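/- There exist constants C > 0 and K > 0 such that the following holds for all sufficiently large x: if C/log x ≤ g ≤ 1/10 and 1/(g·log x) ≤ ε ≤ 1/4, then the number of integers n ≤ x for which φ(n) has no prime divisor in the interval (x^g, x^{g(1+ε)}] is at most K·g^{ε/2}·log(1/g)·x. -/

import Mathlib

namespace TotientSieve

/-- The elementary symmetric sum of degree `i` of the values `x p`, `p ∈ P`. -/
noncomputable def elemSymm {ι : Type*} (P : Finset ι) (x : ι → ℝ) (i : ℕ) : ℝ :=
  ∑ D ∈ P.powersetCard i, ∏ p ∈ D, x p

/-- The alternating sum of the elementary symmetric sums of degree at most `b`. -/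
noncomputable def altSymm {ι : Type*} (P : Finset ι) (x : ι → ℝ) (b : ℕ) : ℝ :=
  ∑ i ∈ Finset.range (b + 1), (-1) ^ i * elemSymm P x i

lemma elemSymm_zero {ι : Type*} (P : Finset ι) (x : ι → ℝ) : elemSymm P x 0 = 1 := by
  simp [elemSymm]

lemma elemSymm_empty {ι : Type*} (x : ι → ℝ) (i : ℕ) :
    elemSymm (∅ : Finset ι) x (i + 1) = 0 := by
  rw [elemSymm, Finset.powersetCard_eq_empty.2 (by simp), Finset.sum_empty]

lemma elemSymm_insert {ι : Type*} [DecidableEq ι] {P : Finset ι} {a : ι} (ha : a ∉ P)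
    (x : ι → ℝ) (i : ℕ) :
    elemSymm (insert a P) x (i + 1) = elemSymm P x (i + 1) + x a * elemSymm P x i := by
  unfold elemSymm
  rw [Finset.powersetCard_succ_insert ha, Finset.sum_union, Finset.sum_image, Finset.mul_sum]
  · congr 1
    refine Finset.sum_congr rfl fun D hD => ?_
    rw [Finset.prod_insert]
    exact fun h => ha ((Finset.mem_powersetCard.1 hD).1 h)
  · intro D hD D' hD' h
    have h1 : a ∉ D := fun h => ha ((Finset.mem_powersetCard.1 hD).1 h)
    have h2 : a ∉ D' := fun h => ha ((Finset.mem_powersetCard.1 hD').1 h)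
    rw [← Finset.erase_insert h1, ← Finset.erase_insert h2, h]
  · rw [Finset.disjoint_left]
    intro D hD hD'
    obtain ⟨D', -, rfl⟩ := Finset.mem_image.1 hD'
    exact ha ((Finset.mem_powersetCard.1 hD).1 (Finset.mem_insert_self _ _))

lemma elemSymm_nonneg {ι : Type*} {P : Finset ι} {x : ι → ℝ} (hx : ∀ p ∈ P, 0 ≤ x p) (i : ℕ) :
    0 ≤ elemSymm P x i :=
  Finset.sum_nonneg fun _ hD => Finset.prod_nonneg fun p hp =>
    hx p ((Finset.mem_powersetCard.1 hD).1 hp)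

lemma pow_add_le_add_pow {s x : ℝ} (hs : 0 ≤ s) (hx : 0 ≤ x) (n : ℕ) :
    s ^ (n + 1) + (n + 1) * x * s ^ n ≤ (s + x) ^ (n + 1) := by
  induction n with
  | zero => simp
  | succ n ih =>
    have h1 : (s + x) ^ (n + 1 + 1) = (s + x) ^ (n + 1) * (s + x) := pow_succ _ _
    have h2 := mul_le_mul_of_nonneg_right ih (add_nonneg hs hx)
    have h3 : 0 ≤ (n + 1) * x * s ^ n * x := by positivity
    rw [h1]
    push_cast
    calc s ^ (n + 1 + 1) + ((n : ℝ) + 1 + 1) * x * s ^ (n + 1)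
        ≤ (s ^ (n + 1) + (n + 1) * x * s ^ n) * (s + x) := by
          ring_nf at h3 ⊢
          linarith
      _ ≤ _ := h2

lemma elemSymm_le_pow_div {ι : Type*} {P : Finset ι} {x : ι → ℝ} (hx : ∀ p ∈ P, 0 ≤ x p)
    (i : ℕ) : elemSymm P x i ≤ (∑ p ∈ P, x p) ^ i / i.factorial := by
  classical
  induction P using Finset.induction_on generalizing i with
  | empty =>
    cases i with
    | zero => simp [elemSymm_zero]
    | succ i => simp [elemSymm_empty]
  | insert a P ha ih =>
    have hP : ∀ p ∈ P, 0 ≤ x p := fun p hp => hx p (Finset.mem_insert_of_mem hp)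
    have hxa : 0 ≤ x a := hx a (Finset.mem_insert_self _ _)
    cases i with
    | zero => simp [elemSymm_zero]
    | succ i =>
      rw [elemSymm_insert ha, Finset.sum_insert ha]
      set s := ∑ p ∈ P, x p with hs
      have hs0 : 0 ≤ s := Finset.sum_nonneg hP
      have h1 := ih hP (i + 1)
      have h2 := mul_le_mul_of_nonneg_left (ih hP i) hxa
      have h3 := pow_add_le_add_pow hs0 hxa i
      have hf : ((i + 1).factorial : ℝ) = (i + 1) * i.factorial := by
        rw [Nat.factorial_succ]; push_cast; ring
      have hf0 : (0 : ℝ) < i.factorial := by exact_mod_cast i.factorial_pos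
      calc _ ≤ s ^ (i + 1) / (i + 1).factorial + x a * (s ^ i / i.factorial) := add_le_add h1 h2
        _ = (s ^ (i + 1) + (i + 1) * x a * s ^ i) / (i + 1).factorial := by
          rw [hf]; field_simp
        _ ≤ (x a + s) ^ (i + 1) / (i + 1).factorial := by
          rw [add_comm (x a)]
          gcongr

lemma altSymm_insert {ι : Type*} [DecidableEq ι] {P : Finset ι} {a : ι} (ha : a ∉ P)
    (x : ι → ℝ) (b : ℕ) :
    altSymm (insert a P) x (b + 1) = altSymm P x (b + 1) - x a * altSymm P x b := by
  unfold altSymm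
  rw [Finset.sum_range_succ', Finset.sum_range_succ' _ (b + 1), Finset.mul_sum]
  simp only [elemSymm_insert ha, elemSymm_zero]
  rw [add_sub_right_comm, ← Finset.sum_sub_distrib]
  congr 1
  refine Finset.sum_congr rfl fun i _ => ?_
  ring

/-- Bonferroni's inequalities. -/
lemma bonferroni {ι : Type*} {P : Finset ι} {x : ι → ℝ} (h0 : ∀ p ∈ P, 0 ≤ x p)
    (h1 : ∀ p ∈ P, x p ≤ 1) (b : ℕ) :
    0 ≤ (-1) ^ b * (altSymm P x b - ∏ p ∈ P, (1 - x p)) ∧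
      (-1) ^ b * (altSymm P x b - ∏ p ∈ P, (1 - x p)) ≤ elemSymm P x (b + 1) := by
  classical
  induction P using Finset.induction_on generalizing b with
  | empty =>
    have : altSymm (∅ : Finset ι) x b = 1 := by
      rw [altSymm, Finset.sum_range_succ', Finset.sum_eq_zero]
      · simp [elemSymm_zero]
      · intro i _
        simp [elemSymm_empty]
    simp [this, elemSymm_empty]
  | insert a P ha ih =>
    have hP0 : ∀ p ∈ P, 0 ≤ x p := fun p hp => h0 p (Finset.mem_insert_of_mem hp)
    have hP1 : ∀ p ∈ P, x p ≤ 1 := fun p hp => h1 p (Finset.mem_insert_of_mem hp)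
    have hxa := h0 a (Finset.mem_insert_self _ _)
    have hxa1 := h1 a (Finset.mem_insert_self _ _)
    rw [Finset.prod_insert ha, elemSymm_insert ha]
    cases b with
    | zero =>
      have e : ∀ Q : Finset ι, altSymm Q x 0 = 1 := fun Q => by simp [altSymm, elemSymm_zero]
      have := ih hP0 hP1 0
      simp only [e, pow_zero, one_mul, elemSymm_zero] at this ⊢
      have hp0 : 0 ≤ ∏ p ∈ P, (1 - x p) :=
        Finset.prod_nonneg fun p hp => by linarith [hP1 p hp]
      have hp1 : ∏ p ∈ P, (1 - x p) ≤ 1 :=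
        Finset.prod_le_one (fun p hp => by linarith [hP1 p hp]) fun p hp => by linarith [hP0 p hp]
      constructor <;> nlinarith
    | succ b =>
      obtain ⟨i1, i2⟩ := ih hP0 hP1 (b + 1)
      obtain ⟨j1, j2⟩ := ih hP0 hP1 b
      rw [altSymm_insert ha]
      have e : (-1 : ℝ) ^ (b + 1) * (altSymm P x (b + 1) - x a * altSymm P x b
            - (1 - x a) * ∏ p ∈ P, (1 - x p))
          = (-1) ^ (b + 1) * (altSymm P x (b + 1) - ∏ p ∈ P, (1 - x p))
            + x a * ((-1) ^ b * (altSymm P x b - ∏ p ∈ P, (1 - x p))) := by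
        ring
      rw [e]
      have k1 := mul_nonneg hxa j1
      have k2 := mul_le_mul_of_nonneg_left j2 hxa
      constructor <;> linarith

/-- The indicator of `p ∣ n`, as a real number. -/
noncomputable def dvdInd (n p : ℕ) : ℝ := if p ∣ n then 1 else 0

lemma dvdInd_nonneg (n p : ℕ) : 0 ≤ dvdInd n p := by unfold dvdInd; split_ifs <;> simp

lemma dvdInd_le_one (n p : ℕ) : dvdInd n p ≤ 1 := by unfold dvdInd; split_ifs <;> simp

lemma prod_dvdInd (D : Finset ℕ) (n : ℕ) :
    ∏ p ∈ D, dvdInd n p = if ∀ p ∈ D, p ∣ n then 1 else 0 := by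
  simp only [dvdInd]
  rw [Finset.prod_ite_zero]
  simp

lemma prod_one_sub_dvdInd (D : Finset ℕ) (n : ℕ) :
    ∏ p ∈ D, (1 - dvdInd n p) = if ∀ p ∈ D, ¬ p ∣ n then 1 else 0 := by
  have : ∀ p, 1 - dvdInd n p = if ¬ p ∣ n then (1 : ℝ) else 0 := fun p => by
    unfold dvdInd; split_ifs <;> simp_all
  simp only [this]
  rw [Finset.prod_ite_zero]
  simp

/-- Twisting a weight with well distributed multiples by an elementary symmetric sum. -/
lemma abs_sum_elemSymm_sub_le {P Q D : Finset ℕ} (hD : D ⊆ P) (hPQ : Disjoint P Q)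
    {S : Finset ℕ} {f : ℕ → ℝ} {H E : ℝ}
    (h : ∀ D ⊆ P ∪ Q, |∑ n ∈ S with ∀ p ∈ D, p ∣ n, f n - H / ∏ p ∈ D, (p : ℝ)| ≤ E) (i : ℕ) :
    |∑ n ∈ S with ∀ p ∈ D, p ∣ n, f n * elemSymm Q (dvdInd n) i
      - H * elemSymm Q (fun p => 1 / (p : ℝ)) i / ∏ p ∈ D, (p : ℝ)| ≤ (Q.card.choose i) * E := by
  have e1 : ∑ n ∈ S with ∀ p ∈ D, p ∣ n, f n * elemSymm Q (dvdInd n) i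
      = ∑ D' ∈ Q.powersetCard i, ∑ n ∈ S with ∀ p ∈ D ∪ D', p ∣ n, f n := by
    simp only [elemSymm, Finset.mul_sum]
    rw [Finset.sum_comm]
    refine Finset.sum_congr rfl fun D' _ => ?_
    simp only [prod_dvdInd, mul_ite, mul_one, mul_zero]
    rw [← Finset.sum_filter, Finset.filter_filter]
    refine Finset.sum_congr ?_ fun _ _ => rfl
    ext n
    simp only [Finset.mem_filter, Finset.mem_union]
    grind
  have e2 : H * elemSymm Q (fun p => 1 / (p : ℝ)) i / ∏ p ∈ D, (p : ℝ)
      = ∑ D' ∈ Q.powersetCard i, H / ∏ p ∈ D ∪ D', (p : ℝ) := by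
    simp only [elemSymm, Finset.mul_sum, Finset.sum_div]
    refine Finset.sum_congr rfl fun D' hD' => ?_
    rw [Finset.prod_union]
    · rw [Finset.prod_div_distrib, Finset.prod_const_one]
      field_simp
    · exact Finset.disjoint_of_subset_left hD
        (Finset.disjoint_of_subset_right (Finset.mem_powersetCard.1 hD').1 hPQ)
  rw [e1, e2, ← Finset.sum_sub_distrib, ← Finset.card_powersetCard, ← nsmul_eq_mul]
  refine (Finset.abs_sum_le_sum_abs _ _).trans (Finset.sum_le_card_nsmul _ _ _ fun D' hD' => ?_)
  exact h _ (Finset.union_subset_union hD (Finset.mem_powersetCard.1 hD').1)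

lemma abs_sum_altSymm_sub_le {P Q D : Finset ℕ} (hD : D ⊆ P) (hPQ : Disjoint P Q)
    {S : Finset ℕ} {f : ℕ → ℝ} {H E : ℝ}
    (h : ∀ D ⊆ P ∪ Q, |∑ n ∈ S with ∀ p ∈ D, p ∣ n, f n - H / ∏ p ∈ D, (p : ℝ)| ≤ E) (b : ℕ) :
    |∑ n ∈ S with ∀ p ∈ D, p ∣ n, f n * altSymm Q (dvdInd n) b
      - H * altSymm Q (fun p => 1 / (p : ℝ)) b / ∏ p ∈ D, (p : ℝ)|
      ≤ (∑ i ∈ Finset.range (b + 1), (Q.card.choose i : ℝ)) * E := by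
  have e : ∑ n ∈ S with ∀ p ∈ D, p ∣ n, f n * altSymm Q (dvdInd n) b
      - H * altSymm Q (fun p => 1 / (p : ℝ)) b / ∏ p ∈ D, (p : ℝ)
      = ∑ i ∈ Finset.range (b + 1), (-1) ^ i * (∑ n ∈ S with ∀ p ∈ D, p ∣ n,
        f n * elemSymm Q (dvdInd n) i
        - H * elemSymm Q (fun p => 1 / (p : ℝ)) i / ∏ p ∈ D, (p : ℝ)) := by
    simp only [altSymm, Finset.mul_sum, Finset.sum_div, mul_sub, Finset.sum_sub_distrib]
    rw [Finset.sum_comm]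
    congr 1
    · exact Finset.sum_congr rfl fun _ _ => Finset.sum_congr rfl fun _ _ => by ring
    · exact Finset.sum_congr rfl fun _ _ => by ring
  rw [e, Finset.sum_mul]
  refine (Finset.abs_sum_le_sum_abs _ _).trans (Finset.sum_le_sum fun i _ => ?_)
  rw [abs_mul, abs_pow, abs_neg, abs_one, one_pow, one_mul]
  exact abs_sum_elemSymm_sub_le hD hPQ h i

lemma sum_range_pow_le {w : ℝ} (hw : 2 ≤ w) (b : ℕ) :
    ∑ i ∈ Finset.range (b + 1), w ^ i ≤ 2 * w ^ b := by
  induction b with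
  | zero => simp
  | succ b ih =>
    rw [Finset.sum_range_succ, pow_succ]
    have : 0 < w ^ b := by positivity
    nlinarith

lemma card_primes_lt_le {w : ℝ} (hw : 1 ≤ w) {P : Finset ℕ}
    (hP : ∀ p ∈ P, p.Prime ∧ (p : ℝ) < w) : (P.card : ℝ) ≤ w := by
  have h : P ⊆ Finset.Icc 1 ⌊w⌋₊ := fun p hp => by
    rw [Finset.mem_Icc]
    exact ⟨(hP p hp).1.one_lt.le, Nat.le_floor (hP p hp).2.le⟩
  calc (P.card : ℝ) ≤ (Finset.Icc 1 ⌊w⌋₊).card := by exact_mod_cast Finset.card_le_card h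
    _ = ⌊w⌋₊ := by simp
    _ ≤ w := Nat.floor_le (by linarith)

lemma exp_neg_two_mul_le {x : ℝ} (h0 : 0 ≤ x) (h1 : x ≤ 1 / 2) : Real.exp (-(2 * x)) ≤ 1 - x := by
  have hpos : 0 < 1 - x := by linarith
  rw [← Real.le_log_iff_exp_le hpos]
  refine le_trans ?_ (Real.one_sub_inv_le_log_of_pos hpos)
  rw [le_sub_iff_add_le, ← le_sub_iff_add_le', inv_le_iff_one_le_mul₀ hpos]
  nlinarith

lemma exp_neg_le_prod_one_sub {P : Finset ℕ} (hP : ∀ p ∈ P, p.Prime) :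
    Real.exp (-(2 * ∑ p ∈ P, 1 / (p : ℝ))) ≤ ∏ p ∈ P, (1 - 1 / (p : ℝ)) := by
  rw [Finset.mul_sum, ← Finset.sum_neg_distrib, Real.exp_sum]
  refine Finset.prod_le_prod (fun _ _ => (Real.exp_pos _).le) fun p hp => ?_
  have h2 : (2 : ℝ) ≤ p := by exact_mod_cast (hP p hp).two_le
  exact exp_neg_two_mul_le (by positivity) (one_div_le_one_div_of_le (by norm_num) h2)

lemma prod_one_sub_pos {P : Finset ℕ} (hP : ∀ p ∈ P, p.Prime) :
    0 < ∏ p ∈ P, (1 - 1 / (p : ℝ)) :=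
  (Real.exp_pos _).trans_le (exp_neg_le_prod_one_sub hP)

set_option maxHeartbeats 1000000 in
/-- The fundamental lemma of the sieve in dimension one. -/
theorem fundamental_lemma {c : ℝ} (hc : ∀ w : ℝ, 2 ≤ w → ∀ P : Finset ℕ,
      (∀ p ∈ P, p.Prime ∧ √w ≤ p ∧ (p : ℝ) < w) → ∑ p ∈ P, 1 / (p : ℝ) ≤ c) :
    ∃ K : ℝ, 1 ≤ K ∧ ∃ b₀ : ℕ, ∀ J b : ℕ, b₀ ≤ b → Even b → ∀ w : ℝ, 1 ≤ w → w ≤ 2 ^ 2 ^ J →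
      ∀ P : Finset ℕ, (∀ p ∈ P, p.Prime ∧ (p : ℝ) < w) →
      ∀ (S : Finset ℕ) (f : ℕ → ℝ) (H E : ℝ), (∀ n ∈ S, 0 ≤ f n) → 0 ≤ H → 0 ≤ E →
      (∀ D ⊆ P, |∑ n ∈ S with ∀ p ∈ D, p ∣ n, f n - H / ∏ p ∈ D, (p : ℝ)| ≤ E) →
      |∑ n ∈ S with ∀ p ∈ P, ¬ p ∣ n, f n - H * ∏ p ∈ P, (1 - 1 / (p : ℝ))|
        ≤ K / 2 ^ b * (H * ∏ p ∈ P, (1 - 1 / (p : ℝ))) + w ^ (2 * b + 8) * E := by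
  have hc0 : 0 ≤ c := by simpa using hc 2 le_rfl ∅ (by simp)
  set K₁ : ℝ := Real.exp (4 * c) with hK₁
  have hK₁1 : 1 ≤ K₁ := Real.one_le_exp (by positivity)
  obtain ⟨b₀, hb₀⟩ := pow_unbounded_of_one_lt K₁ (one_lt_two (α := ℝ))
  refine ⟨8 * K₁, by linarith, b₀, fun J => ?_⟩
  have base : ∀ (b : ℕ) (w : ℝ), 1 ≤ w → w ≤ 2 →
      ∀ P : Finset ℕ, (∀ p ∈ P, p.Prime ∧ (p : ℝ) < w) →
      ∀ (S : Finset ℕ) (f : ℕ → ℝ) (H E : ℝ), 0 ≤ H → 0 ≤ E →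
      (∀ D ⊆ P, |∑ n ∈ S with ∀ p ∈ D, p ∣ n, f n - H / ∏ p ∈ D, (p : ℝ)| ≤ E) →
      |∑ n ∈ S with ∀ p ∈ P, ¬ p ∣ n, f n - H * ∏ p ∈ P, (1 - 1 / (p : ℝ))|
        ≤ 8 * K₁ / 2 ^ b * (H * ∏ p ∈ P, (1 - 1 / (p : ℝ))) + w ^ (2 * b + 8) * E := by
    intro b w hw1 hw2 P hP S f H E hH hE h
    have hPe : P = ∅ := by
      refine Finset.eq_empty_of_forall_notMem fun p hp => ?_
      have h2 : (2 : ℝ) ≤ p := by exact_mod_cast (hP p hp).1.two_le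
      linarith [(hP p hp).2]
    subst hPe
    have := h ∅ (by simp)
    simp only [Finset.notMem_empty, false_imp_iff, implies_true, Finset.filter_true,
      Finset.prod_empty, div_one, mul_one] at this ⊢
    have h1 : 1 * E ≤ w ^ (2 * b + 8) * E :=
      mul_le_mul_of_nonneg_right (one_le_pow₀ hw1) hE
    have h2 : 0 ≤ 8 * K₁ / 2 ^ b * H := by positivity
    linarith
  induction J with
  | zero =>
    intro b _ _ w hw1 hw2 P hP S f H E _ hH hE h
    exact base b w hw1 (by simpa using hw2) P hP S f H E hH hE h
  | succ J ih =>
    intro b hb hbe w hw1 hw2 P hP S f H E hf hH hE h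
    rcases le_total w 2 with hw | hw
    · exact base b w hw1 hw P hP S f H E hH hE h
    set P₁ := P.filter (fun p : ℕ => (p : ℝ) < √w) with hP₁
    set P₂ := P.filter (fun p : ℕ => ¬ (p : ℝ) < √w) with hP₂
    have hdisj : Disjoint P₁ P₂ := Finset.disjoint_filter_filter_not P P _
    have hun : P₁ ∪ P₂ = P := Finset.filter_union_filter_not_eq _ P
    have hP₁p : ∀ p ∈ P₁, p.Prime ∧ (p : ℝ) < √w := fun p hp =>
      ⟨(hP p (Finset.mem_filter.1 hp).1).1, (Finset.mem_filter.1 hp).2⟩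
    have hP₂p : ∀ p ∈ P₂, p.Prime ∧ √w ≤ p ∧ (p : ℝ) < w := fun p hp =>
      ⟨(hP p (Finset.mem_filter.1 hp).1).1, not_lt.1 (Finset.mem_filter.1 hp).2,
        (hP p (Finset.mem_filter.1 hp).1).2⟩
    have hs1 : 1 ≤ √w := Real.one_le_sqrt.2 hw1
    have hs2 : √w ≤ 2 ^ 2 ^ J := by
      rw [Real.sqrt_le_left (by positivity), ← pow_mul, ← pow_succ]
      exact hw2
    rw [← hun] at h
    set T : ℕ → ℝ := fun n => altSymm P₂ (dvdInd n) b with hT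
    set Y : ℕ → ℝ := fun n => elemSymm P₂ (dvdInd n) (b + 1) with hY
    set X : ℕ → ℝ := fun n => ∏ p ∈ P₂, (1 - dvdInd n p) with hX
    set M : ℝ := altSymm P₂ (fun p => 1 / (p : ℝ)) b with hM
    set y : ℝ := elemSymm P₂ (fun p => 1 / (p : ℝ)) (b + 1) with hy
    set v : ℝ := ∏ p ∈ P₂, (1 - 1 / (p : ℝ)) with hv
    set V : ℝ := ∏ p ∈ P₁, (1 - 1 / (p : ℝ)) with hV
    have hV0 : 0 < V := prod_one_sub_pos fun p hp => (hP₁p p hp).1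
    have hv0 : 0 < v := prod_one_sub_pos fun p hp => (hP₂p p hp).1
    have hVv : ∏ p ∈ P, (1 - 1 / (p : ℝ)) = V * v := by
      rw [← hun, Finset.prod_union hdisj]
    have hX0 : ∀ n, 0 ≤ X n := fun n =>
      Finset.prod_nonneg fun p _ => by linarith [dvdInd_le_one n p]
    have hTX : ∀ n, 0 ≤ T n - X n ∧ T n - X n ≤ Y n := fun n => by
      have := bonferroni (P := P₂) (x := dvdInd n) (fun p _ => dvdInd_nonneg n p)
        (fun p _ => dvdInd_le_one n p) b
      rwa [hbe.neg_one_pow, one_mul] at this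
    have hMv : 0 ≤ M - v ∧ M - v ≤ y := by
      have := bonferroni (P := P₂) (x := fun p => 1 / (p : ℝ)) (fun p _ => by positivity)
        (fun p hp => by
          have : (1 : ℝ) ≤ p := by exact_mod_cast (hP₂p p hp).1.one_lt.le
          rw [div_le_one (by linarith)]; exact this) b
      rwa [hbe.neg_one_pow, one_mul] at this
    have hy0 : 0 ≤ y := elemSymm_nonneg (fun p _ => by positivity) _
    have hyr : y ≤ K₁ / 2 ^ b * v := by
      have hsum := hc w hw P₂ hP₂p
      have hsum0 : 0 ≤ ∑ p ∈ P₂, 1 / (p : ℝ) := Finset.sum_nonneg fun _ _ => by positivity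
      have h1 : y ≤ c ^ (b + 1) / (b + 1).factorial :=
        (elemSymm_le_pow_div (fun p _ => by positivity) _).trans (by gcongr)
      have h2 : (2 * c) ^ (b + 1) / (b + 1).factorial ≤ Real.exp (2 * c) :=
        Real.pow_div_factorial_le_exp _ (by positivity) _
      have h3 : Real.exp (-(2 * c)) ≤ v := by
        refine le_trans (Real.exp_le_exp.2 ?_) (exp_neg_le_prod_one_sub fun p hp => (hP₂p p hp).1)
        linarith
      have h4 : K₁ = Real.exp (2 * c) * Real.exp (2 * c) := by
        rw [← Real.exp_add, hK₁]; ring_nf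
      have h5 : Real.exp (2 * c) * Real.exp (-(2 * c)) = 1 := by
        rw [← Real.exp_add]; simp
      have h6 : c ^ (b + 1) / (b + 1).factorial ≤ Real.exp (2 * c) / 2 ^ b := by
        rw [mul_pow] at h2
        rw [le_div_iff₀ (by positivity)]
        refine le_trans ?_ h2
        rw [div_mul_eq_mul_div, mul_comm]
        gcongr
        · norm_num
        · simp
      calc y ≤ Real.exp (2 * c) / 2 ^ b * 1 := by rw [mul_one]; exact h1.trans h6
        _ = K₁ / 2 ^ b * Real.exp (-(2 * c)) := by
          rw [← h5, h4]; ring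
        _ ≤ _ := by gcongr
    set k := P₂.card with hk
    have hkw : (k : ℝ) ≤ w := card_primes_lt_le hw1 fun p hp => ⟨(hP₂p p hp).1, (hP₂p p hp).2.2⟩
    have hchoose : ∀ i, (k.choose i : ℝ) ≤ w ^ i := fun i => by
      calc (k.choose i : ℝ) ≤ (k : ℝ) ^ i := by exact_mod_cast Nat.choose_le_pow k i
        _ ≤ w ^ i := by gcongr
    set cT : ℝ := ∑ i ∈ Finset.range (b + 1), (k.choose i : ℝ) with hcT
    set cY : ℝ := (k.choose (b + 1) : ℝ) with hcY
    have hcTY : cT + cY ≤ w ^ (b + 2) := by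
      have h1 : cT ≤ 2 * w ^ b :=
        (Finset.sum_le_sum fun i _ => hchoose i).trans (sum_range_pow_le hw b)
      have h2 := hchoose (b + 1)
      have h3 : 0 < w ^ b := by positivity
      calc cT + cY ≤ 2 * w ^ b + w ^ (b + 1) := add_le_add h1 h2
        _ ≤ w ^ (b + 2) := by
          rw [pow_succ, pow_add]
          nlinarith [mul_le_mul_of_nonneg_left hw h3.le,
            mul_le_mul_of_nonneg_left hw (mul_nonneg h3.le (by linarith : (0 : ℝ) ≤ w))]
    have hcT0 : 0 ≤ cT := Finset.sum_nonneg fun _ _ => by positivity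
    have hcY0 : 0 ≤ cY := by positivity
    have hbe' : Even (b + 2) := hbe.add (by decide)
    have hM0 : 0 ≤ M := by linarith [hMv.1]
    have hT0 : ∀ n, 0 ≤ T n := fun n => by linarith [(hTX n).1, hX0 n]
    have iA := ih (b + 2) (by omega) hbe' (√w) hs1 hs2 P₁ hP₁p S (fun n => f n * T n) (H * M)
      (cT * E) (fun n hn => mul_nonneg (hf n hn) (hT0 n)) (by positivity) (by positivity)
      (fun D hD => abs_sum_altSymm_sub_le hD hdisj h b)
    have iZ := ih (b + 2) (by omega) hbe' (√w) hs1 hs2 P₁ hP₁p S (fun n => f n * Y n) (H * y)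
      (cY * E) (fun n hn => mul_nonneg (hf n hn) (by linarith [(hTX n).1, (hTX n).2]))
      (by positivity) (by positivity)
      (fun D hD => abs_sum_elemSymm_sub_le hD hdisj h (b + 1))
    have hsw : √w ^ (2 * (b + 2) + 8) = w ^ (b + 6) := by
      rw [show 2 * (b + 2) + 8 = 2 * (b + 6) by ring, pow_mul, Real.sq_sqrt (by linarith)]
    rw [hsw] at iA iZ
    set A := ∑ n ∈ S with ∀ p ∈ P₁, ¬ p ∣ n, f n * T n with hA
    set Z := ∑ n ∈ S with ∀ p ∈ P₁, ¬ p ∣ n, f n * Y n with hZ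
    set R := ∑ n ∈ S with ∀ p ∈ P₁, ¬ p ∣ n, f n * (T n - X n) with hR
    have hR0 : 0 ≤ R := Finset.sum_nonneg fun n hn =>
      mul_nonneg (hf n (Finset.mem_filter.1 hn).1) (hTX n).1
    have hRZ : R ≤ Z := Finset.sum_le_sum fun n hn =>
      mul_le_mul_of_nonneg_left (hTX n).2 (hf n (Finset.mem_filter.1 hn).1)
    have hmain : ∑ n ∈ S with ∀ p ∈ P, ¬ p ∣ n, f n = A - R := by
      rw [hA, hR, ← Finset.sum_sub_distrib]
      have : ∀ n, f n * T n - f n * (T n - X n) = if ∀ p ∈ P₂, ¬ p ∣ n then f n else 0 := by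
        intro n
        have := prod_one_sub_dvdInd P₂ n
        simp only [hX, this]
        split_ifs <;> ring
      simp only [this]
      rw [← Finset.sum_filter, Finset.filter_filter]
      refine Finset.sum_congr ?_ fun _ _ => rfl
      ext n
      simp only [Finset.mem_filter, ← hun, Finset.mem_union]
      grind
    rw [hmain, hVv]
    have hη : 8 * K₁ / 2 ^ (b + 2) = 2 * (K₁ / 2 ^ b) := by
      rw [pow_add]; field_simp; norm_num
    have hη' : 8 * K₁ / 2 ^ b = 8 * (K₁ / 2 ^ b) := by ring
    rw [hη] at iA iZ
    rw [hη']
    set r := K₁ / 2 ^ b with hr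
    have hr0 : 0 < r := by positivity
    have hr1 : r ≤ 1 := by
      rw [hr, div_le_one (by positivity)]
      exact hb₀.le.trans (pow_le_pow_right₀ one_le_two hb)
    have hW : w ^ (b + 6) * (cT * E) + w ^ (b + 6) * (cY * E) ≤ w ^ (2 * b + 8) * E := by
      have : w ^ (2 * b + 8) = w ^ (b + 6) * w ^ (b + 2) := by rw [← pow_add]; ring_nf
      rw [this]
      have h6 : 0 ≤ w ^ (b + 6) := by positivity
      have := mul_le_mul_of_nonneg_right (mul_le_mul_of_nonneg_left hcTY h6) hE
      linarith
    set eT := w ^ (b + 6) * (cT * E) with heT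
    set eY := w ^ (b + 6) * (cY * E) with heY
    have heT0 : 0 ≤ eT := by positivity
    have heY0 : 0 ≤ eY := by positivity
    have hG0 : 0 ≤ H * V := by positivity
    obtain ⟨a1, a2⟩ := abs_le.1 iA
    obtain ⟨-, z2⟩ := abs_le.1 iZ
    set G := H * V with hG
    have g1 : H * M * V = G * M := by rw [hG]; ring
    have g2 : H * y * V = G * y := by rw [hG]; ring
    have g3 : H * (V * v) = G * v := by rw [hG]; ring
    rw [g1] at a1 a2
    rw [g2] at z2
    rw [g3]
    have m1 : G * v ≤ G * M := mul_le_mul_of_nonneg_left (by linarith [hMv.1]) hG0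
    have m2 : G * M ≤ G * v + G * y := by
      rw [← mul_add]; exact mul_le_mul_of_nonneg_left (by linarith [hMv.2]) hG0
    have m3 : G * y ≤ r * (G * v) := by
      calc G * y ≤ G * (r * v) := mul_le_mul_of_nonneg_left hyr hG0
        _ = _ := by ring
    have m0 : 0 ≤ G * v := by positivity
    have m4 : r * (r * (G * v)) ≤ r * (G * v) := by
      have : 0 ≤ r * (G * v) := by positivity
      nlinarith
    have m5 : r * (G * M) ≤ r * (G * v) + r * (G * y) := by
      rw [← mul_add]; exact mul_le_mul_of_nonneg_left m2 hr0.le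
    have m6 : r * (G * y) ≤ r * (r * (G * v)) := mul_le_mul_of_nonneg_left m3 hr0.le
    rw [abs_le]
    constructor <;> linarith

open ArithmeticFunction (vonMangoldt)

/-- Partial summation as a comparison principle. -/
lemma sum_mul_antitone_le {A B : ℕ} {d f : ℕ → ℝ} {m : ℝ}
    (hf : ∀ i, A < i → i < B → f (i + 1) ≤ f i) (hf0 : ∀ i, A < i → i ≤ B → 0 ≤ f i)
    (hm : 0 ≤ m) (hf1 : 0 ≤ f (A + 1)) (hd : ∀ k, A < k → k ≤ B → ∑ n ∈ Finset.Ioc A k, d n ≤ m) :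
    ∑ n ∈ Finset.Ioc A B, d n * f n ≤ m * f (A + 1) := by
  rcases le_or_gt B A with h | h
  · rw [Finset.Ioc_eq_empty (by omega), Finset.sum_empty]; positivity
  have key : ∀ k, A + 1 ≤ k → k ≤ B → ∑ n ∈ Finset.Ioc A k, d n * f n ≤
      (∑ n ∈ Finset.Ioc A k, d n - m) * f k + m * f (A + 1) := by
    intro k hk
    induction k, hk using Nat.le_induction with
    | base =>
      intro _
      simp only [Nat.Ioc_succ_singleton, Finset.sum_singleton]
      exact le_of_eq (by ring)
    | succ k hk ih =>
      intro hkB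
      rw [Finset.sum_Ioc_succ_top (by omega), Finset.sum_Ioc_succ_top (by omega)]
      have h1 := ih (by omega)
      have h2 := hd k (by omega) (by omega)
      have h3 := hf k (by omega) (by omega)
      nlinarith
  have h1 := key B h le_rfl
  have h2 := hd B h le_rfl
  have h3 := hf0 B h le_rfl
  nlinarith

lemma sum_mul_le_sum_mul {A B : ℕ} {u v f : ℕ → ℝ} {m : ℝ}
    (hf : ∀ i, A < i → i < B → f (i + 1) ≤ f i) (hf0 : ∀ i, A < i → i ≤ B → 0 ≤ f i)
    (hm : 0 ≤ m) (hf1 : 0 ≤ f (A + 1))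
    (hd : ∀ k, A < k → k ≤ B → ∑ n ∈ Finset.Ioc A k, u n ≤ ∑ n ∈ Finset.Ioc A k, v n + m) :
    ∑ n ∈ Finset.Ioc A B, u n * f n ≤ ∑ n ∈ Finset.Ioc A B, v n * f n + m * f (A + 1) := by
  have := sum_mul_antitone_le (d := fun n => u n - v n) hf hf0 hm hf1 (fun k h1 h2 => by
    rw [Finset.sum_sub_distrib]; linarith [hd k h1 h2])
  simp only [sub_mul, Finset.sum_sub_distrib] at this
  linarith

lemma log_factorial_eq (N : ℕ) :
    Real.log (N.factorial : ℝ) = ∑ n ∈ Finset.Icc 1 N, Real.log n := by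
  induction N with
  | zero => simp
  | succ N ih =>
    rw [Finset.sum_Icc_succ_top (by omega), ← ih, Nat.factorial_succ, Nat.cast_mul,
      Real.log_mul (by positivity) (by positivity), add_comm]

lemma log_factorial_eq_sum_vonMangoldt (N : ℕ) :
    Real.log (N.factorial : ℝ) = ∑ n ∈ Finset.Icc 1 N, vonMangoldt n * (N / n : ℕ) := by
  rw [log_factorial_eq]
  have h1 : ∀ n ∈ Finset.Icc 1 N, Real.log n =
      ∑ d ∈ Finset.Icc 1 N, if d ∣ n then vonMangoldt d else 0 := by
    intro n hn
    rw [Finset.mem_Icc] at hn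
    rw [← ArithmeticFunction.vonMangoldt_sum, ← Finset.sum_filter]
    refine Finset.sum_congr ?_ fun _ _ => rfl
    ext d
    simp only [Nat.mem_divisors, Finset.mem_filter, Finset.mem_Icc]
    constructor
    · rintro ⟨h, h0⟩
      exact ⟨⟨Nat.pos_of_dvd_of_pos h (by omega), (Nat.le_of_dvd (by omega) h).trans hn.2⟩, h⟩
    · rintro ⟨_, h⟩
      exact ⟨h, by omega⟩
  rw [Finset.sum_congr rfl h1, Finset.sum_comm]
  refine Finset.sum_congr rfl fun d hd => ?_
  rw [← Finset.sum_filter, Finset.sum_const, nsmul_eq_mul, mul_comm]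
  congr 2
  have := Nat.Ioc_filter_dvd_card_eq_div N d
  rwa [← Finset.Icc_add_one_left_eq_Ioc] at this

lemma le_log_factorial (N : ℕ) : N * Real.log N - N ≤ Real.log (N.factorial : ℝ) := by
  rcases Nat.eq_zero_or_pos N with rfl | hN
  · simp
  have h := Real.pow_div_factorial_le_exp (N : ℝ) (by positivity) N
  have h2 := Real.log_le_log (by positivity) h
  rw [Real.log_exp, Real.log_div (by positivity) (by positivity), Real.log_pow] at h2
  linarith

lemma log_factorial_le {N : ℕ} (hN : 1 ≤ N) :
    Real.log (N.factorial : ℝ) ≤ N * Real.log N - N + Real.log N + 1 := by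
  induction N, hN using Nat.le_induction with
  | base => simp
  | succ N hN ih =>
    have hN' : (0 : ℝ) < N := by exact_mod_cast hN
    rw [Nat.factorial_succ, Nat.cast_mul, Real.log_mul (by positivity) (by positivity)]
    have h1 := Real.one_sub_inv_le_log_of_pos (x := ((N + 1 : ℕ) : ℝ) / N) (by positivity)
    rw [Real.log_div (by positivity) (by positivity)] at h1
    have h2 : 1 - (((N + 1 : ℕ) : ℝ) / N)⁻¹ = 1 / (N + 1) := by
      push_cast; field_simp; ring
    rw [h2] at h1
    have h3 := mul_le_mul_of_nonneg_left h1 (by positivity : (0 : ℝ) ≤ N + 1)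
    rw [mul_one_div_cancel (by positivity)] at h3
    push_cast at h3 ⊢
    linarith

lemma abs_log_factorial_div_sub_le {N k : ℕ} (hk : 1 ≤ k) (hN : k ≤ N) :
    |Real.log ((N / k).factorial : ℝ) - (N / k * Real.log (N / k) - N / k)|
      ≤ Real.log N + 1 := by
  set M := N / k with hM
  have hM1 : 1 ≤ M := (Nat.one_le_div_iff (by omega)).2 hN
  have hk0 : (0 : ℝ) < k := by exact_mod_cast hk
  have hM0 : (0 : ℝ) < M := by exact_mod_cast hM1
  have hN0 : (0 : ℝ) < N := by exact_mod_cast (by omega : 0 < N)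
  set t : ℝ := (N : ℝ) / k with ht
  have ht0 : 0 < t := by positivity
  have hMt : (M : ℝ) ≤ t := by
    rw [hM, ht]; exact Nat.cast_div_le
  have htM : t < M + 1 := by
    rw [ht, div_lt_iff₀ hk0]
    have : N < (M + 1) * k := by
      exact (Nat.div_lt_iff_lt_mul (by omega)).1 (Nat.lt_succ_self _)
    exact_mod_cast this
  have hM1' : (1 : ℝ) ≤ M := by exact_mod_cast hM1
  have htN : t ≤ N := by
    rw [ht, div_le_iff₀ hk0]
    have : (1 : ℝ) ≤ k := by exact_mod_cast hk
    nlinarith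
  have hlt : Real.log t ≤ Real.log N := Real.log_le_log ht0 htN
  have hlM : Real.log M ≤ Real.log t := Real.log_le_log hM0 hMt
  have hlM0 : 0 ≤ Real.log M := Real.log_nonneg hM1'
  have h1 := le_log_factorial M
  have h2 := log_factorial_le hM1
  have h3 : M * Real.log t - t ≤ M * Real.log M - M := by
    have := Real.one_sub_inv_le_log_of_pos (x := (M : ℝ) / t) (by positivity)
    rw [Real.log_div hM0.ne' ht0.ne', inv_div] at this
    have := mul_le_mul_of_nonneg_left this hM0.le
    rw [mul_sub, mul_div_cancel₀ _ hM0.ne'] at this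
    linarith
  have h4 : t * Real.log M - M ≤ t * Real.log t - t := by
    have := Real.one_sub_inv_le_log_of_pos (x := t / M) (by positivity)
    rw [Real.log_div ht0.ne' hM0.ne', inv_div] at this
    have := mul_le_mul_of_nonneg_left this ht0.le
    rw [mul_sub, mul_div_cancel₀ _ ht0.ne'] at this
    linarith
  rw [abs_le]
  constructor
  · nlinarith
  · nlinarith

lemma psi_natCast (N : ℕ) : Chebyshev.psi N = ∑ n ∈ Finset.Icc 1 N, vonMangoldt n := by
  simp [Chebyshev.psi, ← Finset.Icc_add_one_left_eq_Ioc]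

lemma log_factorial_div_eq_sum {N k : ℕ} :
    Real.log ((N / k).factorial : ℝ) =
      ∑ n ∈ Finset.Icc 1 N, vonMangoldt n * (N / n / k : ℕ) := by
  rw [log_factorial_eq_sum_vonMangoldt]
  have h : ∀ n, N / k / n = N / n / k := fun n => by
    rw [Nat.div_div_eq_div_mul, Nat.div_div_eq_div_mul, mul_comm]
  simp only [h]
  refine Finset.sum_subset (Finset.Icc_subset_Icc_right (Nat.div_le_self _ _)) fun n hn hn' => ?_
  rw [Finset.mem_Icc] at hn hn'
  have : N / n / k = 0 := by
    rw [← h, Nat.div_eq_zero_iff]; right; omega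
  rw [this]; simp

/-- The constant in Chebyshev's estimates. -/
noncomputable def chebyshevConst : ℝ :=
  Real.log 2 / 2 + Real.log 3 / 3 + Real.log 5 / 5 - Real.log 30 / 30

lemma log_ratio_le {a b m n : ℕ} (ha : 0 < a) (h : a ^ m ≤ b ^ n) :
    m * Real.log a ≤ n * Real.log b := by
  rw [← Real.log_pow, ← Real.log_pow]
  exact Real.log_le_log (by positivity) (by exact_mod_cast h)

lemma chebyshevConst_bounds : 0.9208 ≤ chebyshevConst ∧ chebyshevConst ≤ 0.9234 := by
  have h30 : Real.log 30 = Real.log 2 + Real.log 3 + Real.log 5 := by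
    rw [← Real.log_mul (by norm_num) (by norm_num), ← Real.log_mul (by norm_num) (by norm_num)]
    norm_num
  have h1 := log_ratio_le (a := 2) (b := 3) (m := 19) (n := 12) (by norm_num) (by norm_num)
  have h2 := log_ratio_le (a := 3) (b := 2) (m := 17) (n := 27) (by norm_num) (by norm_num)
  have h3 := log_ratio_le (a := 2) (b := 5) (m := 65) (n := 28) (by norm_num) (by norm_num)
  have h4 := log_ratio_le (a := 5) (b := 2) (m := 3) (n := 7) (by norm_num) (by norm_num)
  have h5 := Real.log_two_gt_d9
  have h6 := Real.log_two_lt_d9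
  push_cast at h1 h2 h3 h4
  unfold chebyshevConst
  rw [h30]
  constructor <;> linarith

lemma abs_chebyshev_combination_sub_le {N : ℕ} (hN : 30 ≤ N) :
    |∑ n ∈ Finset.Icc 1 N, vonMangoldt n *
        ((N / n : ℕ) - (N / n / 2 : ℕ) - (N / n / 3 : ℕ) - (N / n / 5 : ℕ) + (N / n / 30 : ℕ))
      - chebyshevConst * N| ≤ 5 * (Real.log N + 1) := by
  have hN0 : (0 : ℝ) < N := by exact_mod_cast (by omega : 0 < N)
  have e1 := abs_log_factorial_div_sub_le (N := N) (k := 1) (by omega) (by omega)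
  have e2 := abs_log_factorial_div_sub_le (N := N) (k := 2) (by omega) (by omega)
  have e3 := abs_log_factorial_div_sub_le (N := N) (k := 3) (by omega) (by omega)
  have e5 := abs_log_factorial_div_sub_le (N := N) (k := 5) (by omega) (by omega)
  have e30 := abs_log_factorial_div_sub_le (N := N) (k := 30) (by omega) (by omega)
  rw [log_factorial_div_eq_sum] at e1 e2 e3 e5 e30
  simp only [Nat.div_one, Nat.cast_one, div_one] at e1
  rw [Real.log_div hN0.ne' (by norm_num)] at e2 e3 e5 e30
  push_cast at e2 e3 e5 e30
  have hs : ∑ n ∈ Finset.Icc 1 N, vonMangoldt n *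
        ((N / n : ℕ) - (N / n / 2 : ℕ) - (N / n / 3 : ℕ) - (N / n / 5 : ℕ) + (N / n / 30 : ℕ)) =
      ∑ n ∈ Finset.Icc 1 N, vonMangoldt n * (N / n : ℕ)
      - ∑ n ∈ Finset.Icc 1 N, vonMangoldt n * (N / n / 2 : ℕ)
      - ∑ n ∈ Finset.Icc 1 N, vonMangoldt n * (N / n / 3 : ℕ)
      - ∑ n ∈ Finset.Icc 1 N, vonMangoldt n * (N / n / 5 : ℕ)
      + ∑ n ∈ Finset.Icc 1 N, vonMangoldt n * (N / n / 30 : ℕ) := by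
    simp only [← Finset.sum_sub_distrib, ← Finset.sum_add_distrib]
    refine Finset.sum_congr rfl fun n _ => ?_
    ring
  rw [hs]
  rw [abs_le] at *
  unfold chebyshevConst
  constructor <;> linarith [e1.1, e1.2, e2.1, e2.2, e3.1, e3.2, e5.1, e5.2, e30.1, e30.2]

lemma chebyshev_coeff_nonneg (k : ℕ) :
    (0 : ℝ) ≤ (k : ℝ) - (k / 2 : ℕ) - (k / 3 : ℕ) - (k / 5 : ℕ) + (k / 30 : ℕ) := by
  have : k / 2 + k / 3 + k / 5 ≤ k + k / 30 := by omega
  have : ((k / 2 : ℕ) : ℝ) + (k / 3 : ℕ) + (k / 5 : ℕ) ≤ k + (k / 30 : ℕ) := by exact_mod_cast this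
  linarith

lemma chebyshev_coeff_le_one (k : ℕ) :
    (k : ℝ) - (k / 2 : ℕ) - (k / 3 : ℕ) - (k / 5 : ℕ) + (k / 30 : ℕ) ≤ 1 := by
  have : k + k / 30 ≤ k / 2 + k / 3 + k / 5 + 1 := by omega
  have : (k : ℝ) + (k / 30 : ℕ) ≤ (k / 2 : ℕ) + (k / 3 : ℕ) + (k / 5 : ℕ) + 1 := by
    exact_mod_cast this
  linarith

lemma chebyshev_coeff_eq_one {k : ℕ} (h1 : 1 ≤ k) (h5 : k ≤ 5) :
    (k : ℝ) - (k / 2 : ℕ) - (k / 3 : ℕ) - (k / 5 : ℕ) + (k / 30 : ℕ) = 1 := by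
  have : k + k / 30 = k / 2 + k / 3 + k / 5 + 1 := by omega
  have : (k : ℝ) + (k / 30 : ℕ) = (k / 2 : ℕ) + (k / 3 : ℕ) + (k / 5 : ℕ) + 1 := by
    exact_mod_cast this
  linarith

lemma le_psi {N : ℕ} (hN : 30 ≤ N) :
    0.9208 * N - 5 * (Real.log N + 1) ≤ Chebyshev.psi N := by
  have h := (abs_le.1 (abs_chebyshev_combination_sub_le hN)).1
  have h2 : ∑ n ∈ Finset.Icc 1 N, vonMangoldt n *
        ((N / n : ℕ) - (N / n / 2 : ℕ) - (N / n / 3 : ℕ) - (N / n / 5 : ℕ) + (N / n / 30 : ℕ))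
      ≤ Chebyshev.psi N := by
    rw [psi_natCast]
    exact Finset.sum_le_sum fun n _ =>
      mul_le_of_le_one_right ArithmeticFunction.vonMangoldt_nonneg (chebyshev_coeff_le_one _)
  have h3 : 0.9208 * (N : ℝ) ≤ chebyshevConst * N :=
    mul_le_mul_of_nonneg_right chebyshevConst_bounds.1 (by positivity)
  linarith

lemma psi_le_psi_div_six_add {N : ℕ} (hN : 30 ≤ N) :
    Chebyshev.psi N ≤ Chebyshev.psi (N / 6 : ℕ) + 0.9234 * N + 5 * (Real.log N + 1) := by
  have h := (abs_le.1 (abs_chebyshev_combination_sub_le hN)).2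
  have h2 : Chebyshev.psi N - Chebyshev.psi (N / 6 : ℕ) ≤ ∑ n ∈ Finset.Icc 1 N, vonMangoldt n *
        ((N / n : ℕ) - (N / n / 2 : ℕ) - (N / n / 3 : ℕ) - (N / n / 5 : ℕ) + (N / n / 30 : ℕ)) := by
    rw [psi_natCast, psi_natCast]
    have hsub : Finset.Icc 1 (N / 6) ⊆ Finset.Icc 1 N :=
      Finset.Icc_subset_Icc_right (Nat.div_le_self _ _)
    rw [← Finset.sum_sdiff hsub, ← Finset.sum_sdiff hsub, add_sub_cancel_right]
    refine le_add_of_le_of_nonneg ?_ ?_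
    · refine Finset.sum_le_sum fun n hn => ?_
      simp only [Finset.mem_sdiff, Finset.mem_Icc] at hn
      rw [chebyshev_coeff_eq_one, mul_one]
      · exact (Nat.one_le_div_iff (by omega)).2 hn.1.2
      · have : N / n < 6 := by
          rw [Nat.div_lt_iff_lt_mul (by omega)]
          omega
        omega
    · exact Finset.sum_nonneg fun n _ =>
        mul_nonneg ArithmeticFunction.vonMangoldt_nonneg (chebyshev_coeff_nonneg _)
  have h3 : chebyshevConst * N ≤ 0.9234 * (N : ℝ) :=
    mul_le_mul_of_nonneg_right chebyshevConst_bounds.2 (by positivity)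
  linarith

lemma exists_log_le_mul (c : ℝ) (hc : 0 < c) :
    ∃ D : ℝ, 0 ≤ D ∧ ∀ N : ℕ, 5 * (Real.log N + 1) ≤ c * N + D := by
  have h : ∀ t : ℝ, 0 < t → Real.log t ≤ c / 5 * t + (Real.log (5 / c)) := fun t ht => by
    have := Real.log_le_sub_one_of_pos (x := c / 5 * t) (by positivity)
    rw [Real.log_mul (by positivity) ht.ne', Real.log_div hc.ne' (by norm_num)] at this
    rw [Real.log_div (by norm_num) hc.ne']
    linarith
  refine ⟨5 * |Real.log (5 / c)| + 5, by positivity, fun N => ?_⟩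
  have ha := le_abs_self (Real.log (5 / c))
  have hb := abs_nonneg (Real.log (5 / c))
  rcases Nat.eq_zero_or_pos N with rfl | hN
  · simp
  · have := h N (by exact_mod_cast hN)
    linarith

lemma exists_psi_le : ∃ D : ℝ, ∀ N : ℕ, Chebyshev.psi N ≤ 1.11 * N + D := by
  obtain ⟨D₁, hD₁, h1⟩ := exists_log_le_mul 0.0001 (by norm_num)
  have hlog := h1
  set N₀ : ℕ := max 30 ⌈D₁ * 1000⌉₊ with hN₀
  refine ⟨Chebyshev.psi N₀, fun N => ?_⟩
  induction N using Nat.strong_induction_on with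
  | _ N ih =>
    rcases le_or_gt N N₀ with h | h
    · have : Chebyshev.psi N ≤ Chebyshev.psi N₀ := Chebyshev.psi_mono (by exact_mod_cast h)
      have : (0 : ℝ) ≤ N := by positivity
      linarith
    · have h30 : 30 ≤ N := (le_max_left _ _).trans h.le
      have hN1 : D₁ * 1000 ≤ N := by
        refine (Nat.le_ceil _).trans ?_
        exact_mod_cast (le_max_right 30 ⌈D₁ * 1000⌉₊).trans h.le
      have h2 := psi_le_psi_div_six_add h30
      have h3 := ih (N / 6) (by omega)
      have h4 := h1 N
      have h5 : ((N / 6 : ℕ) : ℝ) ≤ N / 6 := Nat.cast_div_le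
      linarith

/-- Chebyshev's estimates. -/
theorem exists_theta_bounds : ∃ D : ℝ, 0 ≤ D ∧ ∀ N : ℕ,
    0.92 * N - D ≤ Chebyshev.theta N ∧ Chebyshev.theta N ≤ 1.11 * N + D := by
  obtain ⟨D₁, h1⟩ := exists_psi_le
  obtain ⟨D₂, hD₂, h2⟩ := exists_log_le_mul 0.0001 (by norm_num)
  obtain ⟨C, hC⟩ := Chebyshev.psi_sub_theta_le_mul_sqrt
  refine ⟨|D₁| + D₂ + 10000 * C ^ 2 + 30, by positivity, fun N => ⟨?_, ?_⟩⟩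
  · have h0 := Chebyshev.theta_nonneg (N : ℝ)
    have hD1 := abs_nonneg D₁
    rcases le_or_gt 30 N with h | h
    · have e1 := le_psi h
      have e2 := h2 N
      have e3 := hC N
      have e4 : C * √(N : ℝ) ≤ 0.0001 * N + 10000 * C ^ 2 := by
        have := Real.sq_sqrt (show (0 : ℝ) ≤ N by positivity)
        nlinarith [sq_nonneg (√(N : ℝ) * 0.01 - 100 * C), sq_nonneg C]
      linarith
    · have : (N : ℝ) ≤ 30 := by exact_mod_cast h.le
      nlinarith [sq_nonneg C]
  · have := h1 N
    have e2 := Chebyshev.theta_le_psi (N : ℝ)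
    have := le_abs_self D₁
    nlinarith [sq_nonneg C]

lemma sum_vonMangoldt_div_bounds {N : ℕ} (hN : 1 ≤ N) :
    Real.log N - 1 ≤ ∑ n ∈ Finset.Icc 1 N, vonMangoldt n / n ∧
      ∑ n ∈ Finset.Icc 1 N, vonMangoldt n / n ≤ Real.log N + 6 := by
  have hN0 : (0 : ℝ) < N := by exact_mod_cast hN
  have h1 := log_factorial_eq_sum_vonMangoldt N
  have h2 := le_log_factorial N
  have h3 : Real.log (N.factorial : ℝ) ≤ N * Real.log N := by
    rw [← Real.log_pow]
    exact Real.log_le_log (by positivity) (by exact_mod_cast Nat.factorial_le_pow N)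
  have h4 := Chebyshev.psi_le_const_mul_self hN0.le
  have h5 : Real.log 4 + 4 ≤ 6 := by
    have : Real.log 4 = 2 * Real.log 2 := by
      rw [show (4 : ℝ) = 2 ^ 2 by norm_num, Real.log_pow]; norm_num
    linarith [Real.log_two_lt_d9]
  have h6 : Real.log (N.factorial : ℝ) ≤ N * ∑ n ∈ Finset.Icc 1 N, vonMangoldt n / n := by
    rw [h1, Finset.mul_sum]
    refine Finset.sum_le_sum fun n hn => ?_
    have : ((N / n : ℕ) : ℝ) ≤ N / n := Nat.cast_div_le
    calc vonMangoldt n * ((N / n : ℕ) : ℝ) ≤ vonMangoldt n * (N / n) :=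
          mul_le_mul_of_nonneg_left this ArithmeticFunction.vonMangoldt_nonneg
      _ = _ := by ring
  have h7 : N * ∑ n ∈ Finset.Icc 1 N, vonMangoldt n / n ≤
      Real.log (N.factorial : ℝ) + Chebyshev.psi N := by
    rw [h1, psi_natCast, Finset.mul_sum, ← Finset.sum_add_distrib]
    refine Finset.sum_le_sum fun n hn => ?_
    have hn1 := (Finset.mem_Icc.1 hn).1
    have hn0 : (0 : ℝ) < n := by exact_mod_cast hn1
    have : (N : ℝ) / n ≤ (N / n : ℕ) + 1 := by
      rw [div_le_iff₀ hn0]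
      have : N < (N / n + 1) * n := (Nat.div_lt_iff_lt_mul (by omega)).1 (Nat.lt_succ_self _)
      exact_mod_cast this.le
    calc N * (vonMangoldt n / n) = vonMangoldt n * (N / n) := by ring
      _ ≤ vonMangoldt n * ((N / n : ℕ) + 1) :=
          mul_le_mul_of_nonneg_left this ArithmeticFunction.vonMangoldt_nonneg
      _ = _ := by ring
  constructor
  · have : N * (Real.log N - 1) ≤ N * ∑ n ∈ Finset.Icc 1 N, vonMangoldt n / n := by linarith
    exact le_of_mul_le_mul_left this hN0
  · have : N * ∑ n ∈ Finset.Icc 1 N, vonMangoldt n / n ≤ N * (Real.log N + 6) := by nlinarith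
    exact le_of_mul_le_mul_left this hN0

lemma inv_mul_sqrt_le {k : ℕ} (hk : 2 ≤ k) :
    (√k - √(k - 1)) / (k : ℝ) ≤ 2 / √(k - 1) - 2 / √k := by
  have hk' : (2 : ℝ) ≤ k := by exact_mod_cast hk
  have h1 : 0 < √((k : ℝ) - 1) := Real.sqrt_pos.2 (by linarith)
  have h2 : √((k : ℝ) - 1) ≤ √k := Real.sqrt_le_sqrt (by linarith)
  have h3 : √(k : ℝ) ^ 2 = k := Real.sq_sqrt (by linarith)
  have h4 : 0 < √(k : ℝ) := h1.trans_le h2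
  have : 2 / √((k : ℝ) - 1) - 2 / √k = 2 * (√k - √((k : ℝ) - 1)) / (√((k : ℝ) - 1) * √k) := by
    field_simp
  rw [this, div_le_div_iff₀ (by linarith) (by positivity)]
  have h5 : √((k : ℝ) - 1) * √k ≤ 2 * k := by nlinarith
  have h6 : 0 ≤ √(k : ℝ) - √((k : ℝ) - 1) := by linarith
  nlinarith

/-- The contribution of proper prime powers to `∑ Λ(n) / n` is small. -/
lemma exists_sum_vonMangoldt_not_prime_le : ∃ C : ℝ, 0 ≤ C ∧ ∀ A B : ℕ, 1 ≤ A →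
    ∑ n ∈ Finset.Ioc A B with ¬ n.Prime, vonMangoldt n / n ≤ C / √A := by
  obtain ⟨C, hC⟩ := Chebyshev.psi_sub_theta_le_mul_sqrt
  have hC0 : 0 ≤ C := by
    have h := hC 1
    have := Chebyshev.theta_le_psi 1
    rw [Real.sqrt_one, mul_one] at h
    linarith
  refine ⟨3 * C, by positivity, fun A B hA => ?_⟩
  have hA0 : (0 : ℝ) < A := by exact_mod_cast hA
  have hsA : 0 < √(A : ℝ) := Real.sqrt_pos.2 hA0
  rcases le_or_gt B A with hAB | hAB
  · rw [Finset.Ioc_eq_empty (by omega)]; simp; positivity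
  have key := sum_mul_le_sum_mul (A := A) (B := B)
    (u := fun n => if n.Prime then 0 else vonMangoldt n)
    (v := fun n => C * (√(n : ℝ) - √((n : ℝ) - 1)))
    (f := fun n => 1 / (n : ℝ)) (m := C * √A) (fun i h1 h2 => by
      have : (0 : ℝ) < i := by exact_mod_cast (by omega : 0 < i)
      push_cast
      gcongr
      linarith) (fun i _ _ => by positivity) (by positivity) (by positivity)
    (fun k h1 h2 => by
      have e1 : ∑ n ∈ Finset.Ioc A k, C * (√(n : ℝ) - √((n : ℝ) - 1)) = C * (√k - √A) := by
        rw [← Finset.mul_sum]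
        congr 1
        induction k, h1 using Nat.le_induction with
        | base => simp
        | succ k hk ih =>
          rw [Finset.sum_Ioc_succ_top (by omega), ih (by omega)]
          push_cast
          rw [add_sub_cancel_right]; ring
      have e2 := hC k
      rw [Chebyshev.psi_sub_theta_eq_sum_not_prime, Nat.floor_natCast, Finset.sum_filter] at e2
      have e3 : ∑ n ∈ Finset.Ioc A k, (if n.Prime then 0 else vonMangoldt n) ≤
          ∑ n ∈ Finset.Ioc 0 k, (if ¬ n.Prime then vonMangoldt n else 0) := by
        simp only [ite_not]
        refine Finset.sum_le_sum_of_subset_of_nonneg (Finset.Ioc_subset_Ioc_left (by omega)) ?_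
        intro i _ _
        split_ifs
        · exact le_rfl
        · exact ArithmeticFunction.vonMangoldt_nonneg
      rw [e1]
      linarith)
  have e1 : ∑ n ∈ Finset.Ioc A B with ¬ n.Prime, vonMangoldt n / n =
      ∑ n ∈ Finset.Ioc A B, (if n.Prime then 0 else vonMangoldt n) * (1 / (n : ℝ)) := by
    rw [Finset.sum_filter]
    refine Finset.sum_congr rfl fun n _ => ?_
    split_ifs <;> simp_all [div_eq_mul_inv]
  have e2 : ∀ k, A + 1 ≤ k → ∑ n ∈ Finset.Ioc A k, C * (√(n : ℝ) - √((n : ℝ) - 1)) * (1 / (n : ℝ))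
      ≤ C * (2 / √A - 2 / √k) := by
    intro k hk
    induction k, hk using Nat.le_induction with
    | base =>
      have := inv_mul_sqrt_le (k := A + 1) (by omega)
      push_cast at this
      rw [add_sub_cancel_right] at this
      simp only [Nat.Ioc_succ_singleton, Finset.sum_singleton]
      push_cast
      rw [add_sub_cancel_right, mul_assoc, mul_one_div]
      exact mul_le_mul_of_nonneg_left this hC0
    | succ k hk ih =>
      rw [Finset.sum_Ioc_succ_top (by omega)]
      have := inv_mul_sqrt_le (k := k + 1) (by omega)
      push_cast at this ⊢
      rw [add_sub_cancel_right] at this ⊢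
      rw [mul_assoc, mul_one_div]
      have := mul_le_mul_of_nonneg_left this hC0
      linarith
  rw [e1]
  refine key.trans ?_
  have h1 := e2 B hAB
  have h2 : C * √(A : ℝ) * (1 / ((A + 1 : ℕ) : ℝ)) ≤ C / √A := by
    rw [mul_one_div, div_le_div_iff₀ (by positivity) hsA]
    push_cast
    have := Real.mul_self_sqrt hA0.le
    calc C * √(A : ℝ) * √A = C * A := by rw [mul_assoc, this]
      _ ≤ C * (A + 1) := by gcongr; linarith
  have h3 : 0 ≤ C * (2 / √(B : ℝ)) := by positivity
  have h4 : 3 * C / √(A : ℝ) = C * (2 / √A) + C / √A := by ring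
  rw [h4]
  linarith

/-- Mertens' first theorem. -/
theorem exists_mertens_bounds : ∃ C : ℝ, 0 ≤ C ∧ ∀ N : ℕ, 1 ≤ N →
    Real.log N - C ≤ ∑ p ∈ Finset.Icc 1 N with p.Prime, Real.log p / p ∧
      ∑ p ∈ Finset.Icc 1 N with p.Prime, Real.log p / p ≤ Real.log N + C := by
  obtain ⟨C, hC0, hC⟩ := exists_sum_vonMangoldt_not_prime_le
  refine ⟨C + 6, by linarith, fun N hN => ?_⟩
  obtain ⟨h1, h2⟩ := sum_vonMangoldt_div_bounds hN
  have h3 := hC 1 N le_rfl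
  have h4 : ∑ n ∈ Finset.Icc 1 N with ¬ n.Prime, vonMangoldt n / n =
      ∑ n ∈ Finset.Ioc 1 N with ¬ n.Prime, vonMangoldt n / n := by
    rw [Finset.sum_filter, Finset.sum_filter, ← Finset.add_sum_Ioc_eq_sum_Icc hN]
    simp
  have h5 : ∑ p ∈ Finset.Icc 1 N with p.Prime, vonMangoldt p / p =
      ∑ p ∈ Finset.Icc 1 N with p.Prime, Real.log p / p :=
    Finset.sum_congr rfl fun p hp => by
      rw [ArithmeticFunction.vonMangoldt_apply_prime (Finset.mem_filter.1 hp).2]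
  have h6 := Finset.sum_filter_add_sum_filter_not (Finset.Icc 1 N) Nat.Prime
    (fun n => vonMangoldt n / (n : ℝ))
  have h7 : 0 ≤ ∑ n ∈ Finset.Icc 1 N with ¬ n.Prime, vonMangoldt n / n :=
    Finset.sum_nonneg fun n _ => div_nonneg ArithmeticFunction.vonMangoldt_nonneg (by positivity)
  rw [Nat.cast_one, Real.sqrt_one, div_one] at h3
  constructor <;> linarith

lemma exists_sum_log_div_le : ∃ C : ℝ, 0 ≤ C ∧ ∀ a w : ℝ, 1 < a → a ≤ w → ∀ P : Finset ℕ,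
    (∀ p ∈ P, p.Prime ∧ a ≤ p ∧ (p : ℝ) ≤ w) →
    ∑ p ∈ P, Real.log p / p ≤ Real.log w - Real.log a + C := by
  obtain ⟨C, hC0, hC⟩ := exists_mertens_bounds
  refine ⟨2 * C + Real.log 2, by positivity, fun a w ha haw P hP => ?_⟩
  set A := ⌈a⌉₊ - 1 with hA
  set B := ⌊w⌋₊ with hB
  have hc1 : 1 < ⌈a⌉₊ := by rw [Nat.lt_ceil]; exact_mod_cast ha
  have hA1 : 1 ≤ A := by omega
  have hAa : a ≤ A + 1 := by
    have : ((A + 1 : ℕ) : ℝ) = ⌈a⌉₊ := by congr 1; omega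
    push_cast at this
    rw [this]; exact Nat.le_ceil _
  have hAlt : (A : ℝ) < a := by rw [← Nat.lt_ceil]; omega
  have hB1 : A ≤ B := by rw [hB, Nat.le_floor_iff (by linarith)]; linarith
  have hBw : (B : ℝ) ≤ w := Nat.floor_le (by linarith)
  have hsub : P ⊆ (Finset.Icc 1 B).filter Nat.Prime \ (Finset.Icc 1 A).filter Nat.Prime := by
    intro p hp
    obtain ⟨h1, h2, h3⟩ := hP p hp
    have : p ≤ B := Nat.le_floor h3
    have : A < p := by
      have := Nat.ceil_le.2 h2
      omega
    simp only [Finset.mem_sdiff, Finset.mem_filter, Finset.mem_Icc]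
    exact ⟨⟨⟨h1.one_lt.le, by assumption⟩, h1⟩, fun h => by omega⟩
  have h1 : ∑ p ∈ P, Real.log p / p ≤ _ := Finset.sum_le_sum_of_subset_of_nonneg hsub
    fun p _ _ => div_nonneg (Real.log_natCast_nonneg p) (by positivity)
  rw [← add_le_add_iff_right (∑ p ∈ (Finset.Icc 1 A).filter Nat.Prime, Real.log p / p),
    Finset.sum_sdiff (Finset.filter_subset_filter _ (Finset.Icc_subset_Icc_right hB1))] at h1
  have h2 := (hC B (by omega)).2
  have h3 := (hC A hA1).1
  have hA0 : (1 : ℝ) ≤ A := by exact_mod_cast hA1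
  have h4 : Real.log B ≤ Real.log w :=
    Real.log_le_log (by exact_mod_cast (by omega : 0 < B)) hBw
  have h5 : Real.log a ≤ Real.log 2 + Real.log A := by
    rw [← Real.log_mul (by norm_num) (by linarith)]
    exact Real.log_le_log (by linarith) (by linarith)
  linarith

lemma exists_sum_inv_le : ∃ c : ℝ, ∀ w : ℝ, 2 ≤ w → ∀ P : Finset ℕ,
    (∀ p ∈ P, p.Prime ∧ √w ≤ p ∧ (p : ℝ) < w) → ∑ p ∈ P, 1 / (p : ℝ) ≤ c := by
  obtain ⟨C, hC0, hC⟩ := exists_sum_log_div_le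
  refine ⟨1 + 2 * C / Real.log 2, fun w hw P hP => ?_⟩
  have hl2 : 0 < Real.log 2 := Real.log_pos (by norm_num)
  have hlw : Real.log 2 ≤ Real.log w := Real.log_le_log (by norm_num) hw
  have hs1 : 1 < √w := by rw [Real.lt_sqrt (by norm_num)]; linarith
  have hsw : √w ≤ w := by
    rw [Real.sqrt_le_left (by linarith)]; nlinarith
  have h1 := hC (√w) w hs1 hsw P fun p hp => ⟨(hP p hp).1, (hP p hp).2.1, (hP p hp).2.2.le⟩
  have hls : Real.log (√w) = Real.log w / 2 := Real.log_sqrt (by linarith)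
  have h2 : ∑ p ∈ P, 1 / (p : ℝ) * (Real.log w / 2) ≤ ∑ p ∈ P, Real.log p / p := by
    refine Finset.sum_le_sum fun p hp => ?_
    rw [one_div_mul_eq_div, ← hls]
    gcongr
    · exact (hP p hp).2.1
  rw [← Finset.sum_mul] at h2
  have h3 : 2 * C / Real.log w ≤ 2 * C / Real.log 2 := by gcongr
  have h4 : ∑ p ∈ P, 1 / (p : ℝ) ≤ 1 + 2 * C / Real.log w := by
    have hw0 : 0 < Real.log w := by linarith
    have : 1 + 2 * C / Real.log w = (Real.log w / 2 + C) / (Real.log w / 2) := by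
      field_simp
    rw [this, le_div_iff₀ (by linarith)]
    linarith
  linarith

/-- The primes below `w`. -/
noncomputable def sievePrimes (w : ℝ) : Finset ℕ := (Finset.range ⌈w⌉₊).filter Nat.Prime

lemma mem_sievePrimes {w : ℝ} {p : ℕ} : p ∈ sievePrimes w ↔ p.Prime ∧ (p : ℝ) < w := by
  simp [sievePrimes, Nat.lt_ceil, and_comm]

/-- The product of `1 - 1 / p` over the primes `p < w`. -/
noncomputable def mertensProd (w : ℝ) : ℝ := ∏ p ∈ sievePrimes w, (1 - 1 / (p : ℝ))

lemma mertensProd_pos (w : ℝ) : 0 < mertensProd w :=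
  prod_one_sub_pos fun _ hp => (mem_sievePrimes.1 hp).1

lemma sum_inv_le_prod {T s : Finset ℕ} (hT0 : ∀ n ∈ T, n ≠ 0)
    (hT : ∀ n ∈ T, ∀ p, p.Prime → p ∣ n → p ∈ s) :
    ∑ n ∈ T, 1 / (n : ℝ) ≤ ∏ p ∈ s with p.Prime, (1 - 1 / (p : ℝ))⁻¹ := by
  let f : ℕ →* ℝ :=
    { toFun := fun n => 1 / (n : ℝ)
      map_one' := by simp
      map_mul' := fun m n => by push_cast; rw [one_div_mul_one_div] }
  have hf : ∀ n, f n = 1 / (n : ℝ) := fun _ => rfl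
  obtain ⟨h1, h2⟩ := EulerProduct.summable_and_hasSum_factoredNumbers_prod_filter_prime_geometric
    (f := f) (fun {p} hp => by
      have : (1 : ℝ) < p := by exact_mod_cast hp.one_lt
      rw [hf, Real.norm_of_nonneg (by positivity), div_lt_one (by linarith)]
      exact this) s
  have hmem : ∀ n ∈ T, n ∈ Nat.factoredNumbers s := fun n hn =>
    Nat.mem_factoredNumbers_of_primeFactors_subset (hT0 n hn) fun p hp =>
      hT n hn p (Nat.prime_of_mem_primeFactors hp) (Nat.dvd_of_mem_primeFactors hp)
  have h3 := sum_le_hasSum (T.attach.map ⟨fun n => (⟨n.1, hmem n.1 n.2⟩ : Nat.factoredNumbers s),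
    fun a b h => Subtype.ext (congrArg (fun z => z.1) h)⟩) (fun i _ => by
      rw [hf]; positivity) h2
  rw [Finset.sum_map] at h3
  exact (Finset.sum_attach T (fun n => 1 / (n : ℝ))).symm.trans_le h3

lemma mertensProd_le {w : ℝ} (hw : 1 < w) : mertensProd w ≤ 1 / Real.log w := by
  have hl : 0 < Real.log w := Real.log_pos hw
  have hc : 1 < ⌈w⌉₊ := by rw [Nat.lt_ceil]; exact_mod_cast hw
  have h1 := sum_inv_le_prod (T := Finset.Icc 1 (⌈w⌉₊ - 1)) (s := Finset.range ⌈w⌉₊)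
    (fun n hn => by rw [Finset.mem_Icc] at hn; omega)
    (fun n hn p hp hpn => by
      rw [Finset.mem_Icc] at hn
      have := Nat.le_of_dvd (by omega) hpn
      rw [Finset.mem_range]; omega)
  have h2 := log_add_one_le_harmonic (⌈w⌉₊ - 1)
  rw [harmonic_eq_sum_Icc] at h2
  push_cast at h2
  have h3 : Real.log w ≤ Real.log ((⌈w⌉₊ - 1 : ℕ) + 1) := by
    refine Real.log_le_log (by linarith) ?_
    have : (((⌈w⌉₊ - 1 + 1 : ℕ)) : ℝ) = ⌈w⌉₊ := by congr 1; omega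
    push_cast at this
    rw [this]; exact Nat.le_ceil _
  rw [Finset.prod_inv_distrib] at h1
  have h4 : (∏ p ∈ Finset.range ⌈w⌉₊ with p.Prime, (1 - 1 / (p : ℝ))) = mertensProd w := rfl
  rw [h4] at h1
  simp only [one_div] at h1
  rw [le_one_div (mertensProd_pos w) hl, one_div]
  exact h3.trans (h2.trans h1)

lemma sum_inv_mul_pred_le (N : ℕ) : ∑ n ∈ Finset.Ioc 1 N, 1 / ((n : ℝ) * (n - 1)) ≤ 1 := by
  have : ∀ N : ℕ, 1 ≤ N → ∑ n ∈ Finset.Ioc 1 N, 1 / ((n : ℝ) * (n - 1)) ≤ 1 - 1 / N := by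
    intro N hN
    induction N, hN using Nat.le_induction with
    | base => simp
    | succ N hN ih =>
      rw [Finset.sum_Ioc_succ_top hN]
      have h0 : (0 : ℝ) < N := by exact_mod_cast hN
      have : 1 / (((N + 1 : ℕ) : ℝ) * (((N + 1 : ℕ) : ℝ) - 1)) = 1 / N - 1 / ((N + 1 : ℕ) : ℝ) := by
        push_cast; rw [add_sub_cancel_right]; field_simp; ring
      linarith
  rcases Nat.eq_zero_or_pos N with rfl | h
  · simp
  · have h1 := this N h
    have : (0 : ℝ) ≤ 1 / N := by positivity
    linarith

lemma prod_inv_one_sub_le {P : Finset ℕ} (hP : ∀ p ∈ P, p.Prime) :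
    ∏ p ∈ P, (1 - 1 / (p : ℝ))⁻¹ ≤ Real.exp (∑ p ∈ P, 1 / (p : ℝ) + 1) := by
  have h1 : ∑ p ∈ P, 1 / ((p : ℝ) * (p - 1)) ≤ 1 := by
    refine le_trans (Finset.sum_le_sum_of_subset_of_nonneg
      (t := Finset.Ioc 1 (P.sup id)) (fun p hp => ?_) fun n hn _ => ?_) (sum_inv_mul_pred_le _)
    · rw [Finset.mem_Ioc]
      exact ⟨(hP p hp).one_lt, Finset.le_sup (f := id) hp⟩
    · have : (1 : ℝ) < n := by exact_mod_cast (Finset.mem_Ioc.1 hn).1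
      have : 0 < (n : ℝ) * (n - 1) := mul_pos (by linarith) (by linarith)
      positivity
  calc ∏ p ∈ P, (1 - 1 / (p : ℝ))⁻¹ ≤ ∏ p ∈ P, Real.exp (1 / p + 1 / ((p : ℝ) * (p - 1))) := by
        refine Finset.prod_le_prod (fun p hp => ?_) fun p hp => ?_
        · have : (1 : ℝ) ≤ p := by exact_mod_cast (hP p hp).one_lt.le
          have : 1 / (p : ℝ) ≤ 1 := by rw [div_le_one (by linarith)]; exact this
          exact inv_nonneg.2 (by linarith)
        · have h1 : (1 : ℝ) < p := by exact_mod_cast (hP p hp).one_lt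
          have h2 : (p : ℝ) - 1 ≠ 0 := by linarith
          have h3 : (p : ℝ) ≠ 0 := by linarith
          have : (1 - 1 / (p : ℝ))⁻¹ = 1 / p + 1 / ((p : ℝ) * (p - 1)) + 1 := by
            field_simp; ring
          rw [this]
          exact Real.add_one_le_exp _
    _ = Real.exp (∑ p ∈ P, 1 / (p : ℝ) + ∑ p ∈ P, 1 / ((p : ℝ) * (p - 1))) := by
        rw [← Finset.sum_add_distrib, Real.exp_sum]
    _ ≤ _ := Real.exp_le_exp.2 (by linarith)

/-- The upper bound in Mertens' second theorem. -/
lemma exists_sum_prime_inv_le : ∃ C : ℝ, ∀ N : ℕ, 2 ≤ N →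
    ∑ p ∈ Finset.Icc 1 N with p.Prime, 1 / (p : ℝ) ≤ Real.log (Real.log N) + C := by
  obtain ⟨C, hC0, hC⟩ := exists_mertens_bounds
  refine ⟨1 - Real.log (Real.log 2) + C * (1 / Real.log 2), fun N hN => ?_⟩
  have hl2 : 0 < Real.log 2 := Real.log_pos (by norm_num)
  have hlog : ∀ i : ℕ, 1 < i → 0 < Real.log i := fun i hi =>
    Real.log_pos (by exact_mod_cast hi)
  have key := sum_mul_le_sum_mul (A := 1) (B := N)
    (u := fun n => if n.Prime then Real.log n / n else 0)
    (v := fun n => Real.log n - Real.log ((n : ℝ) - 1))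
    (f := fun n => 1 / Real.log n) (m := C) (fun i h1 h2 => by
      have : (0 : ℝ) < i := by exact_mod_cast (by omega : 0 < i)
      have := hlog i h1
      push_cast
      gcongr
      linarith) (fun i h1 _ => by have := hlog i h1; positivity) hC0 (by
        have := hlog 2 (by norm_num); norm_num; positivity)
    (fun k h1 h2 => by
      have e1 : ∑ n ∈ Finset.Ioc 1 k, (Real.log n - Real.log ((n : ℝ) - 1)) = Real.log k := by
        clear h2
        induction k, h1 using Nat.le_induction with
        | base => norm_num
        | succ k hk ih =>
          rw [Finset.sum_Ioc_succ_top (by omega), ih]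
          push_cast
          rw [add_sub_cancel_right]; ring
      have e2 := (hC k (by omega)).2
      rw [Finset.sum_filter, ← Finset.add_sum_Ioc_eq_sum_Icc (by omega)] at e2
      simp only [Nat.not_prime_one, if_false, zero_add] at e2
      rw [e1]
      exact e2)
  have e1 : ∑ p ∈ Finset.Icc 1 N with p.Prime, 1 / (p : ℝ) =
      ∑ n ∈ Finset.Ioc 1 N, (if n.Prime then Real.log n / n else 0) * (1 / Real.log n) := by
    rw [Finset.sum_filter, ← Finset.add_sum_Ioc_eq_sum_Icc (by omega)]
    simp only [Nat.not_prime_one, if_false, zero_add]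
    refine Finset.sum_congr rfl fun n hn => ?_
    have := hlog n (Finset.mem_Ioc.1 hn).1
    split_ifs
    · field_simp
    · simp
  have e2 : ∀ k : ℕ, 2 ≤ k → ∑ n ∈ Finset.Ioc 1 k,
      (Real.log n - Real.log ((n : ℝ) - 1)) * (1 / Real.log n) ≤
      1 + (Real.log (Real.log k) - Real.log (Real.log 2)) := by
    intro k hk
    induction k, hk using Nat.le_induction with
    | base =>
      norm_num
    | succ k hk ih =>
      rw [Finset.sum_Ioc_succ_top (by omega)]
      have h1 := hlog k (by omega)
      have h2 := hlog (k + 1) (by omega)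
      have h3 := Real.one_sub_inv_le_log_of_pos (x := Real.log (k + 1 : ℕ) / Real.log k)
        (by positivity)
      rw [Real.log_div h2.ne' h1.ne', inv_div] at h3
      have h4 : (Real.log ((k + 1 : ℕ) : ℝ) - Real.log (((k + 1 : ℕ) : ℝ) - 1)) *
          (1 / Real.log ((k + 1 : ℕ) : ℝ)) = 1 - Real.log k / Real.log (k + 1 : ℕ) := by
        have : (((k + 1 : ℕ) : ℝ) - 1) = k := by push_cast; ring
        rw [this]
        field_simp
      rw [h4]
      linarith
  have e3 := e2 N hN
  have e4 : ((1 + 1 : ℕ) : ℝ) = 2 := by norm_num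
  rw [e4] at key
  rw [e1]
  linarith

/-- The primes in `(y, y ^ (1 + ε)]`. -/
noncomputable def primesIoc (y ε : ℝ) : Finset ℕ :=
  (Finset.Ioc ⌊y⌋₊ ⌊y ^ (1 + ε)⌋₊).filter Nat.Prime

lemma mem_primesIoc {y ε : ℝ} (hy : 0 ≤ y) {p : ℕ} :
    p ∈ primesIoc y ε ↔ p.Prime ∧ y < p ∧ (p : ℝ) ≤ y ^ (1 + ε) := by
  simp [primesIoc, Nat.floor_lt hy, Nat.le_floor_iff (Real.rpow_nonneg hy _), and_comm]

lemma le_sum_Ioc_inv {A B : ℕ} (hAB : A ≤ B) :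
    Real.log (B + 1) - Real.log (A + 1) ≤ ∑ n ∈ Finset.Ioc A B, 1 / (n : ℝ) := by
  induction B, hAB using Nat.le_induction with
  | base => simp
  | succ B hB ih =>
    rw [Finset.sum_Ioc_succ_top (by omega)]
    have h := Real.log_le_sub_one_of_pos (x := ((B : ℝ) + 1 + 1) / (B + 1)) (by positivity)
    rw [Real.log_div (by positivity) (by positivity)] at h
    have : ((B : ℝ) + 1 + 1) / (B + 1) - 1 = 1 / (B + 1) := by field_simp; ring
    push_cast
    linarith

lemma exists_sum_primesIoc_bounds : ∃ C : ℝ, 1 ≤ C ∧ ∀ y ε : ℝ, 1 < y → C ≤ Real.log y →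
    1 / Real.log y ≤ ε → ε ≤ 1 / 4 →
    0.69 * ε ≤ ∑ q ∈ primesIoc y ε, 1 / ((q : ℝ) - 1) ∧
      ∑ q ∈ primesIoc y ε, 1 / ((q : ℝ) - 1) ≤ 1 := by
  obtain ⟨D, hD0, hD⟩ := exists_theta_bounds
  obtain ⟨C, hC0, hC⟩ := exists_sum_log_div_le
  refine ⟨68 + 200 * (2 * D + 1) + 10 * C, by linarith, fun y ε hy1 hy hε1 hε2 => ?_⟩
  set a := Real.log y with ha
  have ha0 : 0 < a := by linarith
  have hy0 : 0 < y := by linarith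
  have hay : a ≤ y := by linarith [Real.log_le_sub_one_of_pos hy0]
  have hv : 1 ≤ ε * a := by rwa [div_le_iff₀ ha0] at hε1
  have hε0 : 0 < ε := lt_of_lt_of_le (by positivity) hε1
  have hyε : y ≤ y ^ (1 + ε) := by
    conv_lhs => rw [← Real.rpow_one y]
    exact Real.rpow_le_rpow_of_exponent_le hy1.le (by linarith)
  have hlε : Real.log (y ^ (1 + ε)) = (1 + ε) * a := Real.log_rpow hy0 _
  have hmem : ∀ q ∈ primesIoc y ε, q.Prime ∧ y < q ∧ (q : ℝ) ≤ y ^ (1 + ε) := fun q hq =>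
    (mem_primesIoc hy0.le).1 hq
  constructor
  · set A := ⌊y⌋₊ with hA
    set B := ⌊y ^ (1 + ε)⌋₊ with hB
    have hAB : A ≤ B := Nat.floor_le_floor hyε
    have hAy : (A : ℝ) ≤ y := Nat.floor_le hy0.le
    have hyA : y < A + 1 := Nat.lt_floor_add_one y
    have hyB : y ^ (1 + ε) < B + 1 := Nat.lt_floor_add_one _
    have key := sum_mul_le_sum_mul (A := A) (B := B) (u := fun _ => 0.92)
      (v := fun n => if n.Prime then Real.log n else 0)
      (f := fun n => 1 / (n : ℝ)) (m := 0.19 * A + 2 * D) (fun i h1 h2 => by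
        have : (0 : ℝ) < i := by exact_mod_cast (by omega : 0 < i)
        push_cast
        gcongr
        linarith) (fun i _ _ => by positivity) (by positivity) (by positivity)
      (fun k h1 h2 => by
        have e1 := (hD k).1
        have e2 := (hD A).2
        have e3 : Chebyshev.theta k - Chebyshev.theta A =
            ∑ n ∈ Finset.Ioc A k, if n.Prime then Real.log n else 0 := by
          simp only [Chebyshev.theta, Nat.floor_natCast]
          rw [Finset.sum_filter, Finset.sum_filter,
            ← Finset.sum_Ioc_consecutive _ (Nat.zero_le A) h1.le]
          ring
        rw [← e3, Finset.sum_const, Nat.card_Ioc, nsmul_eq_mul, Nat.cast_sub h1.le]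
        linarith)
    have e1 : ∑ n ∈ Finset.Ioc A B, (if n.Prime then Real.log n else 0) * (1 / (n : ℝ)) =
        ∑ q ∈ primesIoc y ε, Real.log q / q := by
      rw [primesIoc, Finset.sum_filter]
      refine Finset.sum_congr rfl fun n _ => ?_
      split_ifs <;> simp [div_eq_mul_inv]
    have e2 : ∑ q ∈ primesIoc y ε, Real.log q / q ≤
        ∑ q ∈ primesIoc y ε, 1 / ((q : ℝ) - 1) * ((1 + ε) * a) := by
      refine Finset.sum_le_sum fun q hq => ?_
      obtain ⟨h1, h2, h3⟩ := hmem q hq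
      have h4 : (1 : ℝ) < q := by exact_mod_cast h1.one_lt
      have h5 : Real.log q ≤ (1 + ε) * a := by
        rw [← hlε]; exact Real.log_le_log (by linarith) h3
      rw [one_div_mul_eq_div]
      have : (0 : ℝ) < q - 1 := by linarith
      have : 0 ≤ (1 + ε) * a := by positivity
      gcongr
      linarith
    have e3 := le_sum_Ioc_inv hAB
    have e4 : (1 + ε) * a ≤ Real.log (B + 1) := by
      rw [← hlε]; exact Real.log_le_log (by positivity) hyB.le
    have e5 : Real.log ((A : ℝ) + 1) ≤ a + 1 / y := by
      have h1 : Real.log ((A : ℝ) + 1) ≤ Real.log (y + 1) :=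
        Real.log_le_log (by positivity) (by linarith)
      have h2 := Real.log_le_sub_one_of_pos (x := (y + 1) / y) (by positivity)
      rw [Real.log_div (by positivity) (by positivity)] at h2
      have : (y + 1) / y - 1 = 1 / y := by field_simp; ring
      linarith
    have e6 : (0.19 * A + 2 * D) * (1 / ((A + 1 : ℕ) : ℝ)) ≤ 0.19 + 2 * D / y := by
      push_cast
      rw [mul_one_div, add_div]
      refine add_le_add ?_ ?_
      · rw [div_le_iff₀ (by positivity)]; linarith
      · gcongr
    have e7 : (2 * D + 1) / y ≤ 0.005 := by
      rw [div_le_iff₀ hy0]; linarith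
    have e8 : 2 * D / y + 0.92 * (1 / y) ≤ (2 * D + 1) / y := by
      rw [mul_one_div, ← add_div]; gcongr; norm_num
    rw [e1, ← Finset.mul_sum] at key
    rw [← Finset.sum_mul] at e2
    set lam := ∑ q ∈ primesIoc y ε, 1 / ((q : ℝ) - 1)
    have e9 : 0.92 * (ε * a) - 0.195 ≤ lam * ((1 + ε) * a) := by
      have : ε * a - 1 / y ≤ ∑ n ∈ Finset.Ioc A B, 1 / (n : ℝ) := by linarith
      linarith
    have e10 : 0.69 * ε * ((1 + ε) * a) ≤ 0.92 * (ε * a) - 0.195 := by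
      have : 0.69 * ε * ((1 + ε) * a) = 0.69 * (ε * a) * (1 + ε) := by ring
      rw [this]
      rcases le_or_gt ε 0.05 with h | h
      · nlinarith
      · have : 3.4 ≤ ε * a := by nlinarith
        nlinarith
    exact le_of_mul_le_mul_right (e10.trans e9) (by positivity)
  · have h1 := hC y (y ^ (1 + ε)) hy1 hyε (primesIoc y ε) fun q hq =>
      ⟨(hmem q hq).1, (hmem q hq).2.1.le, (hmem q hq).2.2⟩
    rw [hlε] at h1
    have h2 : ∑ q ∈ primesIoc y ε, 1 / ((q : ℝ) - 1) * (a / 2) ≤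
        ∑ q ∈ primesIoc y ε, Real.log q / q := by
      refine Finset.sum_le_sum fun q hq => ?_
      obtain ⟨h1, h2, h3⟩ := hmem q hq
      have h4 : (2 : ℝ) ≤ q := by exact_mod_cast h1.two_le
      have h5 : a ≤ Real.log q := Real.log_le_log hy0 h2.le
      rw [one_div_mul_eq_div, div_le_div_iff₀ (by linarith) (by linarith)]
      nlinarith
    rw [← Finset.sum_mul] at h2
    set lam := ∑ q ∈ primesIoc y ε, 1 / ((q : ℝ) - 1)
    have h3 : lam * (a / 2) ≤ 1 * (a / 2) := by nlinarith
    exact le_of_mul_le_mul_right h3 (by positivity)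

/-- `n` has no prime factor below `w`. -/
def IsRough (w : ℝ) (n : ℕ) : Prop := ∀ p ∈ sievePrimes w, ¬ p ∣ n

noncomputable instance (w : ℝ) : DecidablePred (IsRough w) := fun _ => Classical.propDecidable _

lemma isRough_iff {w : ℝ} {n : ℕ} : IsRough w n ↔ ∀ p : ℕ, p.Prime → p ∣ n → w ≤ p := by
  simp only [IsRough, mem_sievePrimes]
  exact ⟨fun h p hp hpn => not_lt.1 fun hlt => h p ⟨hp, hlt⟩ hpn,
    fun h p hp hpn => not_lt.2 (h p hp.1 hpn) hp.2⟩

lemma IsRough.coprime {w : ℝ} {n r : ℕ} (h : IsRough w n) (hr0 : 0 < r) (hr : (r : ℝ) < w) :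
    n.Coprime r := by
  refine Nat.Coprime.symm (Nat.Coprime.symm ?_)
  refine Nat.coprime_of_dvd fun p hp hpn hpr => ?_
  have h1 := isRough_iff.1 h p hp hpn
  have h2 : (p : ℝ) ≤ r := by exact_mod_cast Nat.le_of_dvd hr0 hpr
  linarith

lemma IsRough.of_dvd {w : ℝ} {n d : ℕ} (h : IsRough w n) (hd : d ∣ n) : IsRough w d :=
  fun p hp hpd => h p hp (hpd.trans hd)

lemma IsRough.mono {w w' : ℝ} {n : ℕ} (h : IsRough w n) (hw : w' ≤ w) : IsRough w' n :=
  isRough_iff.2 fun p hp hpn => hw.trans (isRough_iff.1 h p hp hpn)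

lemma IsRough.le {w : ℝ} {n : ℕ} (h : IsRough w n) (hn : 1 < n) : w ≤ n := by
  have h1 := isRough_iff.1 h n.minFac (Nat.minFac_prime (by omega)) (Nat.minFac_dvd n)
  have h2 : (n.minFac : ℝ) ≤ n := by exact_mod_cast Nat.minFac_le (by omega)
  linarith

lemma abs_card_modEq_sub_le {A B m : ℕ} (hAB : A ≤ B) (hm : 0 < m) (c : ℕ) :
    |((Finset.Ioc A B).filter (fun n => n ≡ c [MOD m])).card - ((B : ℝ) - A) / m| ≤ 1 := by
  have h := Nat.Ioc_filter_modEq_card A B hm c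
  have hm0 : (0 : ℚ) < m := by exact_mod_cast hm
  have hle : ((A : ℚ) - c) / m ≤ (B - c) / m := by
    have : (A : ℚ) ≤ B := by exact_mod_cast hAB
    gcongr
  rw [max_eq_left (sub_nonneg.2 (Int.floor_le_floor hle))] at h
  have h' : (((Finset.Ioc A B).filter (fun n => n ≡ c [MOD m])).card : ℚ) =
      (⌊((B : ℚ) - c) / m⌋ : ℚ) - ⌊((A : ℚ) - c) / m⌋ := by exact_mod_cast h
  have key : |(((Finset.Ioc A B).filter (fun n => n ≡ c [MOD m])).card : ℚ) -
      ((B : ℚ) - A) / m| ≤ 1 := by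
    rw [h']
    have h1 := Int.floor_le (((B : ℚ) - c) / m)
    have h2 := Int.lt_floor_add_one (((B : ℚ) - c) / m)
    have h3 := Int.floor_le (((A : ℚ) - c) / m)
    have h4 := Int.lt_floor_add_one (((A : ℚ) - c) / m)
    have h5 : ((B : ℚ) - A) / m = (B - c) / m - (A - c) / m := by ring
    rw [h5, abs_le]
    constructor <;> linarith
  have key' := (Rat.cast_le (K := ℝ)).2 key
  push_cast at key'
  exact key'

/-- Sums of a decreasing function over an arithmetic progression. -/
lemma abs_sum_modEq_sub_le {A B m : ℕ} {f : ℕ → ℝ} (hm : 0 < m) (c : ℕ)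
    (hf : ∀ i, A < i → f (i + 1) ≤ f i) (hf0 : ∀ i, A < i → 0 ≤ f i) :
    |∑ n ∈ Finset.Ioc A B with n ≡ c [MOD m], f n - (∑ n ∈ Finset.Ioc A B, f n) / m|
      ≤ f (A + 1) := by
  have hm0 : (0 : ℝ) < m := by exact_mod_cast hm
  have hsum : ∀ k, A < k → ∑ n ∈ Finset.Ioc A k, ((if n ≡ c [MOD m] then (1 : ℝ) else 0) - 1 / m) =
      ((Finset.Ioc A k).filter (fun n => n ≡ c [MOD m])).card - ((k : ℝ) - A) / m := by
    intro k hk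
    rw [Finset.sum_sub_distrib, Finset.sum_boole, Finset.sum_const, Nat.card_Ioc, nsmul_eq_mul,
      Nat.cast_sub hk.le]
    ring
  have e : ∑ n ∈ Finset.Ioc A B with n ≡ c [MOD m], f n - (∑ n ∈ Finset.Ioc A B, f n) / m =
      ∑ n ∈ Finset.Ioc A B, ((if n ≡ c [MOD m] then (1 : ℝ) else 0) - 1 / m) * f n := by
    rw [Finset.sum_filter, Finset.sum_div, ← Finset.sum_sub_distrib]
    refine Finset.sum_congr rfl fun n _ => ?_
    split_ifs <;> ring
  have h1 := sum_mul_antitone_le (A := A) (B := B) (m := 1)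
    (d := fun n => (if n ≡ c [MOD m] then (1 : ℝ) else 0) - 1 / m) (fun i h _ => hf i h)
    (fun i h _ => hf0 i h) zero_le_one (hf0 _ (Nat.lt_succ_self A)) (fun k hk _ => by
      rw [hsum k hk]; exact (abs_le.1 (abs_card_modEq_sub_le hk.le hm c)).2)
  have h2 := sum_mul_antitone_le (A := A) (B := B) (m := 1)
    (d := fun n => -((if n ≡ c [MOD m] then (1 : ℝ) else 0) - 1 / m)) (fun i h _ => hf i h)
    (fun i h _ => hf0 i h) zero_le_one (hf0 _ (Nat.lt_succ_self A)) (fun k hk _ => by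
      rw [Finset.sum_neg_distrib, hsum k hk]
      linarith [(abs_le.1 (abs_card_modEq_sub_le hk.le hm c)).1])
  simp only [neg_mul, Finset.sum_neg_distrib] at h2
  rw [e, abs_le]
  constructor <;> linarith

lemma totient_eq_mul_prod (r : ℕ) :
    (r.totient : ℝ) = r * ∏ p ∈ r.primeFactors, (1 - 1 / (p : ℝ)) := by
  have := congrArg (fun q : ℚ => (q : ℝ)) (Nat.totient_eq_mul_prod_factors r)
  push_cast at this
  simpa [one_div] using this

/-- The fundamental lemma for sums of decreasing functions over rough numbers in a
reduced residue class. -/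
theorem exists_rough_modEq : ∃ K : ℝ, 1 ≤ K ∧ ∃ b₀ : ℕ, ∀ b : ℕ, b₀ ≤ b → Even b →
    ∀ w : ℝ, 1 ≤ w → ∀ r a : ℕ, 0 < r → (r : ℝ) < w → a.Coprime r → ∀ (A B : ℕ) (f : ℕ → ℝ),
    (∀ i, A < i → f (i + 1) ≤ f i) → (∀ i, A < i → 0 ≤ f i) →
    |∑ n ∈ Finset.Ioc A B with n ≡ a [MOD r] ∧ IsRough w n, f n
        - (∑ n ∈ Finset.Ioc A B, f n) * mertensProd w / r.totient|
      ≤ K / 2 ^ b * ((∑ n ∈ Finset.Ioc A B, f n) * mertensProd w / r.totient)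
        + w ^ (2 * b + 8) * f (A + 1) := by
  obtain ⟨c, hc⟩ := exists_sum_inv_le
  obtain ⟨K, hK, b₀, h⟩ := fundamental_lemma hc
  refine ⟨K, hK, b₀, fun b hb hbe w hw r a hr hrw har A B f hf hf0 => ?_⟩
  obtain ⟨J, hJ⟩ : ∃ J : ℕ, w ≤ 2 ^ 2 ^ J := by
    obtain ⟨n, hn⟩ := pow_unbounded_of_one_lt w (one_lt_two (α := ℝ))
    exact ⟨n, hn.le.trans (pow_le_pow_right₀ one_le_two Nat.lt_two_pow_self.le)⟩
  set P := (sievePrimes w).filter (fun p => ¬ p ∣ r) with hP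
  have hPm : ∀ p ∈ P, p.Prime ∧ (p : ℝ) < w := fun p hp =>
    mem_sievePrimes.1 (Finset.mem_filter.1 hp).1
  have hr0 : (0 : ℝ) < r := by exact_mod_cast hr
  have hH : 0 ≤ ∑ n ∈ Finset.Ioc A B, f n :=
    Finset.sum_nonneg fun n hn => hf0 n (Finset.mem_Ioc.1 hn).1
  have hrec : ∀ n, n ≡ a [MOD r] → (IsRough w n ↔ ∀ p ∈ P, ¬ p ∣ n) := by
    intro n hn
    refine ⟨fun h p hp => h p (Finset.mem_filter.1 hp).1, fun h p hp hpn => ?_⟩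
    by_cases hpr : p ∣ r
    · have h1 : n.Coprime r := by
        have := hn.gcd_eq
        rwa [har.gcd_eq_one] at this
      exact Nat.not_coprime_of_dvd_of_dvd (mem_sievePrimes.1 hp).1.one_lt hpn hpr h1
    · exact h p (Finset.mem_filter.2 ⟨hp, hpr⟩) hpn
  have hV : (∑ n ∈ Finset.Ioc A B, f n) / r * ∏ p ∈ P, (1 - 1 / (p : ℝ)) =
      (∑ n ∈ Finset.Ioc A B, f n) * mertensProd w / r.totient := by
    have h1 : (sievePrimes w).filter (fun p => p ∣ r) = r.primeFactors := by
      ext p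
      simp only [Finset.mem_filter, mem_sievePrimes, Nat.mem_primeFactors]
      refine ⟨fun h => ⟨h.1.1, h.2, by omega⟩, fun h => ⟨⟨h.1, lt_of_le_of_lt ?_ hrw⟩, h.2.1⟩⟩
      exact_mod_cast Nat.le_of_dvd hr h.2.1
    have h2 : mertensProd w = (∏ p ∈ r.primeFactors, (1 - 1 / (p : ℝ))) *
        ∏ p ∈ P, (1 - 1 / (p : ℝ)) := by
      rw [← h1, hP, Finset.prod_filter_mul_prod_filter_not]; rfl
    have h3 : 0 < ∏ p ∈ r.primeFactors, (1 - 1 / (p : ℝ)) :=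
      prod_one_sub_pos fun p hp => Nat.prime_of_mem_primeFactors hp
    rw [h2, totient_eq_mul_prod]
    field_simp
  have key := h J b hb hbe w hw hJ P hPm ((Finset.Ioc A B).filter (fun n => n ≡ a [MOD r])) f
    ((∑ n ∈ Finset.Ioc A B, f n) / r) (f (A + 1))
    (fun n hn => hf0 n (Finset.mem_Ioc.1 (Finset.mem_filter.1 hn).1).1) (by positivity)
    (hf0 _ (Nat.lt_succ_self A)) (fun D hD => by
      have hDp : ∀ p ∈ D, p.Prime := fun p hp => (hPm p (hD hp)).1
      have hcop : r.Coprime (∏ p ∈ D, p) := Nat.Coprime.prod_right fun p hp =>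
        ((Nat.Prime.coprime_iff_not_dvd (hDp p hp)).2 (Finset.mem_filter.1 (hD hp)).2).symm
      have hdvd : ∀ n, (∀ p ∈ D, p ∣ n) ↔ (∏ p ∈ D, p) ∣ n := fun n =>
        ⟨fun h => Finset.prod_primes_dvd n (fun p hp => (hDp p hp).prime) h,
          fun h p hp => (Finset.dvd_prod_of_mem _ hp).trans h⟩
      obtain ⟨c, hc1, hc2⟩ := Nat.chineseRemainder hcop a 0
      have hset : ((Finset.Ioc A B).filter (fun n => n ≡ a [MOD r])).filter
          (fun n => ∀ p ∈ D, p ∣ n) =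
          (Finset.Ioc A B).filter (fun n => n ≡ c [MOD r * ∏ p ∈ D, p]) := by
        rw [Finset.filter_filter]
        refine Finset.filter_congr fun n _ => ?_
        rw [hdvd, ← Nat.modEq_and_modEq_iff_modEq_mul hcop, ← Nat.modEq_zero_iff_dvd]
        exact ⟨fun h => ⟨h.1.trans hc1.symm, h.2.trans hc2.symm⟩,
          fun h => ⟨h.1.trans hc1, h.2.trans hc2⟩⟩
      rw [hset]
      have := abs_sum_modEq_sub_le (A := A) (B := B) (m := r * ∏ p ∈ D, p) (f := f)
        (Nat.mul_pos hr (Finset.prod_pos fun p hp => (hDp p hp).pos)) c hf hf0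
      push_cast at this
      rwa [← div_div] at this)
  rw [hV, Finset.filter_filter] at key
  have hset : (Finset.Ioc A B).filter (fun n => n ≡ a [MOD r] ∧ IsRough w n) =
      (Finset.Ioc A B).filter (fun n => n ≡ a [MOD r] ∧ ∀ p ∈ P, ¬ p ∣ n) :=
    Finset.filter_congr fun n _ => and_congr_right fun hn => hrec n hn
  rw [hset]
  exact key

/-- The deviation of the indicator function of `n ≡ 1 [MOD r]` from its expected value. -/
noncomputable def apDev (r n : ℕ) : ℝ := (if n ≡ 1 [MOD r] then 1 else 0) - 1 / (r.totient : ℝ)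

lemma abs_apDev_le (r n : ℕ) (hr : 0 < r) : |apDev r n| ≤ 1 := by
  have h1 : (1 : ℝ) ≤ r.totient := by exact_mod_cast Nat.totient_pos.2 hr
  have h2 : 1 / (r.totient : ℝ) ≤ 1 := by rw [div_le_one (by linarith)]; exact h1
  have h3 : 0 < 1 / (r.totient : ℝ) := by positivity
  unfold apDev
  rw [abs_le]
  split_ifs <;> constructor <;> linarith

lemma exists_mul_modEq_one_iff {m r : ℕ} (h : m.Coprime r) (hr : 0 < r) :
    ∃ a : ℕ, a.Coprime r ∧ ∀ d : ℕ, d * m ≡ 1 [MOD r] ↔ d ≡ a [MOD r] := by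
  rcases (Nat.succ_le_of_lt hr).eq_or_lt with rfl | hr1
  · exact ⟨1, Nat.coprime_one_right 1, fun d => by simp [Nat.modEq_one]⟩
  obtain ⟨a, -, ha⟩ := Nat.exists_mul_mod_eq_one_of_coprime h hr1
  have ha' : a * m ≡ 1 [MOD r] := by
    rw [mul_comm, Nat.ModEq, ha, Nat.mod_eq_of_lt hr1]
  refine ⟨a, ?_, fun d => ⟨fun hd => ?_, fun hd => (hd.mul_right m).trans ha'⟩⟩
  · have h1 : (a * m).Coprime r := by
      have := ha'.gcd_eq
      rw [Nat.gcd_one_left] at this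
      exact this
    exact Nat.Coprime.coprime_mul_right h1
  · exact Nat.ModEq.cancel_right_of_coprime (by rw [Nat.gcd_comm]; exact h) (hd.trans ha'.symm)

/-- The correlation of two deviations along a set of multipliers. -/
noncomputable def corr (R : Finset ℕ) (r r' m m' : ℕ) : ℝ :=
  ∑ d ∈ R, 1 / (d : ℝ) * (apDev r (d * m) * apDev r' (d * m'))

lemma corr_eq (R : Finset ℕ) (r r' m m' : ℕ) :
    corr R r r' m m' =
      ∑ d ∈ R with d * m ≡ 1 [MOD r] ∧ d * m' ≡ 1 [MOD r'], 1 / (d : ℝ)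
      - (∑ d ∈ R with d * m ≡ 1 [MOD r], 1 / (d : ℝ)) / r'.totient
      - (∑ d ∈ R with d * m' ≡ 1 [MOD r'], 1 / (d : ℝ)) / r.totient
      + (∑ d ∈ R with d ≡ 1 [MOD 1], 1 / (d : ℝ)) / (r.totient * r'.totient) := by
  simp only [corr, Finset.sum_filter, Finset.sum_div]
  rw [← Finset.sum_sub_distrib, ← Finset.sum_sub_distrib, ← Finset.sum_add_distrib]
  refine Finset.sum_congr rfl fun d _ => ?_
  have h1 : d ≡ 1 [MOD 1] := Nat.modEq_one
  simp only [apDev, h1, if_true]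
  by_cases h2 : d * m ≡ 1 [MOD r] <;> by_cases h3 : d * m' ≡ 1 [MOD r'] <;>
    simp only [h2, h3, if_true, if_false, and_self, and_true, and_false] <;> ring

section

variable {R : Finset ℕ} {w η S e σ : ℝ}

lemma abs_corr_le_of_coprime (he : 0 ≤ e)
    (hR : ∀ r a : ℕ, 0 < r → (r : ℝ) < w → a.Coprime r →
      |∑ d ∈ R with d ≡ a [MOD r], 1 / (d : ℝ) - σ / r.totient| ≤ η * S / r.totient + e)
    {r r' m m' : ℕ} (hr : 0 < r) (hr' : 0 < r') (hrw : ((r * r' : ℕ) : ℝ) < w)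
    (hrr : r.Coprime r') (hm : m.Coprime r) (hm' : m'.Coprime r') :
    |corr R r r' m m'| ≤ 4 * (η * S / (r.totient * r'.totient) + e) := by
  obtain ⟨a, ha, hda⟩ := exists_mul_modEq_one_iff hm hr
  obtain ⟨a', ha', hda'⟩ := exists_mul_modEq_one_iff hm' hr'
  obtain ⟨c, hc1, hc2⟩ := Nat.chineseRemainder hrr a a'
  have hφ : (1 : ℝ) ≤ r.totient := by exact_mod_cast Nat.totient_pos.2 hr
  have hφ' : (1 : ℝ) ≤ r'.totient := by exact_mod_cast Nat.totient_pos.2 hr'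
  have hlt1 : (r : ℝ) < w := lt_of_le_of_lt
    (by exact_mod_cast Nat.le_mul_of_pos_right r hr') hrw
  have hlt2 : (r' : ℝ) < w := lt_of_le_of_lt
    (by exact_mod_cast Nat.le_mul_of_pos_left r' hr) hrw
  have hcc : c.Coprime (r * r') := by
    refine Nat.Coprime.mul_right ?_ ?_
    · have := hc1.gcd_eq; rwa [ha.gcd_eq_one] at this
    · have := hc2.gcd_eq; rwa [ha'.gcd_eq_one] at this
  have h1 := hR (r * r') c (Nat.mul_pos hr hr') hrw hcc
  have h2 := hR r a hr hlt1 ha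
  have h3 := hR r' a' hr' hlt2 ha'
  have h4 := hR 1 1 one_pos
    (lt_of_le_of_lt (by exact_mod_cast hr) hlt1) (Nat.coprime_one_right 1)
  rw [corr_eq]
  simp only [hda, hda']
  have hset : ∀ d, (d ≡ a [MOD r] ∧ d ≡ a' [MOD r']) ↔ d ≡ c [MOD r * r'] := by
    intro d
    rw [← Nat.modEq_and_modEq_iff_modEq_mul hrr]
    exact ⟨fun h => ⟨h.1.trans hc1.symm, h.2.trans hc2.symm⟩,
      fun h => ⟨h.1.trans hc1, h.2.trans hc2⟩⟩
  simp only [hset]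
  rw [Nat.totient_mul hrr] at h1
  push_cast [Nat.totient_one] at h1 h4
  set t1 := ∑ d ∈ R with d ≡ c [MOD r * r'], 1 / (d : ℝ)
  set t2 := ∑ d ∈ R with d ≡ a [MOD r], 1 / (d : ℝ)
  set t3 := ∑ d ∈ R with d ≡ a' [MOD r'], 1 / (d : ℝ)
  set t4 := ∑ d ∈ R with d ≡ 1 [MOD 1], 1 / (d : ℝ)
  set φ : ℝ := (r.totient : ℝ)
  set φ' : ℝ := (r'.totient : ℝ)
  have hp : (0 : ℝ) < φ := by linarith
  have hp' : (0 : ℝ) < φ' := by linarith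
  have hdiv : ∀ t M : ℝ, ∀ q : ℝ, 1 ≤ q → |t| ≤ M + e → |t / q| ≤ M / q + e := by
    intro t M q hq ht
    rw [abs_div, abs_of_pos (by linarith : (0:ℝ) < q)]
    calc |t| / q ≤ (M + e) / q := by gcongr
      _ = M / q + e / q := by ring
      _ ≤ _ := by gcongr; exact div_le_self he hq
  have k2 := hdiv _ _ φ' hφ' h2
  have k3 := hdiv _ _ φ hφ h3
  have k4 := hdiv _ _ (φ * φ') (by nlinarith) h4
  have e2 : η * S / φ / φ' = η * S / (φ * φ') := by rw [div_div]
  have e3 : η * S / φ' / φ = η * S / (φ * φ') := by rw [div_div, mul_comm φ']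
  have e4 : η * S / 1 / (φ * φ') = η * S / (φ * φ') := by rw [div_one]
  rw [e2] at k2
  rw [e3] at k3
  rw [e4] at k4
  have key : t1 - t2 / φ' - t3 / φ + t4 / (φ * φ') =
      (t1 - σ / (φ * φ')) - (t2 - σ / φ) / φ' - (t3 - σ / φ') / φ +
        (t4 - σ / 1) / (φ * φ') := by
    field_simp
    ring
  rw [key]
  rw [abs_le] at h1 k2 k3 k4 ⊢
  constructor <;> linarith [h1.1, h1.2, k2.1, k2.2, k3.1, k3.2, k4.1, k4.2]

lemma abs_corr_le (hη1 : η ≤ 1) (hS : 0 ≤ S) (he : 0 ≤ e) (hσ : σ ≤ S)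
    (hRr : ∀ d ∈ R, IsRough w d)
    (hR : ∀ r a : ℕ, 0 < r → (r : ℝ) < w → a.Coprime r →
      |∑ d ∈ R with d ≡ a [MOD r], 1 / (d : ℝ) - σ / r.totient| ≤ η * S / r.totient + e)
    {r r' m m' : ℕ} (hr : 0 < r) (hr' : 0 < r') (hrw : ((r * r' : ℕ) : ℝ) < w)
    (hm : m.Coprime r) (hm' : m'.Coprime r') :
    |corr R r r' m m'| ≤
      (if m' ≡ m [MOD r.gcd r'] then 2 * S / ((r.lcm r').totient : ℝ) + e else 0) +
        3 * (2 * S / (r.totient * r'.totient) + e) := by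
  obtain ⟨a, ha, hda⟩ := exists_mul_modEq_one_iff hm hr
  obtain ⟨a', ha', hda'⟩ := exists_mul_modEq_one_iff hm' hr'
  have hφ : (1 : ℝ) ≤ r.totient := by exact_mod_cast Nat.totient_pos.2 hr
  have hφ' : (1 : ℝ) ≤ r'.totient := by exact_mod_cast Nat.totient_pos.2 hr'
  have hlt1 : (r : ℝ) < w := lt_of_le_of_lt
    (by exact_mod_cast Nat.le_mul_of_pos_right r hr') hrw
  have hlt2 : (r' : ℝ) < w := lt_of_le_of_lt
    (by exact_mod_cast Nat.le_mul_of_pos_left r' hr) hrw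
  have hub : ∀ r a : ℕ, 0 < r → (r : ℝ) < w → a.Coprime r →
      ∑ d ∈ R with d ≡ a [MOD r], 1 / (d : ℝ) ≤ 2 * S / r.totient + e := by
    intro r a hr hrw har
    have h := (abs_le.1 (hR r a hr hrw har)).2
    have h1 : (0 : ℝ) < r.totient := by exact_mod_cast Nat.totient_pos.2 hr
    have h2 : σ / (r.totient : ℝ) + η * S / r.totient ≤ 2 * S / r.totient := by
      rw [← add_div]; gcongr; nlinarith
    linarith
  have h2 := hub r a hr hlt1 ha
  have h3 := hub r' a' hr' hlt2 ha'
  have h4 := hub 1 1 one_pos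
    (lt_of_le_of_lt (by exact_mod_cast hr) hlt1) (Nat.coprime_one_right 1)
  have hlcm : 0 < r.lcm r' := Nat.lcm_pos hr hr'
  have hlcmw : ((r.lcm r' : ℕ) : ℝ) < w := lt_of_le_of_lt
    (Nat.cast_le.2 (Nat.le_of_dvd (Nat.mul_pos hr hr') (Nat.lcm_dvd_mul r r'))) hrw
  have h1 : ∑ d ∈ R with d * m ≡ 1 [MOD r] ∧ d * m' ≡ 1 [MOD r'], 1 / (d : ℝ) ≤
      (if m' ≡ m [MOD r.gcd r'] then 2 * S / ((r.lcm r').totient : ℝ) + e else 0) := by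
    by_cases hne : ∃ d ∈ R, d * m ≡ 1 [MOD r] ∧ d * m' ≡ 1 [MOD r']
    · obtain ⟨d, hd, hd1, hd2⟩ := hne
      have hdl : d.Coprime (r.lcm r') := (hRr d hd).coprime hlcm hlcmw
      have hmm : m' ≡ m [MOD r.gcd r'] := by
        have h5 : d * m' ≡ d * m [MOD r.gcd r'] :=
          (hd2.of_dvd (Nat.gcd_dvd_right r r')).trans (hd1.of_dvd (Nat.gcd_dvd_left r r')).symm
        refine Nat.ModEq.cancel_left_of_coprime ?_ h5
        have := hdl.coprime_dvd_right ((Nat.gcd_dvd_left r r').trans (Nat.dvd_lcm_left r r'))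
        exact this.symm
      rw [if_pos hmm]
      refine le_trans (Finset.sum_le_sum_of_subset_of_nonneg (fun k hk => ?_)
        fun _ _ _ => by positivity) (hub (r.lcm r') d hlcm hlcmw hdl)
      rw [Finset.mem_filter] at hk ⊢
      refine ⟨hk.1, ?_⟩
      have k1 : k ≡ d [MOD r] := ((hda k).1 hk.2.1).trans ((hda d).1 hd1).symm
      have k2 : k ≡ d [MOD r'] := ((hda' k).1 hk.2.2).trans ((hda' d).1 hd2).symm
      exact Nat.mod_lcm k1 k2
    · rw [Finset.sum_eq_zero]
      · split_ifs <;> positivity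
      · intro d hd
        rw [Finset.mem_filter] at hd
        exact (hne ⟨d, hd⟩).elim
  rw [corr_eq]
  have n1 : 0 ≤ ∑ d ∈ R with d * m ≡ 1 [MOD r] ∧ d * m' ≡ 1 [MOD r'], 1 / (d : ℝ) :=
    Finset.sum_nonneg fun _ _ => by positivity
  simp only [hda, hda'] at h1 n1 ⊢
  push_cast [Nat.totient_one] at h4
  have n2 : 0 ≤ ∑ d ∈ R with d ≡ a [MOD r], 1 / (d : ℝ) :=
    Finset.sum_nonneg fun _ _ => by positivity
  have n3 : 0 ≤ ∑ d ∈ R with d ≡ a' [MOD r'], 1 / (d : ℝ) :=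
    Finset.sum_nonneg fun _ _ => by positivity
  have n4 : 0 ≤ ∑ d ∈ R with d ≡ 1 [MOD 1], 1 / (d : ℝ) :=
    Finset.sum_nonneg fun _ _ => by positivity
  set t1 := ∑ d ∈ R with d ≡ a [MOD r] ∧ d ≡ a' [MOD r'], 1 / (d : ℝ)
  set t2 := ∑ d ∈ R with d ≡ a [MOD r], 1 / (d : ℝ)
  set t3 := ∑ d ∈ R with d ≡ a' [MOD r'], 1 / (d : ℝ)
  set t4 := ∑ d ∈ R with d ≡ 1 [MOD 1], 1 / (d : ℝ)
  set φ : ℝ := (r.totient : ℝ)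
  set φ' : ℝ := (r'.totient : ℝ)
  have hdiv : ∀ t M : ℝ, ∀ q : ℝ, 1 ≤ q → t ≤ M + e → t / q ≤ M / q + e := by
    intro t M q hq ht
    calc t / q ≤ (M + e) / q := by gcongr
      _ = M / q + e / q := by ring
      _ ≤ _ := by gcongr; exact div_le_self he hq
  have k2 := hdiv _ _ φ' hφ' h2
  have k3 := hdiv _ _ φ hφ h3
  have k4 := hdiv _ _ (φ * φ') (by nlinarith) h4
  rw [div_div] at k2
  rw [div_div, mul_comm φ'] at k3
  rw [div_one] at k4
  have m2 : 0 ≤ t2 / φ' := by positivity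
  have m3 : 0 ≤ t3 / φ := by positivity
  have m4 : 0 ≤ t4 / (φ * φ') := by positivity
  rw [abs_le]
  constructor <;> linarith

end

lemma totient_gcd_mul_totient_lcm (a b : ℕ) :
    (a.gcd b).totient * (a.lcm b).totient = a.totient * b.totient := by
  rcases Nat.eq_zero_or_pos a with rfl | ha
  · simp
  have hg : 0 < a.gcd b := Nat.gcd_pos_of_pos_left b ha
  have h1 := Nat.totient_gcd_mul_totient_mul a b
  have h2 := Nat.totient_gcd_mul_totient_mul (a.gcd b) (a.lcm b)
  rw [Nat.gcd_eq_left ((Nat.gcd_dvd_left a b).trans (Nat.dvd_lcm_left a b)),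
    Nat.gcd_mul_lcm, h1] at h2
  exact (Nat.eq_of_mul_eq_mul_right hg h2).symm

/-- Expansion of the second moment into correlations. -/
lemma sum_sq_le_sum_abs_corr {ι : Type} (I : Finset ι) (r : ι → ℕ) (c : ι → ℝ)
    (hc : ∀ i ∈ I, |c i| ≤ 1) (D X : Finset ℕ) (E : ℕ → ℕ → Prop) [∀ d m, Decidable (E d m)] :
    ∑ d ∈ D, 1 / (d : ℝ) * (∑ m ∈ X with E d m, 1 / (m : ℝ) *
      ∑ i ∈ I, c i * apDev (r i) (d * m)) ^ 2 ≤
    ∑ q ∈ I ×ˢ I, ∑ m ∈ X, 1 / (m : ℝ) * ∑ m' ∈ X, 1 / (m' : ℝ) *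
      |corr (D.filter (fun d => E d m ∧ E d m')) (r q.1) (r q.2) m m'| := by
  have h1 : ∀ d, (∑ m ∈ X with E d m, 1 / (m : ℝ) * ∑ i ∈ I, c i * apDev (r i) (d * m)) ^ 2 =
      ∑ q ∈ I ×ˢ I, ∑ m ∈ X, ∑ m' ∈ X, if E d m ∧ E d m' then
        c q.1 * c q.2 * (1 / (m : ℝ) * (1 / (m' : ℝ))) *
          (apDev (r q.1) (d * m) * apDev (r q.2) (d * m')) else 0 := by
    intro d
    have e1 : ∑ m ∈ X with E d m, 1 / (m : ℝ) * ∑ i ∈ I, c i * apDev (r i) (d * m) =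
        ∑ i ∈ I, ∑ m ∈ X, if E d m then 1 / (m : ℝ) * (c i * apDev (r i) (d * m)) else 0 := by
      rw [Finset.sum_filter, Finset.sum_comm]
      refine Finset.sum_congr rfl fun m _ => ?_
      split_ifs
      · rw [Finset.mul_sum]
      · simp
    rw [e1, sq, Finset.sum_mul_sum, ← Finset.sum_product']
    refine Finset.sum_congr rfl fun q _ => ?_
    rw [Finset.sum_mul_sum]
    refine Finset.sum_congr rfl fun m _ => Finset.sum_congr rfl fun m' _ => ?_
    by_cases h : E d m <;> by_cases h' : E d m' <;> simp only [h, h', if_true, if_false, and_self,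
      and_true, and_false, mul_zero, zero_mul]
    ring
  simp only [h1]
  have h2 : ∑ d ∈ D, 1 / (d : ℝ) * ∑ q ∈ I ×ˢ I, ∑ m ∈ X, ∑ m' ∈ X, (if E d m ∧ E d m' then
        c q.1 * c q.2 * (1 / (m : ℝ) * (1 / (m' : ℝ))) *
          (apDev (r q.1) (d * m) * apDev (r q.2) (d * m')) else 0) =
      ∑ q ∈ I ×ˢ I, ∑ m ∈ X, ∑ m' ∈ X, c q.1 * c q.2 * (1 / (m : ℝ) * (1 / (m' : ℝ))) *
        corr (D.filter (fun d => E d m ∧ E d m')) (r q.1) (r q.2) m m' := by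
    simp only [Finset.mul_sum]
    rw [Finset.sum_comm]
    refine Finset.sum_congr rfl fun q _ => ?_
    rw [Finset.sum_comm]
    refine Finset.sum_congr rfl fun m _ => ?_
    rw [Finset.sum_comm]
    refine Finset.sum_congr rfl fun m' _ => ?_
    rw [corr, Finset.sum_filter, Finset.mul_sum]
    refine Finset.sum_congr rfl fun d _ => ?_
    split_ifs
    · ring
    · simp
  rw [h2]
  refine Finset.sum_le_sum fun q hq => Finset.sum_le_sum fun m _ => ?_
  rw [Finset.mul_sum]
  refine Finset.sum_le_sum fun m' _ => ?_
  rw [Finset.mem_product] at hq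
  have hcc : |c q.1 * c q.2| ≤ 1 := by
    rw [abs_mul]; exact mul_le_one₀ (hc _ hq.1) (abs_nonneg _) (hc _ hq.2)
  refine (le_abs_self _).trans ?_
  rw [abs_mul, abs_mul, abs_of_nonneg (by positivity : (0:ℝ) ≤ 1 / (m : ℝ) * (1 / (m' : ℝ))),
    ← mul_assoc (1 / (m : ℝ))]
  refine mul_le_mul_of_nonneg_right ?_ (abs_nonneg (corr _ _ _ _ _))
  exact mul_le_of_le_one_left (by positivity) hcc

lemma sum_corr_le {w η S e : ℝ} (hη1 : η ≤ 1) (hη0 : 0 ≤ η) (hS : 1 ≤ S) (he : 0 ≤ e) (he1 : e ≤ 1)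
    {X : Finset ℕ} (R : ℕ → ℕ → Finset ℕ) (hX : ∀ m ∈ X, IsRough w m)
    (hXs : ∀ r a : ℕ, 0 < r → (r : ℝ) < w → a.Coprime r →
      ∑ m ∈ X with m ≡ a [MOD r], 1 / (m : ℝ) ≤ 2 * S / r.totient + e)
    (hRr : ∀ m ∈ X, ∀ m' ∈ X, ∀ d ∈ R m m', IsRough w d)
    (hR : ∀ m ∈ X, ∀ m' ∈ X, ∃ σ ≤ S, ∀ r a : ℕ, 0 < r → (r : ℝ) < w → a.Coprime r →
      |∑ d ∈ R m m' with d ≡ a [MOD r], 1 / (d : ℝ) - σ / r.totient| ≤ η * S / r.totient + e)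
    {r r' : ℕ} (hr : 0 < r) (hr' : 0 < r') (hrw : ((r * r' : ℕ) : ℝ) < w) :
    ∑ m ∈ X, 1 / (m : ℝ) * ∑ m' ∈ X, 1 / (m' : ℝ) * |corr (R m m') r r' m m'| ≤
      100 * S ^ 3 * (η * (1 / r.totient * (1 / r'.totient)) +
        (if r.Coprime r' then 0 else 1 / (r.totient : ℝ) * (1 / (r'.totient : ℝ))) + e) := by
  have hφ : (1 : ℝ) ≤ r.totient := by exact_mod_cast Nat.totient_pos.2 hr
  have hφ' : (1 : ℝ) ≤ r'.totient := by exact_mod_cast Nat.totient_pos.2 hr'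
  have hlt1 : (r : ℝ) < w := lt_of_le_of_lt
    (by exact_mod_cast Nat.le_mul_of_pos_right r hr') hrw
  have hlt2 : (r' : ℝ) < w := lt_of_le_of_lt
    (by exact_mod_cast Nat.le_mul_of_pos_left r' hr) hrw
  have hw1 : ((1 : ℕ) : ℝ) < w := lt_of_le_of_lt (by exact_mod_cast hr) hlt1
  have hT : ∑ m ∈ X, 1 / (m : ℝ) ≤ 3 * S := by
    have h := hXs 1 1 one_pos hw1 (Nat.coprime_one_right 1)
    rw [Finset.filter_true_of_mem (fun m _ => Nat.modEq_one), Nat.totient_one] at h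
    push_cast at h
    linarith
  have hT0 : 0 ≤ ∑ m ∈ X, 1 / (m : ℝ) := Finset.sum_nonneg fun _ _ => by positivity
  have hmr : ∀ m ∈ X, m.Coprime r := fun m hm => (hX m hm).coprime hr hlt1
  have hmr' : ∀ m ∈ X, m.Coprime r' := fun m hm => (hX m hm).coprime hr' hlt2
  set ψ : ℝ := 1 / r.totient * (1 / r'.totient) with hψ
  have hψe : ∀ t : ℝ, t / (r.totient * r'.totient) = t * ψ := fun t => by
    rw [hψ]; field_simp
  have hψ0 : 0 < ψ := by positivity
  have hS0 : 0 < S := by linarith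
  have hS3 : S ^ 2 ≤ S ^ 3 := pow_le_pow_right₀ hS (by norm_num)
  have hconst : ∀ K : ℝ, 0 ≤ K → ∑ m ∈ X, 1 / (m : ℝ) * ∑ m' ∈ X, 1 / (m' : ℝ) * K ≤
      9 * S ^ 2 * K := by
    intro K hK
    rw [← Finset.sum_mul, ← Finset.sum_mul, ← mul_assoc]
    refine mul_le_mul_of_nonneg_right ?_ hK
    nlinarith
  by_cases hrr : r.Coprime r'
  · rw [if_pos hrr, add_zero]
    calc _ ≤ ∑ m ∈ X, 1 / (m : ℝ) * ∑ m' ∈ X, 1 / (m' : ℝ) * (4 * (η * S * ψ + e)) := by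
          refine Finset.sum_le_sum fun m hm => ?_
          refine mul_le_mul_of_nonneg_left ?_ (by positivity)
          refine Finset.sum_le_sum fun m' hm' => ?_
          refine mul_le_mul_of_nonneg_left ?_ (by positivity)
          obtain ⟨σ, hσ, hR'⟩ := hR m hm m' hm'
          rw [← hψe]
          exact abs_corr_le_of_coprime he hR' hr hr' hrw hrr (hmr m hm) (hmr' m' hm')
      _ ≤ 9 * S ^ 2 * (4 * (η * S * ψ + e)) := hconst _ (by positivity)
      _ = 36 * S ^ 3 * (η * ψ) + 36 * S ^ 2 * e := by ring
      _ ≤ 36 * S ^ 3 * (η * ψ) + 36 * S ^ 3 * e := by gcongr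
      _ ≤ 100 * S ^ 3 * (η * ψ + e) := by
          have : 0 ≤ S ^ 3 * (η * ψ) := by positivity
          have : 0 ≤ S ^ 3 * e := by positivity
          linarith
  · rw [if_neg hrr]
    set g := r.gcd r' with hg
    have hg0 : 0 < g := Nat.gcd_pos_of_pos_left _ hr
    have hl0 : 0 < r.lcm r' := Nat.lcm_pos hr hr'
    have hgw : (g : ℝ) < w := lt_of_le_of_lt
      (by exact_mod_cast Nat.gcd_le_left r' hr) hlt1
    have hgl : 1 / (g.totient : ℝ) * (1 / (r.lcm r').totient) = ψ := by
      rw [hψ, one_div_mul_one_div, one_div_mul_one_div]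
      congr 1
      exact_mod_cast totient_gcd_mul_totient_lcm r r'
    have hφg : (1 : ℝ) ≤ g.totient := by exact_mod_cast Nat.totient_pos.2 hg0
    have hφl : (1 : ℝ) ≤ (r.lcm r').totient := by exact_mod_cast Nat.totient_pos.2 hl0
    have hig : 1 / (g.totient : ℝ) ≤ 1 := by rw [div_le_one (by linarith)]; exact hφg
    have hil : 1 / ((r.lcm r').totient : ℝ) ≤ 1 := by rw [div_le_one (by linarith)]; exact hφl
    set K1 := 2 * S / ((r.lcm r').totient : ℝ) + e with hK1
    have hK10 : 0 ≤ K1 := by positivity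
    calc _ ≤ ∑ m ∈ X, 1 / (m : ℝ) * ∑ m' ∈ X, 1 / (m' : ℝ) *
          ((if m' ≡ m [MOD g] then K1 else 0) + 3 * (2 * S * ψ + e)) := by
          refine Finset.sum_le_sum fun m hm => ?_
          refine mul_le_mul_of_nonneg_left ?_ (by positivity)
          refine Finset.sum_le_sum fun m' hm' => ?_
          refine mul_le_mul_of_nonneg_left ?_ (by positivity)
          obtain ⟨σ, hσ, hR'⟩ := hR m hm m' hm'
          rw [← hψe]
          exact abs_corr_le hη1 hS0.le he hσ (hRr m hm m' hm') hR' hr hr' hrw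
            (hmr m hm) (hmr' m' hm')
      _ = ∑ m ∈ X, 1 / (m : ℝ) * ((∑ m' ∈ X with m' ≡ m [MOD g], 1 / (m' : ℝ)) * K1) +
          ∑ m ∈ X, 1 / (m : ℝ) * ∑ m' ∈ X, 1 / (m' : ℝ) * (3 * (2 * S * ψ + e)) := by
          rw [← Finset.sum_add_distrib]
          refine Finset.sum_congr rfl fun m _ => ?_
          rw [← mul_add, Finset.sum_filter, Finset.sum_mul, ← Finset.sum_add_distrib]
          congr 1
          refine Finset.sum_congr rfl fun m' _ => ?_
          split_ifs <;> ring
      _ ≤ 3 * S * ((2 * S / (g.totient : ℝ) + e) * K1) +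
          9 * S ^ 2 * (3 * (2 * S * ψ + e)) := by
          refine add_le_add ?_ (hconst _ (by positivity))
          have : ∑ m ∈ X, 1 / (m : ℝ) * ((∑ m' ∈ X with m' ≡ m [MOD g], 1 / (m' : ℝ)) * K1) ≤
              ∑ m ∈ X, 1 / (m : ℝ) * ((2 * S / (g.totient : ℝ) + e) * K1) := by
            refine Finset.sum_le_sum fun m hm => ?_
            have := hXs g m hg0 hgw ((hX m hm).coprime hg0 hgw)
            gcongr
          refine this.trans ?_
          rw [← Finset.sum_mul]
          gcongr
      _ ≤ 3 * S * (4 * S ^ 2 * ψ + 5 * S * e) + 9 * S ^ 2 * (3 * (2 * S * ψ + e)) := by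
          have : (2 * S / (g.totient : ℝ) + e) * K1 ≤ 4 * S ^ 2 * ψ + 5 * S * e := by
            rw [← hgl, hK1]
            have e1 : 2 * S / (g.totient : ℝ) = 2 * S * (1 / (g.totient : ℝ)) := by ring
            have e2 : 2 * S / ((r.lcm r').totient : ℝ) = 2 * S * (1 / ((r.lcm r').totient : ℝ)) := by
              ring
            rw [e1, e2]
            set a := 1 / (g.totient : ℝ)
            set b := 1 / ((r.lcm r').totient : ℝ)
            have k1 : S * e * a ≤ S * e * 1 := by gcongr
            have k2 : S * e * b ≤ S * e * 1 := by gcongr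
            have k3 : e * e ≤ S * e := by nlinarith
            nlinarith
          gcongr
      _ = 66 * S ^ 3 * ψ + 42 * S ^ 2 * e := by ring
      _ ≤ 66 * S ^ 3 * ψ + 42 * S ^ 3 * e := by gcongr
      _ ≤ 100 * S ^ 3 * (η * ψ + ψ + e) := by
          have : 0 ≤ S ^ 3 * (η * ψ) := by positivity
          have : 0 ≤ S ^ 3 * e := by positivity
          have : 0 ≤ S ^ 3 * ψ := by positivity
          linarith

/-- The statement of the fundamental lemma with fixed level `b` and relative error `η`. -/
def RoughEquidistribution (η : ℝ) (s : ℕ) : Prop :=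
  ∀ w : ℝ, 1 ≤ w → ∀ r a : ℕ, 0 < r → (r : ℝ) < w → a.Coprime r → ∀ (A B : ℕ) (f : ℕ → ℝ),
    (∀ i, A < i → f (i + 1) ≤ f i) → (∀ i, A < i → 0 ≤ f i) →
    |∑ n ∈ Finset.Ioc A B with n ≡ a [MOD r] ∧ IsRough w n, f n
        - (∑ n ∈ Finset.Ioc A B, f n) * mertensProd w / r.totient|
      ≤ η * ((∑ n ∈ Finset.Ioc A B, f n) * mertensProd w / r.totient) + w ^ s * f (A + 1)

lemma sum_Ioc_inv_le {A B : ℕ} {L : ℝ} (hL : 1 ≤ L) (hB : Real.log B ≤ 2 * L) :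
    ∑ n ∈ Finset.Ioc A B, 1 / (n : ℝ) ≤ 3 * L := by
  have h := harmonic_le_one_add_log B
  rw [harmonic_eq_sum_Icc] at h
  push_cast at h
  have h2 : ∑ n ∈ Finset.Ioc A B, 1 / (n : ℝ) ≤ ∑ n ∈ Finset.Icc 1 B, ((n : ℝ))⁻¹ := by
    simp only [one_div]
    refine Finset.sum_le_sum_of_subset_of_nonneg (fun n hn => ?_) fun _ _ _ => by positivity
    rw [Finset.mem_Ioc] at hn
    rw [Finset.mem_Icc]
    omega
  linarith

lemma RoughEquidistribution.harmonic {η : ℝ} {s : ℕ} (h : RoughEquidistribution η s)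
    (hη : 0 ≤ η) (hs : 1 ≤ s) {w L : ℝ} (hw : 1 < w) (hL : 1 ≤ L)
    (hLw : L = 16 * (s : ℝ) ^ 2 * Real.log w)
    {A B : ℕ} (hA : w ^ (4 * s) ≤ ((A + 1 : ℕ) : ℝ)) (hB : Real.log B ≤ 2 * L) :
    ∃ σ ≤ 48 * (s : ℝ) ^ 2, ∀ r a : ℕ, 0 < r → (r : ℝ) < w → a.Coprime r →
      |∑ d ∈ (Finset.Ioc A B).filter (IsRough w) with d ≡ a [MOD r], 1 / (d : ℝ) - σ / r.totient|
        ≤ η * (48 * (s : ℝ) ^ 2) / r.totient + 1 / w ^ 2 := by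
  have hlw : 0 < Real.log w := Real.log_pos hw
  have hσ : (∑ n ∈ Finset.Ioc A B, 1 / (n : ℝ)) * mertensProd w ≤ 48 * (s : ℝ) ^ 2 := by
    calc _ ≤ 3 * L * (1 / Real.log w) := by
          have := mertensProd_pos w
          have := mertensProd_le hw
          have := sum_Ioc_inv_le (A := A) hL hB
          gcongr
      _ = _ := by rw [hLw]; field_simp; ring
  refine ⟨_, hσ, fun r a hr hrw har => ?_⟩
  have key := h w hw.le r a hr hrw har A B (fun n => 1 / (n : ℝ))
    (fun i hi => by
      have : (0 : ℝ) < i := by exact_mod_cast (Nat.zero_le A).trans_lt hi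
      push_cast
      gcongr
      linarith) (fun i _ => by positivity)
  have hset : ((Finset.Ioc A B).filter (IsRough w)).filter (fun d => d ≡ a [MOD r]) =
      (Finset.Ioc A B).filter (fun n => n ≡ a [MOD r] ∧ IsRough w n) := by
    rw [Finset.filter_filter]
    exact Finset.filter_congr fun _ _ => and_comm
  rw [hset]
  refine key.trans (add_le_add ?_ ?_)
  · rw [← mul_div_assoc]
    gcongr
  · have hw0 : 0 < w := by linarith
    calc w ^ s * (1 / ((A + 1 : ℕ) : ℝ)) ≤ w ^ s * (1 / w ^ (4 * s)) := by gcongr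
      _ ≤ 1 / w ^ 2 := by
        rw [mul_one_div, div_le_div_iff₀ (by positivity) (by positivity), one_mul, ← pow_add]
        exact pow_le_pow_right₀ hw.le (by omega)

/-- The dispersion bound for the bilinear sums over pairs of rough numbers. -/
theorem RoughEquidistribution.bilinear {η : ℝ} {s : ℕ} (h : RoughEquidistribution η s)
    (hη : 0 ≤ η) (hη1 : η ≤ 1) (hs : 1 ≤ s) {w L : ℝ} (hw : 1 < w) (hL : 1 ≤ L)
    (hLw : L = 16 * (s : ℝ) ^ 2 * Real.log w) {N N' : ℕ} (hN' : Real.log N' ≤ 2 * L)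
    {ι : Type} (I : Finset ι) (r : ι → ℕ) (c : ι → ℝ) (hc : ∀ i ∈ I, |c i| ≤ 1)
    (hr : ∀ i ∈ I, 0 < r i) (hrw : ∀ i ∈ I, ∀ j ∈ I, ((r i * r j : ℕ) : ℝ) < w)
    (X : Finset ℕ) (hX : X = (Finset.Ioc 1 N').filter (IsRough (w ^ (4 * s)))) :
    |∑ d ∈ X, vonMangoldt d / d * ∑ m ∈ X with N < d * m ∧ d * m ≤ N',
        1 / (m : ℝ) * ∑ i ∈ I, c i * apDev (r i) (d * m)| ≤
      2 * L * (20 * (48 * (s : ℝ) ^ 2) ^ 2 * √(η * (∑ i ∈ I, 1 / ((r i).totient : ℝ)) ^ 2 +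
        (∑ q ∈ I ×ˢ I with ¬ (r q.1).Coprime (r q.2),
          1 / ((r q.1).totient : ℝ) * (1 / ((r q.2).totient : ℝ))) +
        (I.card : ℝ) ^ 2 * (1 / w ^ 2))) := by
  set S : ℝ := 48 * (s : ℝ) ^ 2 with hSdef
  have hs1 : (1 : ℝ) ≤ s := by exact_mod_cast hs
  have hS : 1 ≤ S := by rw [hSdef]; nlinarith
  have hS0 : 0 < S := by linarith
  have hw0 : 0 < w := by linarith
  have he1 : 1 / w ^ 2 ≤ 1 := by
    rw [div_le_one (by positivity)]; exact one_le_pow₀ hw.le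
  set A₀ := ⌈w ^ (4 * s)⌉₊ - 1 with hA₀
  have hceil : 0 < ⌈w ^ (4 * s)⌉₊ := Nat.ceil_pos.2 (by positivity)
  have hA₀' : A₀ + 1 = ⌈w ^ (4 * s)⌉₊ := by omega
  have hA₀w : w ^ (4 * s) ≤ ((A₀ + 1 : ℕ) : ℝ) := by rw [hA₀']; exact Nat.le_ceil _
  have hww : w ≤ w ^ (4 * s) := le_self_pow₀ hw.le (by omega)
  set D := (Finset.Ioc A₀ N').filter (IsRough w) with hD
  have hXD : X ⊆ D := by
    intro n hn
    rw [hX, Finset.mem_filter, Finset.mem_Ioc] at hn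
    rw [hD, Finset.mem_filter, Finset.mem_Ioc]
    refine ⟨⟨?_, hn.1.2⟩, hn.2.mono hww⟩
    have h1 := hn.2.le hn.1.1
    have h2 : ⌈w ^ (4 * s)⌉₊ ≤ n := Nat.ceil_le.2 h1
    omega
  have hXr : ∀ m ∈ X, IsRough w m := fun m hm => (Finset.mem_filter.1 (hXD hm)).2
  have hX0 : ∀ m ∈ X, 0 < m ∧ m ≤ N' := fun m hm => by
    rw [hX, Finset.mem_filter, Finset.mem_Ioc] at hm; omega
  have hXs : ∀ r a : ℕ, 0 < r → (r : ℝ) < w → a.Coprime r →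
      ∑ m ∈ X with m ≡ a [MOD r], 1 / (m : ℝ) ≤ 2 * S / r.totient + 1 / w ^ 2 := by
    intro r a hr hrw har
    obtain ⟨σ, hσ, h1⟩ := h.harmonic hη hs hw hL hLw hA₀w hN'
    have h2 := (abs_le.1 (h1 r a hr hrw har)).2
    have h3 : ∑ m ∈ X with m ≡ a [MOD r], 1 / (m : ℝ) ≤
        ∑ m ∈ D with m ≡ a [MOD r], 1 / (m : ℝ) :=
      Finset.sum_le_sum_of_subset_of_nonneg (Finset.filter_subset_filter _ hXD)
        fun _ _ _ => by positivity
    have h4 : (0 : ℝ) < r.totient := by exact_mod_cast Nat.totient_pos.2 hr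
    have h5 : σ / (r.totient : ℝ) + η * S / r.totient ≤ 2 * S / r.totient := by
      rw [← add_div]; gcongr; nlinarith
    linarith
  have hmoment := sum_sq_le_sum_abs_corr I r c hc D X (fun d m => N < d * m ∧ d * m ≤ N')
  have hset : ∀ m ∈ X, ∀ m' ∈ X, D.filter (fun d => (N < d * m ∧ d * m ≤ N') ∧
      (N < d * m' ∧ d * m' ≤ N')) =
      (Finset.Ioc (max A₀ (max (N / m) (N / m'))) (min (N' / m) (N' / m'))).filter
        (IsRough w) := by
    intro m hm m' hm'
    ext d
    have hm0 := (hX0 m hm).1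
    have hm0' := (hX0 m' hm').1
    have h1 : d ≤ N' / m → d ≤ N' := fun h => h.trans (Nat.div_le_self _ _)
    simp only [hD, Finset.mem_filter, Finset.mem_Ioc, max_lt_iff, le_min_iff,
      Nat.div_lt_iff_lt_mul hm0, Nat.div_lt_iff_lt_mul hm0', Nat.le_div_iff_mul_le hm0,
      Nat.le_div_iff_mul_le hm0'] at h1 ⊢
    tauto
  have hpair : ∀ q ∈ I ×ˢ I, ∑ m ∈ X, 1 / (m : ℝ) * ∑ m' ∈ X, 1 / (m' : ℝ) *
      |corr (D.filter (fun d => (N < d * m ∧ d * m ≤ N') ∧ (N < d * m' ∧ d * m' ≤ N')))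
        (r q.1) (r q.2) m m'| ≤
      100 * S ^ 3 * (η * (1 / ((r q.1).totient : ℝ) * (1 / ((r q.2).totient : ℝ))) +
        (if (r q.1).Coprime (r q.2) then 0
          else 1 / ((r q.1).totient : ℝ) * (1 / ((r q.2).totient : ℝ))) + 1 / w ^ 2) := by
    intro q hq
    rw [Finset.mem_product] at hq
    refine sum_corr_le hη1 hη hS (by positivity) he1 (fun m m' => D.filter (fun d =>
      (N < d * m ∧ d * m ≤ N') ∧ (N < d * m' ∧ d * m' ≤ N'))) hXr hXs
      (fun m _ m' _ d hd => (Finset.mem_filter.1 (Finset.mem_filter.1 hd).1).2)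
      (fun m hm m' hm' => ?_) (hr _ hq.1) (hr _ hq.2) (hrw _ hq.1 _ hq.2)
    simp only [hset m hm m' hm']
    refine h.harmonic hη hs hw hL hLw (hA₀w.trans ?_) ?_
    · exact_mod_cast Nat.succ_le_succ (le_max_left _ _)
    · refine le_trans ?_ hN'
      rcases Nat.eq_zero_or_pos (min (N' / m) (N' / m')) with h0 | h0
      · rw [h0]; simpa using Real.log_natCast_nonneg N'
      · refine Real.log_le_log (by exact_mod_cast h0) ?_
        exact_mod_cast (min_le_left _ _).trans (Nat.div_le_self _ _)
  have htotal := hmoment.trans (Finset.sum_le_sum hpair)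
  rw [← Finset.mul_sum, Finset.sum_add_distrib, Finset.sum_add_distrib, Finset.sum_const,
    nsmul_eq_mul, Finset.card_product, ← Finset.mul_sum, Finset.sum_product' I I
      (fun i j => 1 / ((r i).totient : ℝ) * (1 / ((r j).totient : ℝ))), ← Finset.sum_mul_sum,
    ← sq] at htotal
  have hite : ∑ q ∈ I ×ˢ I, (if (r q.1).Coprime (r q.2) then (0 : ℝ)
          else 1 / ((r q.1).totient : ℝ) * (1 / ((r q.2).totient : ℝ))) =
      ∑ q ∈ I ×ˢ I with ¬ (r q.1).Coprime (r q.2),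
          1 / ((r q.1).totient : ℝ) * (1 / ((r q.2).totient : ℝ)) := by
    rw [Finset.sum_filter]
    refine Finset.sum_congr rfl fun q _ => ?_
    split_ifs <;> rfl
  rw [hite] at htotal
  push_cast at htotal
  rw [← sq (I.card : ℝ)] at htotal
  set T := η * (∑ i ∈ I, 1 / ((r i).totient : ℝ)) ^ 2 +
        (∑ q ∈ I ×ˢ I with ¬ (r q.1).Coprime (r q.2),
          1 / ((r q.1).totient : ℝ) * (1 / ((r q.2).totient : ℝ))) +
        (I.card : ℝ) ^ 2 * (1 / w ^ 2) with hT
  set G : ℕ → ℝ := fun d => ∑ m ∈ X with N < d * m ∧ d * m ≤ N',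
        1 / (m : ℝ) * ∑ i ∈ I, c i * apDev (r i) (d * m) with hG
  have hGX : ∑ d ∈ X, 1 / (d : ℝ) * G d ^ 2 ≤ 100 * S ^ 3 * T :=
    (Finset.sum_le_sum_of_subset_of_nonneg hXD fun _ _ _ => by positivity).trans htotal
  have hT0 : 0 ≤ T := by
    have : 0 ≤ ∑ q ∈ I ×ˢ I with ¬ (r q.1).Coprime (r q.2),
          1 / ((r q.1).totient : ℝ) * (1 / ((r q.2).totient : ℝ)) :=
      Finset.sum_nonneg fun _ _ => by positivity
    positivity
  have hΛ : ∑ d ∈ X, vonMangoldt d ^ 2 / (d : ℝ) ≤ (2 * L) ^ 2 * (3 * S) := by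
    calc _ ≤ ∑ d ∈ X, (2 * L) ^ 2 * (1 / (d : ℝ)) := by
          refine Finset.sum_le_sum fun d hd => ?_
          rw [div_eq_mul_one_div]
          have h1 : vonMangoldt d ≤ 2 * L := by
            refine ArithmeticFunction.vonMangoldt_le_log.trans (le_trans ?_ hN')
            exact Real.log_le_log (by exact_mod_cast (hX0 d hd).1)
              (by exact_mod_cast (hX0 d hd).2)
          have h0 : 0 ≤ vonMangoldt d := ArithmeticFunction.vonMangoldt_nonneg
          gcongr
      _ ≤ (2 * L) ^ 2 * (3 * S) := by
          rw [← Finset.mul_sum]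
          have h1 := hXs 1 1 one_pos (by exact_mod_cast hw) (Nat.coprime_one_right 1)
          rw [Finset.filter_true_of_mem (fun m _ => Nat.modEq_one), Nat.totient_one] at h1
          push_cast at h1
          gcongr
          linarith
  have hCS := Finset.sum_sq_le_sum_mul_sum_of_sq_le_mul X
    (r := fun d => vonMangoldt d / d * G d) (f := fun d => vonMangoldt d ^ 2 / (d : ℝ))
    (g := fun d => 1 / (d : ℝ) * G d ^ 2) (fun d _ => by positivity) (fun d _ => by positivity)
    (fun d _ => le_of_eq (by ring))
  refine abs_le_of_sq_le_sq ?_ (by positivity)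
  refine hCS.trans ?_
  calc _ ≤ (2 * L) ^ 2 * (3 * S) * (100 * S ^ 3 * T) := by
        gcongr
    _ ≤ (2 * L * (20 * S ^ 2 * √T)) ^ 2 := by
        have : (2 * L * (20 * S ^ 2 * √T)) ^ 2 = (2 * L) ^ 2 * 400 * S ^ 4 * T := by
          rw [mul_pow (2 * L), mul_pow (20 * S ^ 2), Real.sq_sqrt hT0]; ring
        rw [this]
        have : 0 ≤ (2 * L) ^ 2 * S ^ 4 * T := by positivity
        nlinarith

lemma log_div_self_succ_le {N : ℕ} (hN : 3 ≤ N) :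
    Real.log ((N + 1 : ℕ) : ℝ) / ((N + 1 : ℕ) : ℝ) ≤ Real.log N / N := by
  have h3 : Real.exp 1 ≤ N := by
    have h1 := Real.exp_one_lt_d9
    have h2 : (3 : ℝ) ≤ N := by exact_mod_cast hN
    linarith
  refine Real.log_div_self_antitoneOn (Set.mem_ofPred.2 h3) (Set.mem_ofPred.2 ?_) ?_
  · push_cast; linarith
  · push_cast; linarith

/-- Equidistribution of rough numbers weighted by `log n / n`. -/
lemma RoughEquidistribution.log_div {η : ℝ} {s : ℕ} (h : RoughEquidistribution η s)
    (hη : 0 ≤ η) (hs : 1 ≤ s) {w L : ℝ} (hw : 1 < w) (hL : 1 ≤ L)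
    (hLw : L = 16 * (s : ℝ) ^ 2 * Real.log w) {N N' : ℕ} (hN3 : 3 ≤ N)
    (hN : (N : ℝ) = w ^ (16 * s ^ 2)) (hN' : Real.log N' ≤ 2 * L) {r : ℕ} (hr : 0 < r)
    (hrw : (r : ℝ) < w) :
    |∑ n ∈ Finset.Ioc N N' with IsRough (w ^ (4 * s)) n, apDev r n * (Real.log n / n)| ≤
      2 * (24 * s * η * L * (1 / (r.totient : ℝ)) + L / w ^ 2) := by
  have hlw : 0 < Real.log w := Real.log_pos hw
  have hs0 : (0 : ℝ) < s := by exact_mod_cast hs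
  have hw0 : 0 < w := by linarith
  have hww : w ≤ w ^ (4 * s) := le_self_pow₀ hw.le (by omega)
  set W := w ^ (4 * s) with hW
  have hW1 : 1 < W := hw.trans_le hww
  have hlogN : Real.log N = L := by
    rw [hN, Real.log_pow, hLw]; push_cast; ring
  have hlW : Real.log W = 4 * s * Real.log w := by rw [hW, Real.log_pow]; push_cast; ring
  set f : ℕ → ℝ := fun n => Real.log n / n with hf
  have hfd : ∀ i, N < i → f (i + 1) ≤ f i := fun i hi => log_div_self_succ_le (by omega)
  have hf0 : ∀ i, N < i → 0 ≤ f i := fun i _ => by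
    have := Real.log_natCast_nonneg i
    positivity
  set H := ∑ n ∈ Finset.Ioc N N', f n with hH
  have hHb : H * mertensProd W ≤ 24 * s * L := by
    have h1 : H ≤ 2 * L * (3 * L) := by
      calc H ≤ ∑ n ∈ Finset.Ioc N N', 2 * L * (1 / (n : ℝ)) := by
            refine Finset.sum_le_sum fun n hn => ?_
            rw [Finset.mem_Ioc] at hn
            have : Real.log n ≤ 2 * L := (Real.log_le_log
              (by exact_mod_cast (Nat.zero_le N).trans_lt hn.1) (by exact_mod_cast hn.2)).trans hN'
            change Real.log n / n ≤ _
            rw [div_eq_mul_one_div]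
            gcongr
        _ ≤ _ := by
            rw [← Finset.mul_sum]
            have := sum_Ioc_inv_le (A := N) hL hN'
            gcongr
    have h2 := mertensProd_le hW1
    have h3 := mertensProd_pos W
    calc H * mertensProd W ≤ 2 * L * (3 * L) * (1 / Real.log W) := by gcongr
      _ = _ := by
        rw [hlW, hLw]; field_simp; ring
  have herr : W ^ s * f (N + 1) ≤ L / w ^ 2 := by
    have h1 : f (N + 1) ≤ L / w ^ (16 * s ^ 2) := by
      have := log_div_self_succ_le hN3
      rwa [hlogN, hN] at this
    calc W ^ s * f (N + 1) ≤ W ^ s * (L / w ^ (16 * s ^ 2)) := by gcongr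
      _ = L * (w ^ (4 * s ^ 2) / w ^ (16 * s ^ 2)) := by
        rw [hW, ← pow_mul]; rw [show 4 * s * s = 4 * s ^ 2 by ring]; ring
      _ ≤ L * (1 / w ^ 2) := by
        gcongr ?_ * ?_
        rw [div_le_div_iff₀ (by positivity) (by positivity), one_mul, ← pow_add]
        refine pow_le_pow_right₀ hw.le ?_
        nlinarith
      _ = _ := by ring
  have k1 := h W hW1.le r 1 hr (hrw.trans_le hww) (Nat.coprime_one_left r) N N' f hfd hf0
  have k2 := h W hW1.le 1 1 one_pos (by exact_mod_cast hW1) (Nat.coprime_one_right 1)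
    N N' f hfd hf0
  have hφ : (1 : ℝ) ≤ r.totient := by exact_mod_cast Nat.totient_pos.2 hr
  have hset : (Finset.Ioc N N').filter (fun n => n ≡ 1 [MOD 1] ∧ IsRough W n) =
      (Finset.Ioc N N').filter (IsRough W) :=
    Finset.filter_congr fun n _ => by simp [Nat.modEq_one]
  rw [hset] at k2
  have hsplit : ∑ n ∈ Finset.Ioc N N' with IsRough W n, apDev r n * (Real.log n / n) =
      ∑ n ∈ Finset.Ioc N N' with n ≡ 1 [MOD r] ∧ IsRough W n, f n -
        (∑ n ∈ Finset.Ioc N N' with IsRough W n, f n) / r.totient := by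
    rw [Finset.sum_div, ← Finset.filter_filter, Finset.filter_comm, Finset.sum_filter (p := fun n =>
      n ≡ 1 [MOD r]), ← Finset.sum_sub_distrib]
    refine Finset.sum_congr rfl fun n _ => ?_
    rw [apDev]
    split_ifs <;> simp only [hf] <;> ring
  rw [hsplit]
  push_cast [Nat.totient_one] at k2
  rw [div_one] at k2
  have k3 : |(∑ n ∈ Finset.Ioc N N' with IsRough W n, f n - H * mertensProd W) / r.totient| ≤
      η * (H * mertensProd W) / r.totient + W ^ s * f (N + 1) := by
    rw [abs_div, abs_of_pos (by linarith : (0 : ℝ) < r.totient)]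
    have e0 : 0 ≤ W ^ s * f (N + 1) := by
      have := hf0 (N + 1) (by omega)
      positivity
    calc _ ≤ (η * (H * mertensProd W) + W ^ s * f (N + 1)) / r.totient := by gcongr
      _ ≤ _ := by
        rw [add_div]
        gcongr
        exact div_le_self e0 hφ
  have k4 : η * (H * mertensProd W / r.totient) ≤ 24 * s * η * L * (1 / (r.totient : ℝ)) := by
    calc _ = η * (H * mertensProd W) * (1 / (r.totient : ℝ)) := by ring
      _ ≤ η * (24 * s * L) * (1 / (r.totient : ℝ)) := by gcongr
      _ = _ := by ring
  have k5 : η * (H * mertensProd W) / r.totient = η * (H * mertensProd W / r.totient) := by ring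
  rw [k5] at k3
  have e : ∀ a c : ℝ, a - c / r.totient = (a - H * mertensProd W / r.totient) -
      (c - H * mertensProd W) / r.totient := fun a c => by ring
  rw [e]
  rw [abs_le] at k1 k3 ⊢
  constructor <;> linarith [k1.1, k1.2, k3.1, k3.2]

/-- The identity `log = Λ * 1`, restricted to rough numbers. -/
lemma sum_rough_log_eq {W : ℝ} {N N' : ℕ} (hN : 1 ≤ N) (F : ℕ → ℝ) (X : Finset ℕ)
    (hX : X = (Finset.Ioc 1 N').filter (IsRough W)) :
    ∑ n ∈ Finset.Ioc N N' with IsRough W n, F n * (Real.log n / n) =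
      ∑ n ∈ Finset.Ioc N N' with IsRough W n, F n * (vonMangoldt n / n) +
      ∑ d ∈ X, vonMangoldt d / d * ∑ m ∈ X with N < d * m ∧ d * m ≤ N',
        1 / (m : ℝ) * F (d * m) := by
  have hmX : ∀ n, n ∈ X ↔ (1 < n ∧ n ≤ N') ∧ IsRough W n := fun n => by
    rw [hX, Finset.mem_filter, Finset.mem_Ioc]
  have hpt : ∀ n ∈ (Finset.Ioc N N').filter (IsRough W), Real.log n =
      vonMangoldt n + ∑ d ∈ X, ∑ m ∈ X, if n = d * m then vonMangoldt d else 0 := by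
    intro n hn
    rw [Finset.mem_filter, Finset.mem_Ioc] at hn
    obtain ⟨⟨hn1, hn2⟩, hnr⟩ := hn
    have hn0 : n ≠ 0 := by omega
    rw [← ArithmeticFunction.vonMangoldt_sum, ← Finset.add_sum_erase _ _
      (Nat.mem_divisors_self n hn0)]
    congr 1
    have h1 : ∀ d ∈ X, (∑ m ∈ X, if n = d * m then vonMangoldt d else 0) =
        if d ∣ n ∧ d ≠ n then vonMangoldt d else 0 := by
      intro d hd
      have hd1 := (hmX d).1 hd
      split_ifs with hdn
      · obtain ⟨⟨m, rfl⟩, hne⟩ := hdn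
        have hm0 : m ≠ 0 := by rintro rfl; simp at hn0
        have hm1 : m ≠ 1 := by rintro rfl; simp at hne
        have hmem : m ∈ X := (hmX m).2 ⟨⟨by omega, le_trans
          (Nat.le_mul_of_pos_left m (by omega)) hn2⟩, hnr.of_dvd (Dvd.intro_left _ rfl)⟩
        rw [Finset.sum_eq_single_of_mem m hmem]
        · simp
        · intro m' _ hm'
          rw [if_neg]
          intro h
          exact hm' (Nat.eq_of_mul_eq_mul_left (by omega) h).symm
      · refine Finset.sum_eq_zero fun m hm => if_neg ?_
        rintro rfl
        refine hdn ⟨Dvd.intro _ rfl, fun h => ?_⟩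
        have hm1 := (hmX m).1 hm
        have : d * 1 < d * m := Nat.mul_lt_mul_of_pos_left hm1.1.1 (by omega)
        omega
    rw [Finset.sum_congr rfl h1, ← Finset.sum_filter]
    symm
    refine Finset.sum_subset (fun d hd => ?_) fun d hd hd' => ?_
    · rw [Finset.mem_filter] at hd
      rw [Finset.mem_erase, Nat.mem_divisors]
      exact ⟨hd.2.2, hd.2.1, hn0⟩
    · rw [Finset.mem_erase, Nat.mem_divisors] at hd
      have hd1 : d = 1 := by
        by_contra hne
        refine hd' (Finset.mem_filter.2 ⟨(hmX d).2 ⟨⟨?_, ?_⟩, hnr.of_dvd hd.2.1⟩, hd.2.1, hd.1⟩)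
        · have := Nat.pos_of_dvd_of_pos hd.2.1 (by omega)
          omega
        · exact (Nat.le_of_dvd (by omega) hd.2.1).trans hn2
      rw [hd1]; simp
  have e1 : ∑ n ∈ Finset.Ioc N N' with IsRough W n, F n * (Real.log n / n) =
      ∑ n ∈ Finset.Ioc N N' with IsRough W n, F n * (vonMangoldt n / n) +
      ∑ n ∈ Finset.Ioc N N' with IsRough W n, ∑ d ∈ X, ∑ m ∈ X,
        if n = d * m then vonMangoldt d * (F n / n) else 0 := by
    rw [← Finset.sum_add_distrib]
    refine Finset.sum_congr rfl fun n hn => ?_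
    have key : ∀ a T : ℝ, F n * ((a + T) / n) = F n * (a / n) + T * (F n / n) :=
      fun a T => by ring
    rw [hpt n hn, key, Finset.sum_mul]
    congr 1
    refine Finset.sum_congr rfl fun d _ => ?_
    rw [Finset.sum_mul]
    refine Finset.sum_congr rfl fun m _ => ?_
    split_ifs <;> ring
  rw [e1]
  congr 1
  rw [Finset.sum_comm]
  refine Finset.sum_congr rfl fun d hd => ?_
  rw [Finset.sum_comm, Finset.sum_filter (s := X), Finset.mul_sum]
  refine Finset.sum_congr rfl fun m hm => ?_
  rw [Finset.sum_ite_eq']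
  have hd1 := (hmX d).1 hd
  have hm1 := (hmX m).1 hm
  have hmem : d * m ∈ (Finset.Ioc N N').filter (IsRough W) ↔ N < d * m ∧ d * m ≤ N' := by
    rw [Finset.mem_filter, Finset.mem_Ioc]
    refine ⟨fun h => h.1, fun h => ⟨h, isRough_iff.2 fun p hp hpd => ?_⟩⟩
    rcases (Nat.Prime.dvd_mul hp).1 hpd with h' | h'
    · exact isRough_iff.1 hd1.2 p hp h'
    · exact isRough_iff.1 hm1.2 p hp h'
  simp only [hmem]
  split_ifs
  · push_cast
    have : (d : ℝ) ≠ 0 := by have := hd1.1.1; positivity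
    have : (m : ℝ) ≠ 0 := by have := hm1.1.1; positivity
    field_simp
  · simp

lemma exists_roughEquidistribution {δ : ℝ} (hδ : 0 < δ) : ∃ (η : ℝ) (s : ℕ), 0 ≤ η ∧ η ≤ 1 ∧
    1 ≤ s ∧ (s : ℝ) ^ 4 * √η ≤ δ ∧ RoughEquidistribution η s := by
  obtain ⟨K, hK, b₀, h⟩ := exists_rough_modEq
  have ht := (tendsto_pow_const_div_const_pow_of_one_lt 8 (one_lt_two (α := ℝ))).const_mul
    (10 ^ 8 * K)
  rw [mul_zero] at ht
  have hev := ht.eventually_lt_const (lt_min one_pos (pow_pos hδ 2))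
  obtain ⟨b₁, hb₁⟩ := Filter.eventually_atTop.1 hev
  set b := 2 * (b₀ + b₁ + 1) with hb
  have hbb := hb₁ b (by omega)
  rw [lt_min_iff] at hbb
  have h2b : (0 : ℝ) < 2 ^ b := by positivity
  have hb1 : (1 : ℝ) ≤ b := by exact_mod_cast (by omega : 1 ≤ b)
  refine ⟨K / 2 ^ b, 2 * b + 8, by positivity, ?_, by omega, ?_,
    fun w hw r a hr hrw har A B f hf hf0 =>
      h b (by omega) ⟨b₀ + b₁ + 1, by omega⟩ w hw r a hr hrw har A B f hf hf0⟩
  · refine le_trans ?_ hbb.1.le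
    have : (1 : ℝ) ≤ 10 ^ 8 * (b : ℝ) ^ 8 := by
      have := one_le_pow₀ hb1 (n := 8)
      nlinarith
    calc K / 2 ^ b ≤ (10 ^ 8 * (b : ℝ) ^ 8) * (K / 2 ^ b) :=
          le_mul_of_one_le_left (by positivity) this
      _ = _ := by ring
  · rw [← abs_of_nonneg (by positivity : 0 ≤ ((2 * b + 8 : ℕ) : ℝ) ^ 4 * √(K / 2 ^ b))]
    refine abs_le_of_sq_le_sq ?_ hδ.le
    rw [mul_pow, Real.sq_sqrt (by positivity), ← pow_mul]
    refine le_trans ?_ hbb.2.le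
    have : ((2 * b + 8 : ℕ) : ℝ) ≤ 10 * b := by push_cast; linarith
    calc ((2 * b + 8 : ℕ) : ℝ) ^ (4 * 2) * (K / 2 ^ b) ≤ (10 * b) ^ (4 * 2) * (K / 2 ^ b) := by
          gcongr
      _ = _ := by ring

set_option maxHeartbeats 1000000 in
/-- Equidistribution of primes in progressions `1 mod r`, on average over a sparse family of
small moduli. -/
theorem exists_prime_equidistribution {θ : ℝ} (hθ : 0 < θ) : ∃ (B : ℕ) (C : ℝ), 3 ≤ C ∧
    ∀ Y : ℝ, C ≤ Y → ∀ N N' : ℕ, Y ^ B ≤ N → Real.log N' ≤ 2 * Real.log N →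
    ∀ (ι : Type) (I : Finset ι) (r : ι → ℕ) (c : ι → ℝ), (∀ i ∈ I, |c i| ≤ 1) →
    (∀ i ∈ I, 0 < r i) → (∀ i ∈ I, (r i : ℝ) ≤ Y) → (I.card : ℝ) ≤ Y →
    |∑ p ∈ Finset.Ioc N N' with p.Prime, (∑ i ∈ I, c i * apDev (r i) p) * (Real.log p / p)| ≤
      (θ * ∑ i ∈ I, 1 / ((r i).totient : ℝ) +
        C * √(∑ q ∈ I ×ˢ I with ¬ (r q.1).Coprime (r q.2),
          1 / ((r q.1).totient : ℝ) * (1 / ((r q.2).totient : ℝ))) + 1 / Y) * Real.log N := by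
  obtain ⟨η, s, hη0, hη1, hs, hsη, hRE⟩ := exists_roughEquidistribution
    (δ := θ / (2 * 40 * 48 ^ 2)) (by positivity)
  obtain ⟨C₀, hC₀, hpow⟩ := exists_sum_vonMangoldt_not_prime_le
  set S : ℝ := 48 * (s : ℝ) ^ 2 with hS
  have hs1 : (1 : ℝ) ≤ s := by exact_mod_cast hs
  refine ⟨48 * s ^ 2, 3 + 40 * S ^ 2 + C₀, by nlinarith [sq_nonneg S], ?_⟩
  intro Y hY N N' hN hN' ι I r c hc hr hrY hcard
  have hS1 : 1 ≤ S := by rw [hS]; nlinarith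
  have hY3 : 3 ≤ Y := by nlinarith [sq_nonneg S]
  have hY0 : 0 < Y := by linarith
  set t : ℕ := 16 * s ^ 2 with ht
  have ht0 : 0 < t := by positivity
  have hN0 : (0 : ℝ) < N := lt_of_lt_of_le (by positivity) hN
  set w : ℝ := (N : ℝ) ^ ((t : ℝ)⁻¹) with hw
  have hwN : (N : ℝ) = w ^ t := by rw [hw, Real.rpow_inv_natCast_pow hN0.le ht0.ne']
  have hwY : Y ^ 3 ≤ w := by
    have : (Y ^ 3) ^ t ≤ w ^ t := by
      rw [← hwN, ← pow_mul, ht]; rw [show 3 * (16 * s ^ 2) = 48 * s ^ 2 by ring]; exact hN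
    exact le_of_pow_le_pow_left₀ ht0.ne' (by positivity) this
  have hYw : Y ^ 2 < w := lt_of_lt_of_le (pow_lt_pow_right₀ (by linarith) (by norm_num)) hwY
  have hYw1 : Y < w := lt_of_le_of_lt (le_self_pow₀ (by linarith) two_ne_zero) hYw
  have hw1 : 1 < w := by linarith
  have hw0 : 0 < w := by linarith
  have hwNle : w ≤ N := by rw [hwN]; exact le_self_pow₀ hw1.le ht0.ne'
  have hN3 : 3 ≤ N := by
    have : (3 : ℝ) ≤ N := by linarith
    exact_mod_cast this
  set L := Real.log N with hL
  have hL1 : 1 ≤ L := by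
    rw [hL, Real.le_log_iff_exp_le hN0]
    have := Real.exp_one_lt_d9
    linarith
  have hLw : L = 16 * (s : ℝ) ^ 2 * Real.log w := by
    rw [hL, hwN, Real.log_pow, ht]; push_cast; ring
  set W := w ^ (4 * s) with hW
  set X := (Finset.Ioc 1 N').filter (IsRough W) with hX
  set F : ℕ → ℝ := fun n => ∑ i ∈ I, c i * apDev (r i) n with hF
  have hFle : ∀ n, |F n| ≤ Y := by
    intro n
    calc |F n| ≤ ∑ i ∈ I, |c i * apDev (r i) n| := Finset.abs_sum_le_sum_abs _ _
      _ ≤ ∑ i ∈ I, (1 : ℝ) := by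
        refine Finset.sum_le_sum fun i hi => ?_
        rw [abs_mul]
        exact mul_le_one₀ (hc i hi) (abs_nonneg _) (abs_apDev_le _ _ (hr i hi))
      _ ≤ Y := by simpa using hcard
  have hrw : ∀ i ∈ I, (r i : ℝ) < w := fun i hi => (hrY i hi).trans_lt hYw1
  set μ := ∑ i ∈ I, 1 / ((r i).totient : ℝ) with hμ
  set κ := ∑ q ∈ I ×ˢ I with ¬ (r q.1).Coprime (r q.2),
          1 / ((r q.1).totient : ℝ) * (1 / ((r q.2).totient : ℝ)) with hκ
  have hμ0 : 0 ≤ μ := Finset.sum_nonneg fun _ _ => by positivity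
  have hκ0 : 0 ≤ κ := Finset.sum_nonneg fun _ _ => by positivity
  -- the linear sum
  have hlin : |∑ n ∈ Finset.Ioc N N' with IsRough W n, F n * (Real.log n / n)| ≤
      2 * (24 * s * η * L * μ + Y * (L / w ^ 2)) := by
    have e : ∑ n ∈ Finset.Ioc N N' with IsRough W n, F n * (Real.log n / n) =
        ∑ i ∈ I, c i * ∑ n ∈ Finset.Ioc N N' with IsRough W n,
          apDev (r i) n * (Real.log n / n) := by
      simp only [hF, Finset.sum_mul, Finset.mul_sum]
      rw [Finset.sum_comm]
      refine Finset.sum_congr rfl fun i _ => Finset.sum_congr rfl fun n _ => by ring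
    rw [e]
    calc _ ≤ ∑ i ∈ I, |c i * ∑ n ∈ Finset.Ioc N N' with IsRough W n,
          apDev (r i) n * (Real.log n / n)| := Finset.abs_sum_le_sum_abs _ _
      _ ≤ ∑ i ∈ I, 2 * (24 * s * η * L * (1 / ((r i).totient : ℝ)) + L / w ^ 2) := by
        refine Finset.sum_le_sum fun i hi => ?_
        rw [abs_mul]
        refine (mul_le_of_le_one_left (abs_nonneg _) (hc i hi)).trans ?_
        exact hRE.log_div hη0 hs hw1 hL1 hLw hN3 hwN hN' (hr i hi) (hrw i hi)
      _ = 2 * (24 * s * η * L * μ + I.card * (L / w ^ 2)) := by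
        rw [← Finset.mul_sum, Finset.sum_add_distrib, ← Finset.mul_sum, Finset.sum_const,
          nsmul_eq_mul]
      _ ≤ _ := by gcongr
  -- the bilinear sum
  clear_value S t w L
  have hbil := hRE.bilinear hη0 hη1 hs hw1 hL1 hLw (N := N) hN' I r c hc hr
    (fun i hi j hj => by
      push_cast
      have h1 := hrY i hi
      have h2 := hrY j hj
      calc (r i : ℝ) * r j ≤ Y * Y := by gcongr
        _ = Y ^ 2 := by ring
        _ < w := hYw) X hX
  rw [← hS, ← hμ, ← hκ] at hbil
  clear_value μ κ
  have hroot : √(η * μ ^ 2 + κ + (I.card : ℝ) ^ 2 * (1 / w ^ 2)) ≤ √η * μ + √κ + Y / w := by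
    rw [Real.sqrt_le_left (by positivity)]
    have h1 : √η ^ 2 = η := Real.sq_sqrt hη0
    have h2 : √κ ^ 2 = κ := Real.sq_sqrt hκ0
    have h3 : (I.card : ℝ) ^ 2 * (1 / w ^ 2) ≤ (Y / w) ^ 2 := by
      rw [div_pow, mul_one_div]
      exact div_le_div_of_nonneg_right (pow_le_pow_left₀ (Nat.cast_nonneg _) hcard 2) (sq_nonneg w)
    have h4 : 0 ≤ √η * μ * √κ := by positivity
    have h5 : 0 ≤ √η * μ * (Y / w) := by positivity
    have h6 : 0 ≤ √κ * (Y / w) := by positivity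
    have h7 : (√η * μ) ^ 2 = η * μ ^ 2 := by rw [mul_pow, h1]
    nlinarith
  have hid := sum_rough_log_eq (W := W) (N := N) (N' := N') (by omega) F X hX
  have hFn : ∀ n, ∑ i ∈ I, c i * apDev (r i) n = F n := fun n => rfl
  simp only [hFn] at hbil ⊢
  clear_value F
  -- proper prime powers
  have hWN : W ≤ N := by
    rw [hwN, hW]
    exact pow_le_pow_right₀ hw1.le (by rw [ht]; nlinarith)
  have hprimes : ∑ n ∈ Finset.Ioc N N' with IsRough W n, F n * (vonMangoldt n / n) =
      ∑ p ∈ Finset.Ioc N N' with p.Prime, F p * (Real.log p / p) +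
      ∑ n ∈ (Finset.Ioc N N').filter (IsRough W) with ¬ n.Prime, F n * (vonMangoldt n / n) := by
    rw [← Finset.sum_filter_add_sum_filter_not _ Nat.Prime]
    congr 1
    have : ((Finset.Ioc N N').filter (IsRough W)).filter Nat.Prime =
        (Finset.Ioc N N').filter Nat.Prime := by
      rw [Finset.filter_filter]
      refine Finset.filter_congr fun p hp => ⟨fun h => h.2, fun h => ⟨isRough_iff.2 ?_, h⟩⟩
      intro q hq hqp
      rw [(Nat.prime_dvd_prime_iff_eq hq h).1 hqp]
      rw [Finset.mem_Ioc] at hp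
      have : (N : ℝ) ≤ p := by exact_mod_cast hp.1.le
      linarith
    rw [this]
    refine Finset.sum_congr rfl fun p hp => ?_
    rw [ArithmeticFunction.vonMangoldt_apply_prime (Finset.mem_filter.1 hp).2]
  have hpp : |∑ n ∈ (Finset.Ioc N N').filter (IsRough W) with ¬ n.Prime,
      F n * (vonMangoldt n / n)| ≤ Y * (C₀ / √N) := by
    calc _ ≤ ∑ n ∈ (Finset.Ioc N N').filter (IsRough W) with ¬ n.Prime,
          |F n * (vonMangoldt n / n)| := Finset.abs_sum_le_sum_abs _ _
      _ ≤ ∑ n ∈ Finset.Ioc N N' with ¬ n.Prime, Y * (vonMangoldt n / n) := by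
          refine (Finset.sum_le_sum fun n _ => ?_).trans
            (Finset.sum_le_sum_of_subset_of_nonneg (Finset.filter_subset_filter _
              (Finset.filter_subset _ _)) fun n _ _ => ?_)
          · have h0 : 0 ≤ vonMangoldt n := ArithmeticFunction.vonMangoldt_nonneg
            rw [abs_mul, abs_of_nonneg (by positivity : 0 ≤ vonMangoldt n / (n : ℝ))]
            have := hFle n
            gcongr
          · have h0 : 0 ≤ vonMangoldt n := ArithmeticFunction.vonMangoldt_nonneg
            positivity
      _ ≤ _ := by
          rw [← Finset.mul_sum]
          have := hpow N N' (by omega)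
          gcongr
  have hsqrt : Y ^ 3 ≤ √N := by
    refine Real.le_sqrt_of_sq_le ?_
    refine le_trans (pow_le_pow_left₀ (by positivity) hwY 2) ?_
    rw [hwN]
    exact pow_le_pow_right₀ hw1.le (by rw [ht]; nlinarith)
  have b1 : Y * (L / w ^ 2) ≤ 1 / Y ^ 2 * L := by
    have : Y ^ 3 ≤ w ^ 2 := hwY.trans (le_self_pow₀ hw1.le two_ne_zero)
    calc Y * (L / w ^ 2) ≤ Y * (L / Y ^ 3) := by gcongr
      _ = _ := by field_simp
  have b2 : Y / w ≤ 1 / Y ^ 2 := by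
    calc Y / w ≤ Y / Y ^ 3 := by gcongr
      _ = _ := by field_simp
  have b3 : Y * (C₀ / √N) ≤ C₀ * (1 / Y ^ 2) * L := by
    calc Y * (C₀ / √N) ≤ Y * (C₀ / Y ^ 3) := by gcongr
      _ = C₀ * (1 / Y ^ 2) := by field_simp
      _ ≤ _ := le_mul_of_one_le_right (by positivity) hL1
  have b4 : (2 + 40 * S ^ 2 + C₀) * (1 / Y ^ 2) ≤ 1 / Y := by
    calc (2 + 40 * S ^ 2 + C₀) * (1 / Y ^ 2) ≤ Y * (1 / Y ^ 2) := by
          gcongr; linarith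
      _ = _ := by field_simp
  have b5 : 48 * s * η + 40 * S ^ 2 * √η ≤ θ := by
    have h1 : (s : ℝ) * η ≤ s ^ 4 * √η := by
      have h2 : (s : ℝ) ≤ s ^ 4 := le_self_pow₀ hs1 (by norm_num)
      have h3 : η ≤ √η := Real.le_sqrt_of_sq_le (by nlinarith)
      gcongr
    have h2 : 40 * S ^ 2 * √η = 40 * 48 ^ 2 * (s ^ 4 * √η) := by rw [hS]; ring
    rw [h2]
    rw [le_div_iff₀ (by norm_num)] at hsη
    nlinarith [Real.sqrt_nonneg η, pow_nonneg (by linarith : (0:ℝ) ≤ s) 4]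
  have hbil' : 2 * L * (20 * S ^ 2 * √(η * μ ^ 2 + κ + (I.card : ℝ) ^ 2 * (1 / w ^ 2))) ≤
      2 * L * (20 * S ^ 2 * (√η * μ + √κ + 1 / Y ^ 2)) := by
    have := hroot.trans (add_le_add_right b2 _)
    gcongr
  have hfin : |∑ p ∈ Finset.Ioc N N' with p.Prime, F p * (Real.log p / p)| ≤
      2 * (24 * s * η * L * μ + 1 / Y ^ 2 * L) +
      2 * L * (20 * S ^ 2 * (√η * μ + √κ + 1 / Y ^ 2)) + C₀ * (1 / Y ^ 2) * L := by
    have h1 := hlin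
    have h2 := hbil.trans hbil'
    have h3 := hpp.trans b3
    rw [abs_le] at h1 h2 h3 ⊢
    constructor <;> linarith [h1.1, h1.2, h2.1, h2.2, h3.1, h3.2]
  refine hfin.trans ?_
  have e : 2 * (24 * s * η * L * μ + 1 / Y ^ 2 * L) +
      2 * L * (20 * S ^ 2 * (√η * μ + √κ + 1 / Y ^ 2)) + C₀ * (1 / Y ^ 2) * L =
      ((48 * s * η + 40 * S ^ 2 * √η) * μ + 40 * S ^ 2 * √κ +
        (2 + 40 * S ^ 2 + C₀) * (1 / Y ^ 2)) * L := by ring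
  rw [e]
  gcongr
  linarith

/-- The modulus attached to an ordered pair of primes. -/
def pairModulus (i : ℕ × ℕ) : ℕ := if i.1 = i.2 then i.1 else i.1 * i.2

/-- The weight attached to an ordered pair of primes in the second Bonferroni inequality. -/
noncomputable def pairCoeff (i : ℕ × ℕ) : ℝ := if i.1 = i.2 then 1 else -1 / 2

lemma abs_pairCoeff_le (i : ℕ × ℕ) : |pairCoeff i| ≤ 1 := by
  unfold pairCoeff
  split_ifs <;> norm_num [abs_le]

lemma sum_product_ite (R : Finset ℕ) (f : ℕ → ℝ) (x : ℕ → ℝ) :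
    ∑ i ∈ R ×ˢ R, (if i.1 = i.2 then f i.1 else x i.1 * x i.2) =
      ∑ q ∈ R, f q + (∑ q ∈ R, x q) ^ 2 - ∑ q ∈ R, x q ^ 2 := by
  have h : ∀ q ∈ R, ∑ q' ∈ R, (if q = q' then f q else x q * x q') =
      f q + x q * ∑ q' ∈ R, x q' - x q ^ 2 := by
    intro q hq
    have h1 : ∀ q', (if q = q' then f q else x q * x q') =
        x q * x q' + (if q = q' then f q - x q ^ 2 else 0) := by
      intro q'
      split_ifs with h
      · rw [← h]; ring
      · ring
    simp only [h1, Finset.sum_add_distrib, ← Finset.mul_sum, Finset.sum_ite_eq, hq, if_true]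
    ring
  rw [Finset.sum_product, Finset.sum_congr rfl h, Finset.sum_sub_distrib, Finset.sum_add_distrib,
    ← Finset.sum_mul]
  ring

section

variable {R : Finset ℕ}

lemma one_div_totient_pairModulus (hR : ∀ q ∈ R, q.Prime) {i : ℕ × ℕ} (hi : i ∈ R ×ˢ R) :
    1 / ((pairModulus i).totient : ℝ) =
      if i.1 = i.2 then 1 / ((i.1 : ℝ) - 1) else 1 / ((i.1 : ℝ) - 1) * (1 / ((i.2 : ℝ) - 1)) := by
  rw [Finset.mem_product] at hi
  have h1 := hR _ hi.1
  have h2 := hR _ hi.2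
  unfold pairModulus
  split_ifs with h
  · rw [Nat.totient_prime h1, Nat.cast_sub h1.one_lt.le, Nat.cast_one]
  · rw [Nat.totient_mul ((Nat.coprime_primes h1 h2).2 h), Nat.totient_prime h1,
      Nat.totient_prime h2, Nat.cast_mul, Nat.cast_sub h1.one_lt.le, Nat.cast_sub h2.one_lt.le,
      Nat.cast_one, one_div_mul_one_div]

lemma modEq_pairModulus_iff (hR : ∀ q ∈ R, q.Prime) {i : ℕ × ℕ} (hi : i ∈ R ×ˢ R) (n : ℕ) :
    n ≡ 1 [MOD pairModulus i] ↔ n ≡ 1 [MOD i.1] ∧ n ≡ 1 [MOD i.2] := by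
  rw [Finset.mem_product] at hi
  unfold pairModulus
  split_ifs with h
  · rw [h, and_self]
  · exact (Nat.modEq_and_modEq_iff_modEq_mul
      ((Nat.coprime_primes (hR _ hi.1) (hR _ hi.2)).2 h)).symm

lemma sum_pairCoeff_modEq_le (hR : ∀ q ∈ R, q.Prime) (n : ℕ) :
    ∑ i ∈ R ×ˢ R, pairCoeff i * (if n ≡ 1 [MOD pairModulus i] then 1 else 0) ≤
      if ∃ q ∈ R, n ≡ 1 [MOD q] then 1 else 0 := by
  set x : ℕ → ℝ := fun q => if n ≡ 1 [MOD q] then 1 else 0 with hx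
  have e : ∑ i ∈ R ×ˢ R, pairCoeff i * (if n ≡ 1 [MOD pairModulus i] then 1 else 0) =
      -1 / 2 * ∑ i ∈ R ×ˢ R, (if i.1 = i.2 then -2 * x i.1 else x i.1 * x i.2) := by
    rw [Finset.mul_sum]
    refine Finset.sum_congr rfl fun i hi => ?_
    simp only [modEq_pairModulus_iff hR hi, pairCoeff, hx]
    by_cases h : i.1 = i.2
    · simp only [h, if_true, and_self]; split_ifs <;> norm_num
    · simp only [h, if_false]
      by_cases h1 : n ≡ 1 [MOD i.1] <;> by_cases h2 : n ≡ 1 [MOD i.2] <;> simp [h1, h2]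
  have hsq : ∑ q ∈ R, x q ^ 2 = ∑ q ∈ R, x q := by
    refine Finset.sum_congr rfl fun q _ => ?_
    simp only [hx]; split_ifs <;> norm_num
  rw [e, sum_product_ite R (fun q => -2 * x q) x, ← Finset.mul_sum, hsq]
  have hk : ∑ q ∈ R, x q = ((R.filter fun q => n ≡ 1 [MOD q]).card : ℝ) := by
    rw [Finset.card_filter]; push_cast; rfl
  rw [hk]
  split_ifs with h
  · generalize (R.filter fun q => n ≡ 1 [MOD q]).card = k
    rcases lt_or_ge k 2 with hk2 | hk2
    · interval_cases k <;> norm_num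
    · have : (2 : ℝ) ≤ k := by exact_mod_cast hk2
      nlinarith
  · rw [Finset.filter_false_of_mem (fun q hq hm => h ⟨q, hq, hm⟩)]
    norm_num

lemma le_sum_pairCoeff_div (hR : ∀ q ∈ R, q.Prime) :
    ∑ q ∈ R, 1 / ((q : ℝ) - 1) - (∑ q ∈ R, 1 / ((q : ℝ) - 1)) ^ 2 / 2 ≤
      ∑ i ∈ R ×ˢ R, pairCoeff i * (1 / ((pairModulus i).totient : ℝ)) := by
  set x : ℕ → ℝ := fun q => 1 / ((q : ℝ) - 1) with hx
  have e : ∑ i ∈ R ×ˢ R, pairCoeff i * (1 / ((pairModulus i).totient : ℝ)) =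
      -1 / 2 * ∑ i ∈ R ×ˢ R, (if i.1 = i.2 then -2 * x i.1 else x i.1 * x i.2) := by
    rw [Finset.mul_sum]
    refine Finset.sum_congr rfl fun i hi => ?_
    rw [one_div_totient_pairModulus hR hi, pairCoeff]
    split_ifs
    · simp only [hx]; ring
    · rfl
  rw [e, sum_product_ite R (fun q => -2 * x q) x, ← Finset.mul_sum]
  have : 0 ≤ ∑ q ∈ R, x q ^ 2 := Finset.sum_nonneg fun _ _ => sq_nonneg _
  linarith

lemma sum_one_div_totient_pairModulus_le (hR : ∀ q ∈ R, q.Prime) :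
    ∑ i ∈ R ×ˢ R, 1 / ((pairModulus i).totient : ℝ) ≤
      ∑ q ∈ R, 1 / ((q : ℝ) - 1) + (∑ q ∈ R, 1 / ((q : ℝ) - 1)) ^ 2 := by
  rw [Finset.sum_congr rfl fun i hi => one_div_totient_pairModulus hR hi,
    sum_product_ite R (fun q => 1 / ((q : ℝ) - 1)) (fun q => 1 / ((q : ℝ) - 1))]
  have : 0 ≤ ∑ q ∈ R, (1 / ((q : ℝ) - 1)) ^ 2 := Finset.sum_nonneg fun _ _ => sq_nonneg _
  linarith

lemma sum_dvd_pairModulus_le (hR : ∀ q ∈ R, q.Prime) (h1 : ∑ q ∈ R, 1 / ((q : ℝ) - 1) ≤ 1)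
    {q : ℕ} (hq : q ∈ R) :
    ∑ i ∈ R ×ˢ R with q ∣ pairModulus i, 1 / ((pairModulus i).totient : ℝ) ≤
      4 * (1 / ((q : ℝ) - 1)) := by
  set x : ℕ → ℝ := fun q => 1 / ((q : ℝ) - 1) with hx
  have hx0 : ∀ q ∈ R, 0 ≤ x q := fun q hq => by
    have : (1 : ℝ) < q := by exact_mod_cast (hR q hq).one_lt
    exact one_div_nonneg.2 (by linarith)
  set g : ℕ × ℕ → ℝ := fun i => if i.1 = i.2 then x i.1 else x i.1 * x i.2 with hg
  have hg0 : ∀ i ∈ R ×ˢ R, 0 ≤ g i := by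
    intro i hi
    rw [Finset.mem_product] at hi
    simp only [hg]
    split_ifs
    · exact hx0 _ hi.1
    · exact mul_nonneg (hx0 _ hi.1) (hx0 _ hi.2)
  have hrow : ∀ q ∈ R, ∑ q' ∈ R, g (q, q') ≤ 2 * x q := by
    intro q hq
    calc ∑ q' ∈ R, g (q, q') ≤ ∑ q' ∈ R, ((if q = q' then x q else 0) + x q * x q') := by
          refine Finset.sum_le_sum fun q' hq' => ?_
          have := mul_nonneg (hx0 q hq) (hx0 q' hq')
          simp only [hg]
          split_ifs <;> linarith
      _ = x q + x q * ∑ q' ∈ R, x q' := by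
          rw [Finset.sum_add_distrib, Finset.sum_ite_eq, if_pos hq, Finset.mul_sum]
      _ ≤ x q + x q * 1 := by
          have := hx0 q hq
          gcongr
      _ = _ := by ring
  have hsymm : ∀ q q', g (q', q) = g (q, q') := by
    intro q q'
    simp only [hg]
    by_cases h : q = q'
    · simp [h]
    · rw [if_neg h, if_neg (Ne.symm h), mul_comm]
  have hR2 : ∀ i ∈ R ×ˢ R, q ∣ pairModulus i → i.1 = q ∨ i.2 = q := by
    intro i hi hd
    rw [Finset.mem_product] at hi
    have hqp := hR q hq
    have : q ∣ i.1 ∨ q ∣ i.2 := by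
      unfold pairModulus at hd
      split_ifs at hd
      · exact Or.inl hd
      · exact (Nat.Prime.dvd_mul hqp).1 hd
    refine this.imp (fun h => ?_) (fun h => ?_)
    · exact ((Nat.prime_dvd_prime_iff_eq hqp (hR _ hi.1)).1 h).symm
    · exact ((Nat.prime_dvd_prime_iff_eq hqp (hR _ hi.2)).1 h).symm
  calc _ = ∑ i ∈ R ×ˢ R with q ∣ pairModulus i, g i :=
        Finset.sum_congr rfl fun i hi =>
          one_div_totient_pairModulus hR (Finset.mem_filter.1 hi).1
    _ ≤ ∑ i ∈ R ×ˢ R, ((if i.1 = q then g i else 0) + (if i.2 = q then g i else 0)) := by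
        rw [Finset.sum_filter]
        refine Finset.sum_le_sum fun i hi => ?_
        have := hg0 i hi
        have h2 := hR2 i hi
        split_ifs with ha hb hc <;> (try linarith)
        rcases h2 ha with h | h <;> contradiction
    _ = ∑ q' ∈ R, g (q, q') + ∑ q' ∈ R, g (q', q) := by
        rw [Finset.sum_add_distrib]
        congr 1
        · rw [Finset.sum_product_right]
          exact Finset.sum_congr rfl fun q' _ => by
            simp [hq]
        · rw [Finset.sum_product]
          exact Finset.sum_congr rfl fun q' _ => by
            simp [hq]
    _ ≤ 4 * x q := by
        simp only [hsymm q]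
        linarith [hrow q hq]

lemma sum_not_coprime_pairModulus_le (hR : ∀ q ∈ R, q.Prime)
    (h1 : ∑ q ∈ R, 1 / ((q : ℝ) - 1) ≤ 1) :
    ∑ j ∈ (R ×ˢ R) ×ˢ (R ×ˢ R) with ¬ (pairModulus j.1).Coprime (pairModulus j.2),
      1 / ((pairModulus j.1).totient : ℝ) * (1 / ((pairModulus j.2).totient : ℝ)) ≤
      16 * ∑ q ∈ R, (1 / ((q : ℝ) - 1)) ^ 2 := by
  set v : ℕ × ℕ → ℝ := fun i => 1 / ((pairModulus i).totient : ℝ) with hv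
  have hv0 : ∀ i, 0 ≤ v i := fun i => by positivity
  calc ∑ j ∈ (R ×ˢ R) ×ˢ (R ×ˢ R) with ¬ (pairModulus j.1).Coprime (pairModulus j.2),
        v j.1 * v j.2
      ≤ ∑ j ∈ (R ×ˢ R) ×ˢ (R ×ˢ R), ∑ q ∈ R,
          (if q ∣ pairModulus j.1 then v j.1 else 0) *
            (if q ∣ pairModulus j.2 then v j.2 else 0) := by
        rw [Finset.sum_filter]
        refine Finset.sum_le_sum fun j hj => ?_
        have hnn : ∀ q ∈ R, 0 ≤ (if q ∣ pairModulus j.1 then v j.1 else 0) *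
            (if q ∣ pairModulus j.2 then v j.2 else 0) := by
          intro q _
          have := hv0 j.1
          have := hv0 j.2
          split_ifs <;> positivity
        split_ifs with hc
        · exact Finset.sum_nonneg hnn
        · obtain ⟨q, hq, hd1, hd2⟩ := Nat.Prime.not_coprime_iff_dvd.1 hc
          have hqR : q ∈ R := by
            rw [Finset.mem_product, Finset.mem_product] at hj
            have hp1 := hR _ hj.1.1
            have hp2 := hR _ hj.1.2
            have : q ∣ j.1.1 ∨ q ∣ j.1.2 := by
              unfold pairModulus at hd1
              split_ifs at hd1
              · exact Or.inl hd1
              · exact (Nat.Prime.dvd_mul hq).1 hd1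
            rcases this with h | h
            · rw [(Nat.prime_dvd_prime_iff_eq hq hp1).1 h]; exact hj.1.1
            · rw [(Nat.prime_dvd_prime_iff_eq hq hp2).1 h]; exact hj.1.2
          refine le_trans ?_ (Finset.single_le_sum hnn hqR)
          rw [if_pos hd1, if_pos hd2]
    _ = ∑ q ∈ R, (∑ i ∈ R ×ˢ R with q ∣ pairModulus i, v i) ^ 2 := by
        rw [Finset.sum_comm]
        refine Finset.sum_congr rfl fun q _ => ?_
        rw [Finset.sum_product, sq, Finset.sum_filter, Finset.sum_mul_sum]
    _ ≤ ∑ q ∈ R, (4 * (1 / ((q : ℝ) - 1))) ^ 2 := by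
        refine Finset.sum_le_sum fun q hq => ?_
        exact pow_le_pow_left₀ (Finset.sum_nonneg fun i _ => hv0 i)
          (sum_dvd_pairModulus_le hR h1 hq) 2
    _ = _ := by
        rw [Finset.mul_sum]
        exact Finset.sum_congr rfl fun q _ => by ring

end

lemma sum_sq_primesIoc_le {y ε : ℝ} (hy : 2 ≤ y)
    (h1 : ∑ q ∈ primesIoc y ε, 1 / ((q : ℝ) - 1) ≤ 1) :
    ∑ q ∈ primesIoc y ε, (1 / ((q : ℝ) - 1)) ^ 2 ≤ 2 / y := by
  calc ∑ q ∈ primesIoc y ε, (1 / ((q : ℝ) - 1)) ^ 2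
      ≤ ∑ q ∈ primesIoc y ε, 2 / y * (1 / ((q : ℝ) - 1)) := by
        refine Finset.sum_le_sum fun q hq => ?_
        have hq' := ((mem_primesIoc (by linarith)).1 hq).2.1
        have h0 : 0 ≤ 1 / ((q : ℝ) - 1) := one_div_nonneg.2 (by linarith)
        rw [sq]
        refine mul_le_mul_of_nonneg_right ?_ h0
        rw [div_le_div_iff₀ (by linarith) (by linarith)]
        linarith
    _ ≤ 2 / y * 1 := by
        rw [← Finset.mul_sum]
        have : 0 ≤ 2 / y := by positivity
        gcongr
    _ = _ := mul_one _

lemma sq_rpow_le {y ε : ℝ} (hy : 1 ≤ y) (hε : ε ≤ 1 / 4) : (y ^ (1 + ε)) ^ 2 ≤ y ^ 3 := by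
  rw [← Real.rpow_natCast (y ^ (1 + ε)), ← Real.rpow_mul (by linarith), ← Real.rpow_natCast y 3]
  refine Real.rpow_le_rpow_of_exponent_le hy ?_
  push_cast
  linarith

lemma card_product_primesIoc_le {y ε : ℝ} (hy : 1 ≤ y) (hε : ε ≤ 1 / 4) :
    ((primesIoc y ε ×ˢ primesIoc y ε).card : ℝ) ≤ y ^ 3 := by
  refine le_trans ?_ (sq_rpow_le hy hε)
  rw [Finset.card_product, Nat.cast_mul, ← sq]
  refine pow_le_pow_left₀ (Nat.cast_nonneg _) ?_ 2
  have h : (primesIoc y ε).card ≤ ⌊y ^ (1 + ε)⌋₊ := by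
    refine (Finset.card_filter_le _ _).trans ?_
    rw [Nat.card_Ioc]
    exact Nat.sub_le _ _
  exact (Nat.cast_le.2 h).trans (Nat.floor_le (by positivity))

lemma pairModulus_le {y ε : ℝ} (hy : 1 ≤ y) (hε : ε ≤ 1 / 4) {i : ℕ × ℕ}
    (hi : i ∈ primesIoc y ε ×ˢ primesIoc y ε) : (pairModulus i : ℝ) ≤ y ^ 3 := by
  rw [Finset.mem_product, mem_primesIoc (by linarith), mem_primesIoc (by linarith)] at hi
  refine le_trans ?_ (sq_rpow_le hy hε)
  have h2 : (1 : ℝ) ≤ i.2 := by linarith [hi.2.2.1]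
  have h : (i.1 : ℝ) * i.2 ≤ (y ^ (1 + ε)) ^ 2 := by
    rw [sq]
    exact mul_le_mul hi.1.2.2 hi.2.2.2 (by linarith) (by positivity)
  unfold pairModulus
  split_ifs
  · exact (le_mul_of_one_le_right (Nat.cast_nonneg _) h2).trans h
  · push_cast; exact h

lemma le_sub_sq_div_two {l ε : ℝ} (hε0 : 0 < ε) (hε : ε ≤ 1 / 4) (h : 0.69 * ε ≤ l)
    (h1 : l ≤ 1) : 0.63 * ε ≤ l - l ^ 2 / 2 := by
  have h2 : 0 ≤ (l - 0.69 * ε) * (1 - l) := mul_nonneg (by linarith) (by linarith)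
  have h3 : 0 ≤ (l - 0.69 * ε) * (1 - 0.69 * ε) := mul_nonneg (by linarith) (by linarith)
  have h4 : ε * ε ≤ ε * (1 / 4) := by gcongr
  nlinarith

set_option maxHeartbeats 1000000 in
/-- Primes congruent to `1` modulo some prime of `(y, y ^ (1 + ε)]` have relative density at least
`ε / 2` on logarithmically long blocks beyond a fixed power of `y`. -/
theorem exists_block_bound : ∃ (B : ℕ) (C : ℝ), 1 ≤ B ∧ 1 ≤ C ∧ ∀ y ε : ℝ, 1 < y →
    C ≤ Real.log y → 1 / Real.log y ≤ ε → ε ≤ 1 / 4 → ∀ N N' : ℕ, y ^ B ≤ N →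
    1.099 * Real.log N ≤ Real.log N' → Real.log N' ≤ 1.1 * Real.log N →
    0.05 * ε ≤ ∑ p ∈ Finset.Ioc N N' with p.Prime ∧ ∃ q ∈ primesIoc y ε, p ≡ 1 [MOD q],
      1 / (p : ℝ) := by
  obtain ⟨B, C₀, hC₀, hequi⟩ := exists_prime_equidistribution (θ := 0.001) (by norm_num)
  obtain ⟨C₁, hC₁, hbd⟩ := exists_sum_primesIoc_bounds
  obtain ⟨C₂, hC₂, hmert⟩ := exists_mertens_bounds
  refine ⟨3 * B + 1, C₁ + 28000 * C₀ + 2000 * C₂, by omega, by linarith, ?_⟩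
  intro y ε hy1 hy hε1 hε2 N N' hN hNN' hN'
  set a := Real.log y with ha
  have ha0 : 0 < a := by linarith
  have hy0 : 0 < y := by linarith
  have hε0 : 0 < ε := lt_of_lt_of_le (by positivity) hε1
  obtain ⟨hlam1, hlam2⟩ := hbd y ε hy1 (by linarith) hε1 hε2
  have hay : a ^ 4 / 24 ≤ y := by
    have := Real.pow_div_factorial_le_exp a ha0.le 4
    rw [ha, Real.exp_log hy0, ← ha] at this
    norm_num [Nat.factorial] at this
    exact this
  have haε : 1 ≤ a * ε := by rwa [div_le_iff₀' ha0] at hε1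
  have ha4 : 28000 ^ 3 * a ≤ a ^ 4 := by
    have : (28000 : ℝ) ^ 3 ≤ a ^ 3 := pow_le_pow_left₀ (by norm_num) (by linarith) 3
    calc _ ≤ a ^ 3 * a := by gcongr
      _ = _ := by ring
  have hy84 : 84000 ≤ y := by
    have : (84000 : ℝ) ≤ a := by linarith
    nlinarith
  have hyY : y ≤ y ^ 3 := le_self_pow₀ hy1.le (by norm_num)
  set R := primesIoc y ε with hRdef
  have hmem : ∀ q ∈ R, q.Prime ∧ y < q ∧ (q : ℝ) ≤ y ^ (1 + ε) := fun q hq =>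
    (mem_primesIoc hy0.le).1 hq
  have hR : ∀ q ∈ R, q.Prime := fun q hq => (hmem q hq).1
  set lam := ∑ q ∈ R, 1 / ((q : ℝ) - 1) with hlam
  set μ := ∑ i ∈ R ×ˢ R, 1 / ((pairModulus i).totient : ℝ) with hμ
  set κ := ∑ j ∈ (R ×ˢ R) ×ˢ (R ×ˢ R) with ¬ (pairModulus j.1).Coprime (pairModulus j.2),
      1 / ((pairModulus j.1).totient : ℝ) * (1 / ((pairModulus j.2).totient : ℝ)) with hκ
  set M := ∑ i ∈ R ×ˢ R, pairCoeff i * (1 / ((pairModulus i).totient : ℝ)) with hM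
  have hMle : lam - lam ^ 2 / 2 ≤ M := le_sum_pairCoeff_div hR
  have hμle : μ ≤ lam + lam ^ 2 := sum_one_div_totient_pairModulus_le hR
  have hκle : κ ≤ 32 / y := by
    refine (sum_not_coprime_pairModulus_le hR hlam2).trans ?_
    have := sum_sq_primesIoc_le (by linarith) hlam2
    calc _ ≤ 16 * (2 / y) := by gcongr
      _ = _ := by ring
  have hκs : √κ ≤ 28 / a ^ 2 := by
    rw [Real.sqrt_le_left (by positivity)]
    refine hκle.trans ?_
    rw [div_pow, div_le_div_iff₀ hy0 (by positivity)]
    nlinarith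
  have hN1 : y ≤ N := (le_self_pow₀ hy1.le (by omega)).trans hN
  have hN0 : (0 : ℝ) < N := by linarith
  set L := Real.log N with hL
  have haL : a ≤ L := Real.log_le_log hy0 hN1
  have hL0 : 0 < L := by linarith
  have hN'0 : (0 : ℝ) < N' := by
    rcases Nat.eq_zero_or_pos N' with h | h
    · rw [h, Nat.cast_zero, Real.log_zero] at hNN'; linarith
    · exact_mod_cast h
  have hNleN' : N ≤ N' := by
    have : (N : ℝ) ≤ N' := (Real.log_le_log_iff hN0 hN'0).1 (by linarith)
    exact_mod_cast this
  have hN1' : 1 ≤ N := by exact_mod_cast hN0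
  have heq := hequi (y ^ 3) (by linarith) N N'
    (by
      rw [← pow_mul]
      exact (pow_le_pow_right₀ hy1.le (by omega)).trans hN)
    (by linarith) (ℕ × ℕ) (R ×ˢ R) pairModulus pairCoeff (fun i _ => abs_pairCoeff_le i)
    (fun i hi => by
      rw [Finset.mem_product] at hi
      have h1 := (hR _ hi.1).pos
      have h2 := (hR _ hi.2).pos
      unfold pairModulus
      split_ifs <;> positivity)
    (fun i hi => pairModulus_le hy1.le hε2 hi) (card_product_primesIoc_le hy1.le hε2)
  rw [← hμ, ← hκ, ← hL] at heq
  have hM1 : ∑ p ∈ Finset.Ioc N N' with p.Prime, Real.log p / (p : ℝ) ≥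
      Real.log N' - L - 2 * C₂ := by
    have h1 := (hmert N hN1').2
    have h2 := (hmert N' (hN1'.trans hNleN')).1
    have h3 : ∑ p ∈ Finset.Icc 1 N' with p.Prime, Real.log p / (p : ℝ) =
        ∑ p ∈ Finset.Icc 1 N with p.Prime, Real.log p / (p : ℝ) +
          ∑ p ∈ Finset.Ioc N N' with p.Prime, Real.log p / (p : ℝ) := by
      rw [← Finset.sum_union]
      · rw [← Finset.filter_union]
        congr 2
        ext n
        simp only [Finset.mem_Icc, Finset.mem_union, Finset.mem_Ioc]
        omega
      · rw [Finset.disjoint_left]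
        intro n h1 h2
        simp only [Finset.mem_filter, Finset.mem_Icc, Finset.mem_Ioc] at h1 h2
        omega
    linarith
  have hlow : (∑ p ∈ Finset.Ioc N N' with p.Prime,
        (∑ i ∈ R ×ˢ R, pairCoeff i * apDev (pairModulus i) p) * (Real.log p / p)) +
      M * ∑ p ∈ Finset.Ioc N N' with p.Prime, Real.log p / (p : ℝ) ≤
      ∑ p ∈ Finset.Ioc N N' with p.Prime ∧ ∃ q ∈ R, p ≡ 1 [MOD q], Real.log p / (p : ℝ) := by
    have e : ∑ p ∈ Finset.Ioc N N' with p.Prime ∧ ∃ q ∈ R, p ≡ 1 [MOD q], Real.log p / (p : ℝ) =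
        ∑ p ∈ Finset.Ioc N N' with p.Prime,
          if ∃ q ∈ R, p ≡ 1 [MOD q] then Real.log p / (p : ℝ) else 0 := by
      rw [← Finset.filter_filter, Finset.sum_filter]
    rw [e, Finset.mul_sum, ← Finset.sum_add_distrib]
    refine Finset.sum_le_sum fun p _ => ?_
    have h0 : 0 ≤ Real.log p / (p : ℝ) :=
      div_nonneg (Real.log_natCast_nonneg p) (Nat.cast_nonneg p)
    have h1 := sum_pairCoeff_modEq_le hR p
    have h2 : ∑ i ∈ R ×ˢ R, pairCoeff i * apDev (pairModulus i) p + M =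
        ∑ i ∈ R ×ˢ R, pairCoeff i * (if p ≡ 1 [MOD pairModulus i] then 1 else 0) := by
      rw [hM, ← Finset.sum_add_distrib]
      refine Finset.sum_congr rfl fun i _ => ?_
      rw [apDev]; ring
    rw [← add_mul, h2]
    refine (mul_le_mul_of_nonneg_right h1 h0).trans ?_
    split_ifs <;> simp
  have hup : ∑ p ∈ Finset.Ioc N N' with p.Prime ∧ ∃ q ∈ R, p ≡ 1 [MOD q], Real.log p / (p : ℝ) ≤
      1.1 * L * ∑ p ∈ Finset.Ioc N N' with p.Prime ∧ ∃ q ∈ R, p ≡ 1 [MOD q], 1 / (p : ℝ) := by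
    rw [Finset.mul_sum]
    refine Finset.sum_le_sum fun p hp => ?_
    rw [Finset.mem_filter, Finset.mem_Ioc] at hp
    have h0 : (0 : ℝ) < p := by exact_mod_cast hp.2.1.pos
    have h1 : Real.log p ≤ 1.1 * L :=
      (Real.log_le_log h0 (by exact_mod_cast hp.1.2)).trans hN'
    rw [div_eq_mul_one_div]
    gcongr
  clear_value M μ κ lam L
  set T := ∑ p ∈ Finset.Ioc N N' with p.Prime ∧ ∃ q ∈ R, p ≡ 1 [MOD q], 1 / (p : ℝ)
  set T' := ∑ p ∈ Finset.Ioc N N' with p.Prime ∧ ∃ q ∈ R, p ≡ 1 [MOD q], Real.log p / (p : ℝ)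
  set A := ∑ p ∈ Finset.Ioc N N' with p.Prime, Real.log p / (p : ℝ)
  have hm : 0.63 * ε ≤ lam - lam ^ 2 / 2 := le_sub_sq_div_two hε0 hε2 hlam1 hlam2
  have hμ4 : μ ≤ 4 * (lam - lam ^ 2 / 2) := by
    have : lam ^ 2 ≤ lam := by
      rw [sq]; exact mul_le_of_le_one_left (by linarith) hlam2
    linarith
  have hC0κ : C₀ * √κ ≤ 0.001 * ε := by
    calc C₀ * √κ ≤ C₀ * (28 / a ^ 2) := by gcongr
      _ = 0.001 * (28000 * C₀ / a) * (1 / a) := by field_simp; norm_num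
      _ ≤ 0.001 * 1 * ε := by
        gcongr
        rw [div_le_one ha0]; linarith
      _ = _ := by ring
  have hY : 1 / y ^ 3 ≤ 0.001 * ε := by
    calc 1 / y ^ 3 ≤ 1 / y := by gcongr
      _ ≤ 0.001 * (1 / a) := by
        rw [div_le_iff₀ hy0]
        have : 1000 * a ≤ y := by linarith
        rw [mul_assoc, one_div_mul_eq_div, ← div_le_iff₀' (by norm_num), le_div_iff₀ ha0]
        linarith
      _ ≤ _ := by gcongr
  set m := lam - lam ^ 2 / 2
  have hA : 0.098 * L ≤ A := by linarith
  have hE := (abs_le.1 heq).1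
  have hE2 : (0.001 * μ + C₀ * √κ + 1 / y ^ 3) * L ≤ (0.004 * m + 0.002 * ε) * L :=
    mul_le_mul_of_nonneg_right (by linarith) hL0.le
  have hMA : m * (0.098 * L) ≤ M * A := mul_le_mul hMle hA (by positivity) (by linarith)
  have hT : (1.1 * 0.05 * ε) * L ≤ 1.1 * L * T := by
    have : 0.63 * ε * (0.094 * L) ≤ m * (0.094 * L) := by gcongr
    have h3 : 0 < ε * L := by positivity
    linarith
  have : 0.05 * ε * (1.1 * L) ≤ T * (1.1 * L) := by linarith
  exact le_of_mul_le_mul_right this (by positivity)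

lemma sub_one_le_log_floor_exp {t : ℝ} (ht : 0 ≤ t) : t - 1 ≤ Real.log ⌊Real.exp t⌋₊ := by
  have h1 : 1 ≤ Real.exp t := Real.one_le_exp ht
  have h2 : Real.exp t / 2 ≤ ⌊Real.exp t⌋₊ := by
    have h3 := Nat.lt_floor_add_one (Real.exp t)
    have h4 : (1 : ℝ) ≤ ⌊Real.exp t⌋₊ := by exact_mod_cast Nat.floor_pos.2 h1
    linarith
  have h5 := Real.log_le_log (by positivity) h2
  rw [Real.log_div (by positivity) two_ne_zero, Real.log_exp] at h5
  have := Real.log_two_lt_d9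
  linarith

lemma log_floor_exp_le (t : ℝ) (ht : 0 ≤ t) : Real.log ⌊Real.exp t⌋₊ ≤ t := by
  have h1 : 1 ≤ Real.exp t := Real.one_le_exp ht
  have h4 : (0 : ℝ) < ⌊Real.exp t⌋₊ := by exact_mod_cast Nat.floor_pos.2 h1
  exact (Real.log_le_log h4 (Nat.floor_le (by positivity))).trans (Real.log_exp t).le

/-- The primes congruent to `1` modulo some prime of `(y, y ^ (1 + ε)]` have logarithmic-type
density at least `ε / 2`. -/
theorem exists_sum_inv_ge : ∃ C D : ℝ, 1 ≤ C ∧ 0 ≤ D ∧ ∀ y ε x : ℝ, 1 < y →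
    C ≤ Real.log y → 1 / Real.log y ≤ ε → ε ≤ 1 / 4 → 1 < x →
    ε / 2 * (Real.log (Real.log x / Real.log y) - D) ≤
      ∑ p ∈ Finset.Icc 1 ⌊x⌋₊ with p.Prime ∧ ∃ q ∈ primesIoc y ε, p ≡ 1 [MOD q],
        1 / (p : ℝ) := by
  obtain ⟨B, C, hB, hC, h⟩ := exists_block_bound
  refine ⟨C + 3000, Real.log (B + 1) + 0.1, by linarith,
    add_nonneg (Real.log_nonneg (by simp)) (by norm_num), ?_⟩
  intro y ε x hy1 hy hε1 hε2 hx
  have hB1 : (1 : ℝ) ≤ B := by exact_mod_cast hB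
  set a := Real.log y with ha
  have ha0 : 3000 ≤ a := by linarith
  have hy0 : 0 < y := by linarith
  have hε0 : 0 < ε := lt_of_lt_of_le (by positivity) hε1
  set b : ℝ := (B + 1) * a with hb
  have hb0 : 3000 ≤ b := by nlinarith
  set Nk : ℕ → ℕ := fun k => ⌊Real.exp (b * 1.0995 ^ k)⌋₊ with hNk
  have htk : ∀ k : ℕ, b ≤ b * 1.0995 ^ k := fun k =>
    le_mul_of_one_le_right (by linarith) (one_le_pow₀ (by norm_num))
  have hsum : ∀ k : ℕ, 0.05 * ε * k ≤
      ∑ p ∈ Finset.Icc 1 (Nk k) with p.Prime ∧ ∃ q ∈ primesIoc y ε, p ≡ 1 [MOD q],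
        1 / (p : ℝ) := by
    intro k
    induction k with
    | zero =>
      rw [Nat.cast_zero, mul_zero]
      exact Finset.sum_nonneg fun _ _ => by positivity
    | succ k ih =>
      have ht := htk k
      set t := b * 1.0995 ^ k with htdef
      have hsucc : b * 1.0995 ^ (k + 1) = 1.0995 * t := by rw [pow_succ, htdef]; ring
      have h1 := sub_one_le_log_floor_exp (t := t) (by linarith)
      have h2 := log_floor_exp_le t (by linarith)
      have h3 := sub_one_le_log_floor_exp (t := b * 1.0995 ^ (k + 1)) (by rw [hsucc]; linarith)
      have h4 := log_floor_exp_le (b * 1.0995 ^ (k + 1)) (by rw [hsucc]; linarith)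
      have hN0 : (0 : ℝ) < ⌊Real.exp t⌋₊ := by
        exact_mod_cast Nat.floor_pos.2 (Real.one_le_exp (by linarith))
      have hle : Nk k ≤ Nk (k + 1) := by
        refine Nat.floor_le_floor (Real.exp_le_exp.2 ?_)
        rw [hsucc]; change t ≤ _; linarith
      have hblock := h y ε hy1 (by linarith) hε1 hε2 (Nk k) (Nk (k + 1))
        (by
          change y ^ B ≤ (⌊Real.exp t⌋₊ : ℝ)
          rw [← Real.log_le_log_iff (by positivity) hN0, Real.log_pow]
          have : b = B * a + a := by rw [hb]; ring
          linarith)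
        (by
          change 1.099 * Real.log (⌊Real.exp t⌋₊ : ℝ) ≤ Real.log (⌊Real.exp _⌋₊ : ℝ)
          linarith)
        (by
          change Real.log (⌊Real.exp _⌋₊ : ℝ) ≤ 1.1 * Real.log (⌊Real.exp t⌋₊ : ℝ)
          linarith)
      have hunion : Finset.Icc 1 (Nk (k + 1)) =
          Finset.Icc 1 (Nk k) ∪ Finset.Ioc (Nk k) (Nk (k + 1)) := by
        ext n
        simp only [Finset.mem_Icc, Finset.mem_union, Finset.mem_Ioc]
        omega
      rw [hunion, Finset.filter_union, Finset.sum_union]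
      · push_cast
        linarith
      · rw [Finset.disjoint_left]
        intro n h1 h2
        simp only [Finset.mem_filter, Finset.mem_Icc, Finset.mem_Ioc] at h1 h2
        omega
  have hX : 0 < Real.log x := Real.log_pos hx
  set X := Real.log x with hXdef
  have hlog : Real.log (X / a) - Real.log (B + 1) = Real.log (X / b) := by
    rw [hb, ← Real.log_div (by positivity) (by positivity), div_div, mul_comm a]
  have hle0 : ∀ {v : ℝ}, v ≤ 0 → v ≤
      ∑ p ∈ Finset.Icc 1 ⌊x⌋₊ with p.Prime ∧ ∃ q ∈ primesIoc y ε, p ≡ 1 [MOD q],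
        1 / (p : ℝ) := fun hv => hv.trans (Finset.sum_nonneg fun _ _ => by positivity)
  rw [← sub_sub, hlog]
  rcases le_total (Real.log (X / b)) 0 with hneg | hpos
  · exact hle0 (mul_nonpos_of_nonneg_of_nonpos (by linarith) (by linarith))
  set v := Real.log (X / b) with hv
  set k := ⌊10 * v⌋₊ with hk
  have hk1 : (k : ℝ) ≤ 10 * v := Nat.floor_le (by positivity)
  have hk2 : 10 * v < k + 1 := Nat.lt_floor_add_one _
  have hkX : b * 1.0995 ^ k ≤ X := by
    have h1 : (1.0995 : ℝ) ^ k ≤ Real.exp (0.1 * k) := by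
      rw [mul_comm, Real.exp_nat_mul]
      refine pow_le_pow_left₀ (by norm_num) ?_ k
      have := Real.add_one_le_exp (0.1 : ℝ)
      linarith
    have h2 : Real.exp (0.1 * k) ≤ X / b := by
      rw [← Real.le_log_iff_exp_le (by positivity), ← hv]
      linarith
    rw [← le_div_iff₀' (by linarith)]
    exact h1.trans h2
  have hNx : Nk k ≤ ⌊x⌋₊ := by
    refine Nat.floor_le_floor ?_
    rw [← Real.exp_log (by linarith : 0 < x)]
    exact Real.exp_le_exp.2 hkX
  calc ε / 2 * (v - 0.1) ≤ 0.05 * ε * k := by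
        have : v - 0.1 ≤ 0.1 * k := by linarith
        calc ε / 2 * (v - 0.1) ≤ ε / 2 * (0.1 * k) := by gcongr
          _ = _ := by ring
    _ ≤ _ := hsum k
    _ ≤ _ := by
        refine Finset.sum_le_sum_of_subset_of_nonneg
          (Finset.filter_subset_filter _ (Finset.Icc_subset_Icc_right hNx)) fun _ _ _ => ?_
        positivity

/-- A set of positive integers up to `x` closed under divisors has at most
`O(x / log x) ∑ 1 / n` elements. -/
lemma card_mul_log_le {x : ℝ} (hx : 1 ≤ x) {T : Finset ℕ} (hT0 : ∀ n ∈ T, n ≠ 0)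
    (hTx : ∀ n ∈ T, (n : ℝ) ≤ x) (hTd : ∀ n ∈ T, ∀ m, m ∣ n → m ∈ T) :
    (T.card : ℝ) * Real.log x ≤ (Real.log 4 + 5) * x * ∑ n ∈ T, 1 / (n : ℝ) := by
  have hpos : ∀ n ∈ T, (0 : ℝ) < n := fun n hn => by exact_mod_cast Nat.pos_of_ne_zero (hT0 n hn)
  have h1 : ∑ n ∈ T, Real.log n ≤ (Real.log 4 + 4) * x * ∑ n ∈ T, 1 / (n : ℝ) := by
    calc ∑ n ∈ T, Real.log n = ∑ n ∈ T, ∑ m ∈ n.divisors, vonMangoldt (n / m) := by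
          refine Finset.sum_congr rfl fun n _ => ?_
          rw [Nat.sum_div_divisors, ArithmeticFunction.vonMangoldt_sum]
      _ = ∑ m ∈ T, ∑ n ∈ T with m ∣ n, vonMangoldt (n / m) := by
          refine Finset.sum_comm' fun n m => ?_
          simp only [Nat.mem_divisors, Finset.mem_filter]
          exact ⟨fun h => ⟨⟨h.1, h.2.1⟩, hTd n h.1 m h.2.1⟩,
            fun h => ⟨h.1.1, h.1.2, hT0 n h.1.1⟩⟩
      _ ≤ ∑ m ∈ T, (Real.log 4 + 4) * (x / m) := by
          refine Finset.sum_le_sum fun m hm => ?_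
          have hm0 := hpos m hm
          refine le_trans ?_ (Chebyshev.psi_le_const_mul_self (x := x / m) (by positivity))
          have hinj : Set.InjOn (fun n => n / m) (T.filter fun n => m ∣ n) := by
            intro n₁ h₁ n₂ h₂ he
            rw [Finset.mem_coe, Finset.mem_filter] at h₁ h₂
            rw [← Nat.div_mul_cancel h₁.2, ← Nat.div_mul_cancel h₂.2]
            exact congrArg (· * m) he
          rw [← Finset.sum_image (f := fun d => vonMangoldt d) hinj, Chebyshev.psi]
          refine Finset.sum_le_sum_of_subset_of_nonneg ?_ fun _ _ _ =>
            ArithmeticFunction.vonMangoldt_nonneg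
          intro d hd
          obtain ⟨n, hn, rfl⟩ := Finset.mem_image.1 hd
          rw [Finset.mem_filter] at hn
          have hn0 := Nat.pos_of_ne_zero (hT0 n hn.1)
          have hmp : 0 < m := Nat.pos_of_ne_zero (hT0 m hm)
          rw [Finset.mem_Ioc]
          refine ⟨Nat.div_pos (Nat.le_of_dvd hn0 hn.2) hmp, Nat.le_floor ?_⟩
          rw [Nat.cast_div hn.2 hm0.ne']
          have := hTx n hn.1
          gcongr
      _ = _ := by
          rw [Finset.mul_sum]
          exact Finset.sum_congr rfl fun m _ => by ring
  have h2 : ∑ n ∈ T, Real.log (x / n) ≤ x * ∑ n ∈ T, 1 / (n : ℝ) := by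
    rw [Finset.mul_sum]
    refine Finset.sum_le_sum fun n hn => ?_
    have hn0 := hpos n hn
    rw [mul_one_div]
    exact Real.log_le_self (by positivity)
  have h3 : (T.card : ℝ) * Real.log x = ∑ n ∈ T, Real.log n + ∑ n ∈ T, Real.log (x / n) := by
    rw [← Finset.sum_add_distrib, ← nsmul_eq_mul, ← Finset.sum_const]
    refine Finset.sum_congr rfl fun n hn => ?_
    rw [Real.log_div (by linarith) (hpos n hn).ne']
    ring
  rw [h3]
  linarith

/-- The number of integers up to `x` free of a given set of primes. -/
theorem exists_card_free_le : ∃ C : ℝ, 0 < C ∧ ∀ x : ℝ, 3 ≤ x → ∀ Q : ℕ → Prop,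
    ∀ [DecidablePred Q], ∀ T : Finset ℕ,
    (∀ n, n ∈ T ↔ n ∈ Finset.Icc 1 ⌊x⌋₊ ∧ ∀ p, p.Prime → Q p → ¬ p ∣ n) →
    (T.card : ℝ) ≤
      C * x * Real.exp (-∑ p ∈ Finset.Icc 1 ⌊x⌋₊ with p.Prime ∧ Q p, 1 / (p : ℝ)) := by
  obtain ⟨C, hC⟩ := exists_sum_prime_inv_le
  have h40 : 0 ≤ Real.log 4 := Real.log_nonneg (by norm_num)
  refine ⟨(Real.log 4 + 5) * Real.exp (C + 1), by positivity, fun x hx Q _ T hT => ?_⟩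
  have hlx : 0 < Real.log x := Real.log_pos (by linarith)
  have hN2 : 2 ≤ ⌊x⌋₊ := Nat.le_floor (by push_cast; linarith)
  have hNx : (⌊x⌋₊ : ℝ) ≤ x := Nat.floor_le (by linarith)
  have hN2' : (2 : ℝ) ≤ ⌊x⌋₊ := by exact_mod_cast hN2
  have hlN : 0 < Real.log ⌊x⌋₊ := Real.log_pos (by linarith)
  have hT0 : ∀ n ∈ T, n ≠ 0 := fun n hn => by
    have := (Finset.mem_Icc.1 ((hT n).1 hn).1).1
    omega
  have hTx : ∀ n ∈ T, (n : ℝ) ≤ x := fun n hn =>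
    (Nat.cast_le.2 (Finset.mem_Icc.1 ((hT n).1 hn).1).2).trans hNx
  have h1 := card_mul_log_le (by linarith) hT0 hTx (by
    intro n hn m hmn
    obtain ⟨hn1, hn2⟩ := (hT n).1 hn
    refine (hT m).2 ⟨Finset.mem_Icc.2 ⟨Nat.pos_of_dvd_of_pos hmn (Finset.mem_Icc.1 hn1).1,
      (Nat.le_of_dvd (Finset.mem_Icc.1 hn1).1 hmn).trans (Finset.mem_Icc.1 hn1).2⟩,
      fun p hp hQ hpm => hn2 p hp hQ (hpm.trans hmn)⟩)
  set s := (Finset.Icc 1 ⌊x⌋₊).filter fun p => p.Prime ∧ ¬ Q p with hs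
  have h2 : ∑ n ∈ T, 1 / (n : ℝ) ≤ ∏ p ∈ s with p.Prime, (1 - 1 / (p : ℝ))⁻¹ := by
    refine sum_inv_le_prod hT0 fun n hn p hp hpn => ?_
    obtain ⟨hn1, hn2⟩ := (hT n).1 hn
    rw [hs, Finset.mem_filter, Finset.mem_Icc]
    exact ⟨⟨hp.one_lt.le, (Nat.le_of_dvd (Finset.mem_Icc.1 hn1).1 hpn).trans
      (Finset.mem_Icc.1 hn1).2⟩, hp, fun hQ => hn2 p hp hQ hpn⟩
  have hsp : s.filter Nat.Prime = s :=
    Finset.filter_true_of_mem fun p hp => (Finset.mem_filter.1 hp).2.1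
  rw [hsp] at h2
  have h3 := prod_inv_one_sub_le (P := s) fun p hp => (Finset.mem_filter.1 hp).2.1
  have h4 : ∑ p ∈ s, 1 / (p : ℝ) =
      ∑ p ∈ Finset.Icc 1 ⌊x⌋₊ with p.Prime, 1 / (p : ℝ) -
        ∑ p ∈ Finset.Icc 1 ⌊x⌋₊ with p.Prime ∧ Q p, 1 / (p : ℝ) := by
    rw [eq_sub_iff_add_eq', hs, ← Finset.filter_filter, ← Finset.filter_filter,
      Finset.sum_filter_add_sum_filter_not]
  set σ := ∑ p ∈ Finset.Icc 1 ⌊x⌋₊ with p.Prime ∧ Q p, 1 / (p : ℝ)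
  have h5 := hC ⌊x⌋₊ hN2
  have h6 : ∑ n ∈ T, 1 / (n : ℝ) ≤ Real.exp (C + 1) * Real.exp (-σ) * Real.log x := by
    refine (h2.trans h3).trans ?_
    calc Real.exp (∑ p ∈ s, 1 / (p : ℝ) + 1)
        ≤ Real.exp (C + 1 + -σ + Real.log (Real.log ⌊x⌋₊)) := by
          refine Real.exp_le_exp.2 ?_
          rw [h4]; linarith
      _ = Real.exp (C + 1) * Real.exp (-σ) * Real.log ⌊x⌋₊ := by
          rw [Real.exp_add, Real.exp_add, Real.exp_log hlN]
      _ ≤ _ := by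
          have := Real.log_le_log (by linarith) hNx
          gcongr
  refine le_of_mul_le_mul_right (h1.trans ?_) hlx
  calc (Real.log 4 + 5) * x * ∑ n ∈ T, 1 / (n : ℝ)
      ≤ (Real.log 4 + 5) * x * (Real.exp (C + 1) * Real.exp (-σ) * Real.log x) := by
        gcongr
    _ = _ := by ring

end TotientSieve

open scoped Classical

open Filter

theorem stmt_12 : ∃ C K : ℝ, 0 < C ∧ 0 < K ∧ ∀ᶠ x : ℝ in atTop,
    ∀ g ε : ℝ, C / Real.log x ≤ g → g ≤ 1 / 10 →
      1 / (g * Real.log x) ≤ ε → ε ≤ 1 / 4 →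
      (((Finset.Icc 1 ⌊x⌋₊).filter
        (fun n => ¬ ∃ q : ℕ, q.Prime ∧ q ∣ Nat.totient n ∧
          x ^ g < (q : ℝ) ∧ (q : ℝ) ≤ x ^ (g * (1 + ε)))).card : ℝ) ≤
        K * g ^ (ε / 2) * Real.log (1 / g) * x := by
  obtain ⟨C, D, hC, hD, hsum⟩ := TotientSieve.exists_sum_inv_ge
  obtain ⟨C', hC', hcard⟩ := TotientSieve.exists_card_free_le
  refine ⟨C, C' * Real.exp D, by linarith, by positivity, ?_⟩
  filter_upwards [eventually_ge_atTop 3] with x hx g ε hg hg2 hε1 hε2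
  have hx0 : 0 < x := by linarith
  have hlx : 0 < Real.log x := Real.log_pos (by linarith)
  have hg0 : 0 < g := lt_of_lt_of_le (by positivity) hg
  have hlogy : Real.log (x ^ g) = g * Real.log x := Real.log_rpow hx0 g
  have hy1 : 1 < x ^ g := Real.one_lt_rpow (by linarith) hg0
  have hyε : (x ^ g) ^ (1 + ε) = x ^ (g * (1 + ε)) := by rw [← Real.rpow_mul hx0.le]
  have hε0 : 0 < ε := lt_of_lt_of_le (by positivity) hε1
  have h1 := hsum (x ^ g) ε x hy1 (by rw [hlogy]; rwa [div_le_iff₀ hlx] at hg)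
    (by rwa [hlogy]) hε2 (by linarith)
  rw [hlogy, show Real.log x / (g * Real.log x) = 1 / g by field_simp] at h1
  have hlg : 1 ≤ Real.log (1 / g) := by
    rw [Real.le_log_iff_exp_le (by positivity), le_div_iff₀ hg0]
    have := Real.exp_one_lt_d9
    nlinarith
  have h2 := hcard x hx
    (fun p => ∃ q ∈ TotientSieve.primesIoc (x ^ g) ε, p ≡ 1 [MOD q])
    ((Finset.Icc 1 ⌊x⌋₊).filter fun n => ∀ p : ℕ, p.Prime →
      (∃ q ∈ TotientSieve.primesIoc (x ^ g) ε, p ≡ 1 [MOD q]) → ¬ p ∣ n)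
    (fun n => Finset.mem_filter)
  have h3 : ((Finset.Icc 1 ⌊x⌋₊).filter (fun n => ¬ ∃ q : ℕ, q.Prime ∧ q ∣ Nat.totient n ∧
      x ^ g < (q : ℝ) ∧ (q : ℝ) ≤ x ^ (g * (1 + ε)))).card ≤
      ((Finset.Icc 1 ⌊x⌋₊).filter fun n => ∀ p : ℕ, p.Prime →
      (∃ q ∈ TotientSieve.primesIoc (x ^ g) ε, p ≡ 1 [MOD q]) → ¬ p ∣ n).card := by
    refine Finset.card_le_card fun n hn => ?_
    rw [Finset.mem_filter] at hn ⊢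
    refine ⟨hn.1, fun p hp ⟨q, hq, hpq⟩ hpn => hn.2 ⟨q, ?_⟩⟩
    rw [TotientSieve.mem_primesIoc (by positivity), hyε] at hq
    refine ⟨hq.1, ?_, hq.2⟩
    have hd : q ∣ p - 1 := (Nat.modEq_iff_dvd' hp.one_lt.le).1 hpq.symm
    rw [← Nat.totient_prime hp] at hd
    exact hd.trans (Nat.totient_dvd_of_dvd hpn)
  refine (Nat.cast_le.2 h3).trans (h2.trans ?_)
  have h4 : Real.exp (-∑ p ∈ Finset.Icc 1 ⌊x⌋₊ with p.Prime ∧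
      ∃ q ∈ TotientSieve.primesIoc (x ^ g) ε, p ≡ 1 [MOD q], 1 / (p : ℝ)) ≤
      Real.exp D * g ^ (ε / 2) := by
    rw [Real.rpow_def_of_pos hg0, ← Real.exp_add]
    refine Real.exp_le_exp.2 ?_
    rw [Real.log_div one_ne_zero hg0.ne', Real.log_one] at h1
    have h5 : ε / 2 * D ≤ D := mul_le_of_le_one_left hD (by linarith)
    have h6 : -∑ p ∈ Finset.Icc 1 ⌊x⌋₊ with p.Prime ∧
      ∃ q ∈ TotientSieve.primesIoc (x ^ g) ε, p ≡ 1 [MOD q], 1 / (p : ℝ) ≤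
      -(ε / 2 * (0 - Real.log g - D)) := by
      refine neg_le_neg (h1.trans (le_of_eq ?_))
      congr!
    linarith
  calc C' * x * _ ≤ C' * x * (Real.exp D * g ^ (ε / 2)) := by gcongr
    _ ≤ C' * x * (Real.exp D * g ^ (ε / 2)) * Real.log (1 / g) :=
        le_mul_of_one_le_right (by positivity) hlg
    _ = _ := by ring
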